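/- Let u be a smooth solution of (−Δ)^{3/2}u = 2e^{3u} with finite volume, and define the scalar curvature of the conformal metric g_u = e^{2u}|dx|² by R_{g_u}(x) := −2e^{−2u(x)}(2Δu(x) + |∇u(x)|²). Then u is a spherical solution (i.e. u(x) = log(2λ/(1+λ²|x−x₀|²)) for some λ > 0, x₀ ∈ ℝ³) if and only if liminf_{|x|→∞} R_{g_u}(x) > −∞. -/

import Mathlib

open MeasureTheory Real Filter

noncomputable section

abbrev E3 := EuclideanSpace ℝ (Fin 3)

/-- The Laplacian of `f : ℝ³ → ℝ` as the sum of second partial derivatives. -/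
def lap (f : E3 → ℝ) (x : E3) : ℝ :=
  ∑ i, fderiv ℝ (fun y => fderiv ℝ f y (EuclideanSpace.single i 1)) x (EuclideanSpace.single i 1)

/-- The half Laplacian `(-Δ)^{1/2} φ` of a Schwartz function on ℝ³, defined as a
principal value: `(1/π²) lim_{ε→0⁺} ∫_{|x−y|>ε} (φ(x)−φ(y))/|x−y|⁴ dy`. -/
def halfLap (φ : SchwartzMap E3 ℝ) (x : E3) : ℝ :=
  limUnder (nhdsWithin (0:ℝ) (Set.Ioi 0)) fun ε =>
    (1 / π ^ 2) * ∫ y in {y : E3 | ε < ‖x - y‖}, (φ x - φ y) / ‖x - y‖ ^ 4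

/-- `w ∈ L_{1/2}(ℝ³)`. -/
def MemL12 (w : E3 → ℝ) : Prop :=
  LocallyIntegrable w volume ∧ Integrable (fun x => |w x| / (1 + ‖x‖ ^ 4)) volume

/-- `u` is a smooth solution of `(-Δ)^{3/2} u = 2 e^{3u}` in ℝ³ with finite volume. -/
def IsSolution (u : E3 → ℝ) : Prop :=
  ContDiff ℝ (⊤ : ℕ∞) u ∧ MemL12 (lap u) ∧ Integrable (fun x => exp (3 * u x)) volume ∧
    ∀ φ : SchwartzMap E3 ℝ,
      ∫ x, (-(lap u x)) * halfLap φ x = 2 * ∫ x, exp (3 * u x) * φ x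

/-- `u` is a spherical solution. -/
def IsSpherical (u : E3 → ℝ) : Prop :=
  ∃ lam : ℝ, 0 < lam ∧ ∃ x₀ : E3, ∀ x, u x = log (2 * lam / (1 + lam ^ 2 * ‖x - x₀‖ ^ 2))

/-- `α = (1/π²) ∫ e^{3u}`. -/
def solAlpha (u : E3 → ℝ) : ℝ := (1 / π ^ 2) * ∫ y, exp (3 * u y)

/-- `v(x) = (1/π²) ∫ log(|y|/|x−y|) e^{3u(y)} dy`. -/
def solV (u : E3 → ℝ) (x : E3) : ℝ :=
  (1 / π ^ 2) * ∫ y, log (‖y‖ / ‖x - y‖) * exp (3 * u y)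

end

open scoped FourierTransform SchwartzMap

/-- The `i`-th partial derivative. -/
noncomputable def pd (i : Fin 3) (f : E3 → ℝ) (x : E3) : ℝ :=
  fderiv ℝ f x (EuclideanSpace.single i 1)

theorem weight_pos (x : E3) : 0 < 1 + ‖x‖ ^ 4 := by positivity

theorem continuous_weight : Continuous fun x : E3 => 1 + ‖x‖ ^ 4 := by fun_prop

theorem integrable_weight : Integrable fun x : E3 => 1 / (1 + ‖x‖ ^ 4) := by
  have h := (integrable_one_add_norm (E := E3) (μ := volume) (r := 4)
    (by rw [finrank_euclideanSpace]; norm_num)).const_mul 16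
  refine h.mono' ?_ (.of_forall fun x => ?_)
  · exact (continuous_const.div continuous_weight fun x => (weight_pos x).ne').aestronglyMeasurable
  · have h0 := norm_nonneg x
    rw [norm_of_nonneg (by positivity), rpow_neg (by positivity), div_le_iff₀ (weight_pos x)]
    have : (1 + ‖x‖) ^ (4 : ℝ) = (1 + ‖x‖) ^ 4 := by exact_mod_cast rpow_natCast (1 + ‖x‖) 4
    rw [this, mul_assoc, inv_mul_eq_div, ← mul_div_assoc, le_div_iff₀ (by positivity)]
    nlinarith [sq_nonneg (‖x‖ - 1), sq_nonneg (‖x‖ ^ 2 - 1), sq_nonneg (‖x‖ ^ 2 - ‖x‖),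
      sq_nonneg (‖x‖ + 1), pow_nonneg h0 3]

theorem SchwartzMap.exists_le_weight {F : Type*} [NormedAddCommGroup F] [NormedSpace ℝ F]
    (φ : SchwartzMap E3 F) : ∃ C, 0 ≤ C ∧ ∀ x, ‖φ x‖ ≤ C / (1 + ‖x‖ ^ 4) := by
  obtain ⟨A, hA, hA'⟩ := φ.decay 0 0
  obtain ⟨B, hB, hB'⟩ := φ.decay 4 0
  refine ⟨A + B, by positivity, fun x => ?_⟩
  rw [le_div_iff₀ (weight_pos x)]
  have := hA' x
  have := hB' x
  simp only [norm_iteratedFDeriv_zero, pow_zero, one_mul] at *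
  linarith

theorem integrable_smul_of_weight {F : Type*} [NormedAddCommGroup F] [NormedSpace ℝ F]
    {w : E3 → ℝ} {θ : E3 → F} {C : ℝ}
    (hw : AEStronglyMeasurable w) (hwi : Integrable fun x => |w x| / (1 + ‖x‖ ^ 4))
    (hθ : AEStronglyMeasurable θ) (hb : ∀ x, ‖θ x‖ ≤ C / (1 + ‖x‖ ^ 4)) :
    Integrable fun x => w x • θ x := by
  refine (hwi.const_mul C).mono' (hw.smul hθ) (.of_forall fun x => ?_)
  rw [norm_smul, Real.norm_eq_abs]
  calc |w x| * ‖θ x‖ ≤ |w x| * (C / (1 + ‖x‖ ^ 4)) := by gcongr; exact hb x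
    _ = C * (|w x| / (1 + ‖x‖ ^ 4)) := by ring

/-- The cutoff `ρ(x / (n + 1))`. -/
noncomputable def cutoff (n : ℕ) (x : E3) : ℝ :=
  (⟨1, 2, one_pos, one_lt_two⟩ : ContDiffBump (0 : E3)) (((n : ℝ) + 1)⁻¹ • x)

theorem contDiff_cutoff (n : ℕ) : ContDiff ℝ (⊤ : ℕ∞) (cutoff n) := by
  unfold cutoff
  exact (ContDiffBump.contDiff _).comp (contDiff_const_smul _)

theorem hasCompactSupport_cutoff (n : ℕ) : HasCompactSupport (cutoff n) := by
  unfold cutoff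
  exact (ContDiffBump.hasCompactSupport _).comp_smul (by positivity)

theorem cutoff_mem_Icc (n : ℕ) (x : E3) : cutoff n x ∈ Set.Icc (0 : ℝ) 1 :=
  ⟨ContDiffBump.nonneg _, ContDiffBump.le_one _⟩

theorem tendsto_cutoff (x : E3) : Tendsto (fun n => cutoff n x) atTop (nhds 1) := by
  have h : Tendsto (fun n : ℕ => ((n : ℝ) + 1)⁻¹ • x) atTop (nhds ((0 : ℝ) • x)) :=
    (tendsto_inv_atTop_zero.comp (tendsto_natCast_atTop_atTop.atTop_add
      tendsto_const_nhds)).smul_const x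
  rw [zero_smul] at h
  have h2 := ((ContDiffBump.continuous
    (⟨1, 2, one_pos, one_lt_two⟩ : ContDiffBump (0 : E3))).tendsto 0).comp h
  rwa [ContDiffBump.one_of_mem_closedBall _ (by simp)] at h2

theorem exists_norm_fderiv_cutoff_le :
    ∃ M, 0 ≤ M ∧ ∀ n x, ‖fderiv ℝ (cutoff n) x‖ ≤ M * ((n : ℝ) + 1)⁻¹ := by
  set b : ContDiffBump (0 : E3) := ⟨1, 2, one_pos, one_lt_two⟩ with hb
  obtain ⟨M, hM⟩ := (b.hasCompactSupport.fderiv ℝ).exists_bound_of_continuous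
    ((b.contDiff (n := (⊤ : ℕ∞))).continuous_fderiv (by simp))
  refine ⟨M, (norm_nonneg _).trans (hM 0), fun n x => ?_⟩
  have h1 : HasFDerivAt (cutoff n)
      ((fderiv ℝ b (((n : ℝ) + 1)⁻¹ • x)).comp (((n : ℝ) + 1)⁻¹ • ContinuousLinearMap.id ℝ E3)) x :=
    HasFDerivAt.comp x (((b.contDiff (n := (⊤ : ℕ∞))).differentiable (by simp) _).hasFDerivAt)
      (((((n : ℝ) + 1)⁻¹ • ContinuousLinearMap.id ℝ E3)).hasFDerivAt)
  rw [h1.fderiv, ContinuousLinearMap.comp_smul, ContinuousLinearMap.comp_id, norm_smul,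
    norm_of_nonneg (by positivity), mul_comm]
  gcongr
  exact hM _

theorem norm_single_one (k : Fin 3) : ‖(EuclideanSpace.single k (1 : ℝ) : E3)‖ = 1 := by simp

/-- The divergence theorem on `ℝ³` against a decaying test function, for a vector field which is,
together with its divergence, integrable against `1 / (1 + |x|⁴)`. -/
theorem integral_div_smul_eq_neg {F : Type*} [NormedAddCommGroup F] [NormedSpace ℝ F]
    (Y : Fin 3 → E3 → ℝ) (hY : ∀ k, ContDiff ℝ 1 (Y k))
    (hYi : ∀ k, Integrable fun x => |Y k x| / (1 + ‖x‖ ^ 4))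
    (hD : Integrable fun x => |∑ k, pd k (Y k) x| / (1 + ‖x‖ ^ 4))
    (θ : E3 → F) (hθ : ContDiff ℝ 1 θ) (C : ℝ) (h0 : ∀ x, ‖θ x‖ ≤ C / (1 + ‖x‖ ^ 4))
    (h1 : ∀ x, ‖fderiv ℝ θ x‖ ≤ C / (1 + ‖x‖ ^ 4)) :
    ∫ x, (∑ k, pd k (Y k) x) • θ x =
      -∫ x, ∑ k, Y k x • fderiv ℝ θ x (EuclideanSpace.single k 1) := by
  have hpd : ∀ k, Continuous fun x => pd k (Y k) x := fun k =>
    ((hY k).continuous_fderiv one_ne_zero).clm_apply continuous_const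
  have hθd : ∀ k : Fin 3, Continuous fun x => fderiv ℝ θ x (EuclideanSpace.single k 1) := fun k =>
    (hθ.continuous_fderiv one_ne_zero).clm_apply continuous_const
  have hcd : ∀ n k, Continuous fun x => fderiv ℝ (cutoff n) x (EuclideanSpace.single k 1) :=
    fun n k => ((contDiff_cutoff n).continuous_fderiv (by simp)).clm_apply continuous_const
  have hC : 0 ≤ C := by
    have := (norm_nonneg _).trans (h0 0)
    simpa using this
  obtain ⟨M, hM, hMb⟩ := exists_norm_fderiv_cutoff_le
  have hder : ∀ n x, HasFDerivAt (fun x => cutoff n x • θ x)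
      (cutoff n x • fderiv ℝ θ x + (fderiv ℝ (cutoff n) x).smulRight (θ x)) x := fun n x =>
    (((contDiff_cutoff n).differentiable (by simp) x).hasFDerivAt).smul
      ((hθ.differentiable one_ne_zero x).hasFDerivAt)
  have hcomp : ∀ n, ∫ x, (∑ k, pd k (Y k) x) • (cutoff n x • θ x) =
      -∫ x, ∑ k, Y k x • (cutoff n x • fderiv ℝ θ x (EuclideanSpace.single k 1) +
        fderiv ℝ (cutoff n) x (EuclideanSpace.single k 1) • θ x) := by
    intro n
    have hcs : HasCompactSupport fun x => cutoff n x • θ x :=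
      (hasCompactSupport_cutoff n).smul_right
    have hcs2 : HasCompactSupport fun x => fderiv ℝ (fun x => cutoff n x • θ x) x := hcs.fderiv ℝ
    have hcd1 : ContDiff ℝ 1 fun x => cutoff n x • θ x := ((contDiff_cutoff n).of_le (by simp)).smul hθ
    have i1 : ∀ k, Integrable fun x => pd k (Y k) x • (cutoff n x • θ x) := fun k =>
      ((hpd k).smul hcd1.continuous).integrable_of_hasCompactSupport hcs.smul_left
    have i2 : ∀ k, Integrable fun x => Y k x •
        fderiv ℝ (fun x => cutoff n x • θ x) x (EuclideanSpace.single k 1) := fun k =>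
      ((hY k).continuous.smul ((hcd1.continuous_fderiv one_ne_zero).clm_apply
        continuous_const)).integrable_of_hasCompactSupport
        (HasCompactSupport.smul_left (hcs2.comp_left (g := fun L : E3 →L[ℝ] F =>
          L (EuclideanSpace.single k 1)) rfl))
    have i3 : ∀ k, Integrable fun x => Y k x • (cutoff n x • θ x) := fun k =>
      ((hY k).continuous.smul hcd1.continuous).integrable_of_hasCompactSupport hcs.smul_left
    have e1 : ∀ x, ∑ k, Y k x • (cutoff n x • fderiv ℝ θ x (EuclideanSpace.single k 1) +
        fderiv ℝ (cutoff n) x (EuclideanSpace.single k 1) • θ x) =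
        ∑ k, Y k x • fderiv ℝ (fun x => cutoff n x • θ x) x (EuclideanSpace.single k 1) := by
      intro x
      simp [(hder n x).fderiv]
    simp_rw [e1, Finset.sum_smul]
    rw [integral_finsetSum _ fun k _ => i1 k, integral_finsetSum _ fun k _ => i2 k,
      ← Finset.sum_neg_distrib]
    refine Finset.sum_congr rfl fun k _ => ?_
    rw [integral_smul_fderiv_eq_neg_fderiv_smul_of_integrable (i1 k) (i2 k) (i3 k)
      (fun x _ => (hY k).differentiable one_ne_zero x)
      (fun x _ => hcd1.differentiable one_ne_zero x), neg_neg]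
    rfl
  have l1 : Tendsto (fun n => ∫ x, (∑ k, pd k (Y k) x) • (cutoff n x • θ x)) atTop
      (nhds (∫ x, (∑ k, pd k (Y k) x) • θ x)) := by
    refine tendsto_integral_of_dominated_convergence
      (fun x => C * (|∑ k, pd k (Y k) x| / (1 + ‖x‖ ^ 4))) (fun n => ?_) (hD.const_mul C)
      (fun n => .of_forall fun x => ?_) (.of_forall fun x => ?_)
    · exact ((continuous_finsetSum _ fun k _ => hpd k).smul
        ((contDiff_cutoff n).continuous.smul hθ.continuous)).aestronglyMeasurable
    · have hc := cutoff_mem_Icc n x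
      rw [norm_smul, norm_smul, Real.norm_eq_abs, norm_of_nonneg hc.1]
      calc |∑ k, pd k (Y k) x| * (cutoff n x * ‖θ x‖)
          ≤ |∑ k, pd k (Y k) x| * (1 * (C / (1 + ‖x‖ ^ 4))) := by
            gcongr
            · exact hc.2
            · exact h0 x
        _ = _ := by ring
    · simpa using ((tendsto_cutoff x).smul_const (θ x)).const_smul (∑ k, pd k (Y k) x)
  have l2 : Tendsto (fun n => ∫ x, ∑ k, Y k x • (cutoff n x •
        fderiv ℝ θ x (EuclideanSpace.single k 1) +
        fderiv ℝ (cutoff n) x (EuclideanSpace.single k 1) • θ x)) atTop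
      (nhds (∫ x, ∑ k, Y k x • fderiv ℝ θ x (EuclideanSpace.single k 1))) := by
    refine tendsto_integral_of_dominated_convergence
      (fun x => ∑ k, (C + M * C) * (|Y k x| / (1 + ‖x‖ ^ 4))) (fun n => ?_)
      (integrable_finsetSum _ fun k _ => (hYi k).const_mul _)
      (fun n => .of_forall fun x => ?_) (.of_forall fun x => ?_)
    · refine (continuous_finsetSum _ fun k _ => (hY k).continuous.smul
        (((contDiff_cutoff n).continuous.smul (hθd k)).add
          ((hcd n k).smul hθ.continuous))).aestronglyMeasurable
    · refine (norm_sum_le _ _).trans (Finset.sum_le_sum fun k _ => ?_)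
      have hc := cutoff_mem_Icc n x
      have b1 : ‖fderiv ℝ θ x (EuclideanSpace.single k 1)‖ ≤ C / (1 + ‖x‖ ^ 4) := by
        refine ((fderiv ℝ θ x).le_opNorm _).trans ?_
        rw [norm_single_one, mul_one]
        exact h1 x
      have b2 : ‖fderiv ℝ (cutoff n) x (EuclideanSpace.single k 1)‖ ≤ M := by
        refine ((fderiv ℝ (cutoff n) x).le_opNorm _).trans ?_
        rw [norm_single_one, mul_one]
        refine (hMb n x).trans (mul_le_of_le_one_right hM (inv_le_one_of_one_le₀ ?_))
        linarith [n.cast_nonneg (α := ℝ)]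
      rw [norm_smul, Real.norm_eq_abs]
      calc _ ≤ |Y k x| * (1 * (C / (1 + ‖x‖ ^ 4)) + M * (C / (1 + ‖x‖ ^ 4))) := by
            gcongr
            refine (norm_add_le _ _).trans ?_
            rw [norm_smul, norm_smul, norm_of_nonneg hc.1]
            gcongr
            · exact hc.2
            · exact h0 x
        _ = _ := by ring
    · refine tendsto_finsetSum _ fun k _ => ?_
      have t1 := (tendsto_cutoff x).smul_const (fderiv ℝ θ x (EuclideanSpace.single k 1))
      have t2 : Tendsto (fun n => fderiv ℝ (cutoff n) x (EuclideanSpace.single k 1)) atTop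
          (nhds 0) := by
        refine squeeze_zero_norm (a := fun n : ℕ => M * ((n : ℝ) + 1)⁻¹) (fun n => ?_) ?_
        · refine ((fderiv ℝ (cutoff n) x).le_opNorm _).trans ?_
          rw [norm_single_one, mul_one]
          exact hMb n x
        · simpa using (tendsto_inv_atTop_zero.comp (tendsto_natCast_atTop_atTop.atTop_add
            (tendsto_const_nhds (x := (1 : ℝ))))).const_mul M
      simpa using (t1.add (t2.smul_const (θ x))).const_smul (Y k x)
  have l3 := l2.neg
  simp_rw [← hcomp] at l3
  exact tendsto_nhds_unique l1 l3

theorem SchwartzMap.exists_fderiv_le_weight {F : Type*} [NormedAddCommGroup F] [NormedSpace ℝ F]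
    (φ : SchwartzMap E3 F) : ∃ C, 0 ≤ C ∧ ∀ x, ‖fderiv ℝ φ x‖ ≤ C / (1 + ‖x‖ ^ 4) := by
  obtain ⟨C, hC, h⟩ := (SchwartzMap.fderivCLM ℝ E3 F φ).exists_le_weight
  exact ⟨C, hC, fun x => by simpa using h x⟩

/-- A bump function equal to `1` near the origin, as a Schwartz function. -/
noncomputable def schwartzBump : 𝓢(E3, ℂ) :=
  HasCompactSupport.toSchwartzMap
    (f := fun x => (((⟨1, 2, one_pos, one_lt_two⟩ : ContDiffBump (0 : E3)) x : ℝ) : ℂ))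
    ((ContDiffBump.hasCompactSupport _).comp_left (g := fun t : ℝ => (t : ℂ)) rfl)
    (Complex.ofRealCLM.contDiff.comp (ContDiffBump.contDiff _))

theorem schwartzBump_of_norm_le {x : E3} (hx : ‖x‖ ≤ 1) : schwartzBump x = 1 := by
  have : (⟨1, 2, one_pos, one_lt_two⟩ : ContDiffBump (0 : E3)) x = 1 :=
    ContDiffBump.one_of_mem_closedBall _ (by simpa using hx)
  change (((⟨1, 2, one_pos, one_lt_two⟩ : ContDiffBump (0 : E3)) x : ℝ) : ℂ) = 1
  rw [this, Complex.ofReal_one]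

theorem hasCompactSupport_schwartzBump : HasCompactSupport schwartzBump :=
  (ContDiffBump.hasCompactSupport _).comp_left (g := fun t : ℝ => (t : ℂ)) rfl

/-- The function `b(ξ / a) e^{-2πi ⟨ξ, x₀⟩}`, with `b` the bump function. -/
noncomputable def modulatedBump (a : ℝ) (x₀ : E3) (ξ : E3) : ℂ :=
  schwartzBump (a⁻¹ • ξ) * Complex.exp (-(2 * π * inner ℝ ξ x₀ : ℝ) * Complex.I)

theorem contDiff_modulatedBump (a : ℝ) (x₀ : E3) : ContDiff ℝ (⊤ : ℕ∞) (modulatedBump a x₀) := by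
  unfold modulatedBump
  refine ((schwartzBump.smooth ⊤).comp (contDiff_const_smul _)).mul ?_
  refine ContDiff.cexp ((ContDiff.neg ?_).mul contDiff_const)
  exact Complex.ofRealCLM.contDiff.comp (contDiff_const.mul (contDiff_id.inner ℝ contDiff_const))

theorem hasCompactSupport_modulatedBump {a : ℝ} (ha : 0 < a) (x₀ : E3) :
    HasCompactSupport (modulatedBump a x₀) :=
  (hasCompactSupport_schwartzBump.comp_smul (inv_ne_zero ha.ne')).mul_right

/-- `modulatedBump` as a Schwartz function. -/
noncomputable def modulatedBumpS {a : ℝ} (ha : 0 < a) (x₀ : E3) : 𝓢(E3, ℂ) :=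
  (hasCompactSupport_modulatedBump ha x₀).toSchwartzMap (contDiff_modulatedBump a x₀)

theorem modulatedBump_of_norm_le {a : ℝ} (ha : 0 < a) (x₀ : E3) {ξ : E3} (h : ‖ξ‖ ≤ a) :
    modulatedBump a x₀ ξ = Complex.exp (-(2 * π * inner ℝ ξ x₀ : ℝ) * Complex.I) := by
  rw [modulatedBump, schwartzBump_of_norm_le, one_mul]
  rw [norm_smul, norm_of_nonneg (by positivity), inv_mul_le_one₀ ha]
  exact h

/-- The inverse Fourier transform of the bump function. -/
noncomputable def bumpKernel : 𝓢(E3, ℂ) := 𝓕⁻ schwartzBump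

theorem fourierInv_modulatedBumpS {a : ℝ} (ha : 0 < a) (x₀ x : E3) :
    (𝓕⁻ (modulatedBumpS ha x₀)) x = a ^ 3 • bumpKernel (a • (x - x₀)) := by
  rw [bumpKernel]
  rw [SchwartzMap.fourierInv_coe, SchwartzMap.fourierInv_coe, Real.fourierInv_eq',
    Real.fourierInv_eq']
  have key := Measure.integral_comp_smul (volume : Measure E3) (fun v : E3 =>
    Complex.exp ((↑(2 * π * inner ℝ v (a • (x - x₀))) * Complex.I)) • schwartzBump v) a⁻¹
  rw [finrank_euclideanSpace, Fintype.card_fin, abs_of_pos (by positivity), inv_pow, inv_inv] at key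
  rw [← key]
  congr 1 with v
  change Complex.exp _ • modulatedBump a x₀ v = _
  rw [modulatedBump, smul_eq_mul, smul_eq_mul, mul_comm (schwartzBump _), ← mul_assoc,
    ← Complex.exp_add]
  congr 2
  rw [inner_smul_left, inner_smul_right, inner_sub_right]
  simp only [conj_trivial]
  rw [inv_mul_cancel_left₀ ha.ne']
  push_cast
  ring

theorem integral_bumpKernel : ∫ x, bumpKernel x = 1 := by
  rw [bumpKernel]
  have h : 𝓕 (𝓕⁻ schwartzBump) = schwartzBump := FourierInvPair.fourier_fourierInv_eq _
  have h0 := DFunLike.congr_fun h 0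
  rw [SchwartzMap.fourier_coe, Real.fourier_eq', schwartzBump_of_norm_le (by simp)] at h0
  simpa using h0

theorem norm_fourierInv_modulatedBumpS_sub_le (x₀ : E3) : ∃ K, 0 ≤ K ∧
    ∀ ε (hε : 0 < ε), ε ≤ 1 → ∀ x,
      ‖(𝓕⁻ (modulatedBumpS hε x₀)) x - (𝓕⁻ (modulatedBumpS hε 0)) x‖ ≤ K / (1 + ‖x‖ ^ 4) ∧
      ‖(𝓕⁻ (modulatedBumpS hε x₀)) x - (𝓕⁻ (modulatedBumpS hε 0)) x‖ ≤ K * ε := by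
  obtain ⟨C, hC, hd⟩ := bumpKernel.exists_fderiv_le_weight
  set X := ‖x₀‖ with hX
  have hX0 : 0 ≤ X := norm_nonneg _
  refine ⟨C * X * (17 + 16 * X ^ 4), by positivity, fun ε hε hε1 x => ?_⟩
  rw [fourierInv_modulatedBumpS, fourierInv_modulatedBumpS, ← smul_sub, norm_smul, sub_zero,
    norm_of_nonneg (by positivity)]
  have hdiff : ∀ B, (∀ z ∈ segment ℝ (ε • x) (ε • (x - x₀)),
      ‖fderiv ℝ bumpKernel z‖ ≤ B) →
      ‖bumpKernel (ε • (x - x₀)) - bumpKernel (ε • x)‖ ≤ B * (ε * X) := by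
    intro B hB
    have := Convex.norm_image_sub_le_of_norm_fderiv_le (𝕜 := ℝ) (f := bumpKernel)
      (fun z _ => bumpKernel.differentiableAt) hB (convex_segment _ _)
      (left_mem_segment _ _ _) (right_mem_segment _ _ _)
    refine this.trans (le_of_eq ?_)
    rw [← smul_sub, sub_sub_cancel_left, norm_smul, norm_neg, norm_of_nonneg hε.le]
  have hunif : ∀ z, ‖fderiv ℝ bumpKernel z‖ ≤ C := fun z => by
    refine (hd z).trans (div_le_self hC ?_)
    have := pow_nonneg (norm_nonneg z) 4
    linarith
  have h1 := hdiff C fun z _ => hunif z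
  have he3 : ε ^ 3 ≤ 1 := pow_le_one₀ hε.le hε1
  have he4 : ε ^ 4 ≤ 1 := pow_le_one₀ hε.le hε1
  constructor
  · rw [le_div_iff₀ (weight_pos x)]
    rcases le_total ‖x‖ (2 * X) with hx | hx
    · have hx4 : ‖x‖ ^ 4 ≤ (2 * X) ^ 4 := by gcongr
      calc _ ≤ ε ^ 3 * (C * (ε * X)) * (1 + (2 * X) ^ 4) := by gcongr
        _ = ε ^ 4 * (C * X * (1 + 16 * X ^ 4)) := by ring
        _ ≤ 1 * (C * X * (17 + 16 * X ^ 4)) := by gcongr; norm_num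
        _ = _ := one_mul _
    · have h2 := hdiff (16 * C / (1 + ε ^ 4 * ‖x‖ ^ 4)) fun z hz => by
        obtain ⟨a, b, ha, hb, hab, rfl⟩ := hz
        refine (hd _).trans ?_
        have hlow : ε * ‖x‖ / 2 ≤ ‖a • ε • x + b • ε • (x - x₀)‖ := by
          have e : a • ε • x + b • ε • (x - x₀) = ε • (x - b • x₀) := by
            have : a = 1 - b := by linarith
            subst this
            module
          rw [e, norm_smul, norm_of_nonneg hε.le, mul_div_assoc]
          gcongr
          have hb1 : b ≤ 1 := by linarith
          have t1 := norm_sub_norm_le x (b • x₀)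
          rw [norm_smul, norm_of_nonneg hb, ← hX] at t1
          nlinarith
        rw [div_le_div_iff₀ (weight_pos _) (by positivity)]
        have h4 : (ε * ‖x‖ / 2) ^ 4 ≤ ‖a • ε • x + b • ε • (x - x₀)‖ ^ 4 := by gcongr
        have : ε ^ 4 * ‖x‖ ^ 4 = 16 * (ε * ‖x‖ / 2) ^ 4 := by ring
        nlinarith
      calc _ ≤ ε ^ 3 * (16 * C / (1 + ε ^ 4 * ‖x‖ ^ 4) * (ε * X)) * (1 + ‖x‖ ^ 4) := by gcongr
        _ = 16 * C * X * (ε ^ 4 * (1 + ‖x‖ ^ 4) / (1 + ε ^ 4 * ‖x‖ ^ 4)) := by ring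
        _ ≤ 16 * C * X * 1 := by
            gcongr
            rw [div_le_one (by positivity)]
            nlinarith
        _ ≤ _ := by
            rw [mul_comm (16 : ℝ), mul_one, mul_right_comm]
            gcongr
            have := pow_nonneg hX0 4
            linarith
  · calc _ ≤ ε ^ 3 * (C * (ε * X)) := by gcongr
      _ = ε ^ 3 * (C * X * 1) * ε := by ring
      _ ≤ 1 * (C * X * (17 + 16 * X ^ 4)) * ε := by
          gcongr
          have := pow_nonneg hX0 4
          linarith
      _ = _ := by ring

theorem tendsto_integral_fourierInv_modulatedBumpS {w : E3 → ℝ} (hw : Continuous w)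
    (hwi : Integrable fun x => |w x| / (1 + ‖x‖ ^ 4)) (x₀ : E3) :
    Tendsto (fun n : ℕ => ∫ x, w x • (𝓕⁻ (modulatedBumpS n.cast_add_one_pos x₀)) x) atTop
      (nhds ((w x₀ : ℝ) : ℂ)) := by
  set η : 𝓢(E3, ℂ) := bumpKernel with hη
  obtain ⟨C, hC, hd⟩ := η.exists_le_weight
  set B : Set E3 := Metric.closedBall x₀ 1 with hB
  have hBm : MeasurableSet B := Metric.isClosed_closedBall.measurableSet
  have hint : ∀ n : ℕ, Integrable fun x => w x • (𝓕⁻ (modulatedBumpS n.cast_add_one_pos x₀)) x := by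
    intro n
    obtain ⟨C', _, h'⟩ := (𝓕⁻ (modulatedBumpS (Nat.cast_add_one_pos (α := ℝ) n) x₀)).exists_le_weight
    exact integrable_smul_of_weight hw.aestronglyMeasurable hwi
      (SchwartzMap.continuous _).aestronglyMeasurable h'
  have far : Tendsto (fun n : ℕ => ∫ x in Bᶜ, w x • (𝓕⁻ (modulatedBumpS n.cast_add_one_pos x₀)) x)
      atTop (nhds 0) := by
    set K := 1 + (1 + ‖x₀‖) ^ 4 with hK
    have hcmp : ∀ x ∈ Bᶜ, 1 + ‖x‖ ^ 4 ≤ K * ‖x - x₀‖ ^ 4 := by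
      intro x hx
      have h1 : 1 ≤ ‖x - x₀‖ := by
        rw [hB, Set.mem_compl_iff, mem_closedBall_iff_norm, not_le] at hx
        exact hx.le
      have h2 : ‖x‖ ≤ (1 + ‖x₀‖) * ‖x - x₀‖ := by
        have := norm_le_norm_add_norm_sub' x x₀
        nlinarith [norm_nonneg x₀]
      calc 1 + ‖x‖ ^ 4 ≤ 1 * ‖x - x₀‖ ^ 4 + ((1 + ‖x₀‖) * ‖x - x₀‖) ^ 4 := by
            gcongr
            rw [one_mul]
            exact one_le_pow₀ h1
        _ = _ := by rw [hK]; ring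
    have hbd : ∀ (n : ℕ), ∀ x ∈ Bᶜ, ‖w x • (𝓕⁻ (modulatedBumpS n.cast_add_one_pos x₀)) x‖ ≤
        C * K * ((n : ℝ) + 1)⁻¹ * (|w x| / (1 + ‖x‖ ^ 4)) := by
      intro n x hx
      have hn : (0 : ℝ) < n + 1 := n.cast_add_one_pos
      have hx1 : 0 < ‖x - x₀‖ := by
        have := hcmp x hx
        have h2 := weight_pos x
        by_contra h
        have : ‖x - x₀‖ = 0 := le_antisymm (not_lt.mp h) (norm_nonneg _)
        simp [this] at *
        linarith
      rw [norm_smul, Real.norm_eq_abs, fourierInv_modulatedBumpS, norm_smul,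
        norm_of_nonneg (by positivity)]
      have h3 : ‖η (((n : ℝ) + 1) • (x - x₀))‖ ≤ C * K / (((n : ℝ) + 1) ^ 4 * (1 + ‖x‖ ^ 4)) := by
        refine (hd _).trans ?_
        rw [norm_smul, norm_of_nonneg hn.le, mul_pow, div_le_div_iff₀ (by positivity)
          (by have := weight_pos x; positivity)]
        have := hcmp x hx
        calc C * (((n : ℝ) + 1) ^ 4 * (1 + ‖x‖ ^ 4))
            ≤ C * (((n : ℝ) + 1) ^ 4 * (K * ‖x - x₀‖ ^ 4)) := by gcongr
          _ = C * K * (((n : ℝ) + 1) ^ 4 * ‖x - x₀‖ ^ 4) := by ring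
          _ ≤ _ := by gcongr; linarith
      calc _ ≤ |w x| * (((n : ℝ) + 1) ^ 3 * (C * K / (((n : ℝ) + 1) ^ 4 * (1 + ‖x‖ ^ 4)))) := by
            gcongr
        _ = _ := by
            have := (weight_pos x).ne'
            field_simp
    refine squeeze_zero_norm (a := fun n : ℕ => ((n : ℝ) + 1)⁻¹ *
      ∫ x in Bᶜ, C * K * (|w x| / (1 + ‖x‖ ^ 4))) (fun n => ?_) ?_
    · rw [← integral_const_mul]
      refine norm_integral_le_of_norm_le (((hwi.const_mul _).const_mul _).integrableOn) ?_
      refine (ae_restrict_mem hBm.compl).mono fun x hx => (hbd n x hx).trans (le_of_eq ?_)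
      ring
    · simpa using (tendsto_inv_atTop_zero.comp (tendsto_natCast_atTop_atTop.atTop_add
            (tendsto_const_nhds (x := (1 : ℝ))))).mul_const _
  have near : Tendsto (fun n : ℕ => ∫ x in B, w x • (𝓕⁻ (modulatedBumpS n.cast_add_one_pos x₀)) x)
      atTop (nhds (∫ z, w x₀ • η z)) := by
    obtain ⟨M, hM⟩ := (isCompact_closedBall x₀ 1).exists_bound_of_continuousOn hw.continuousOn
    have hM0 : 0 ≤ M := (norm_nonneg _).trans (hM x₀ (by simp))
    have heq : ∀ n : ℕ, ∫ x in B, w x • (𝓕⁻ (modulatedBumpS n.cast_add_one_pos x₀)) x =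
        ∫ z, (B.indicator w (x₀ + ((n : ℝ) + 1)⁻¹ • z)) • η z := by
      intro n
      have hn : (0 : ℝ) < n + 1 := n.cast_add_one_pos
      have key := Measure.integral_comp_smul (volume : Measure E3) (fun z : E3 =>
        (B.indicator w (x₀ + ((n : ℝ) + 1)⁻¹ • z)) • η z) ((n : ℝ) + 1)
      rw [finrank_euclideanSpace, Fintype.card_fin, abs_of_pos (by positivity)] at key
      rw [← integral_indicator hBm]
      have : ∀ x, B.indicator (fun x => w x • (𝓕⁻ (modulatedBumpS hn x₀)) x) x =
          (fun y => ((n : ℝ) + 1) ^ 3 • (B.indicator w (x₀ + ((n : ℝ) + 1)⁻¹ • (((n : ℝ) + 1) • y))) •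
            η (((n : ℝ) + 1) • y)) (x - x₀) := by
        intro x
        simp only
        rw [inv_smul_smul₀ hn.ne', add_sub_cancel]
        by_cases hx : x ∈ B
        · rw [Set.indicator_of_mem hx, Set.indicator_of_mem hx, fourierInv_modulatedBumpS, smul_comm]
        · rw [Set.indicator_of_notMem hx, Set.indicator_of_notMem hx, zero_smul, smul_zero]
      simp_rw [this]
      rw [integral_sub_right_eq_self (μ := volume) (fun y => ((n : ℝ) + 1) ^ 3 •
        (B.indicator w (x₀ + ((n : ℝ) + 1)⁻¹ • (((n : ℝ) + 1) • y))) • η (((n : ℝ) + 1) • y)) x₀,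
        integral_smul, key, smul_inv_smul₀ (by positivity)]
    simp_rw [heq]
    refine tendsto_integral_of_dominated_convergence (fun z => M * ‖η z‖) (fun n => ?_)
      (η.integrable.norm.const_mul M) (fun n => .of_forall fun z => ?_) (.of_forall fun z => ?_)
    · refine AEStronglyMeasurable.fun_smul ?_ η.continuous.aestronglyMeasurable
      exact ((hw.measurable.indicator hBm).comp (by fun_prop)).aestronglyMeasurable
    · rw [norm_smul]
      gcongr
      by_cases hx : x₀ + ((n : ℝ) + 1)⁻¹ • z ∈ B
      · rw [Set.indicator_of_mem hx]
        exact hM _ hx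
      · rw [Set.indicator_of_notMem hx, norm_zero]
        exact hM0
    · refine Tendsto.smul_const ?_ _
      have h : Tendsto (fun n : ℕ => x₀ + ((n : ℝ) + 1)⁻¹ • z) atTop (nhds (x₀ + (0 : ℝ) • z)) :=
        tendsto_const_nhds.add ((tendsto_inv_atTop_zero.comp
          (tendsto_natCast_atTop_atTop.atTop_add tendsto_const_nhds)).smul_const z)
      rw [zero_smul, add_zero] at h
      refine ((hw.tendsto x₀).comp h).congr' ?_
      filter_upwards [h.eventually (Metric.closedBall_mem_nhds x₀ one_pos)] with n hn
      have hn' : x₀ + ((n : ℝ) + 1)⁻¹ • z ∈ B := hn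
      rw [Set.indicator_of_mem hn']
      rfl
  have := near.add far
  rw [integral_smul, hη, integral_bumpKernel, add_zero] at this
  rw [Complex.real_smul, mul_one] at this
  exact this.congr fun n => integral_add_compl hBm (hint n)

/-- A Liouville theorem: a function of weighted integrability whose Fourier transform is supported
at the origin is constant. -/
theorem exists_const_of_integral_fourierInv_eq_zero (w : E3 → ℝ) (hw : Continuous w)
    (hwi : Integrable fun x => |w x| / (1 + ‖x‖ ^ 4))
    (h : ∀ g : 𝓢(E3, ℂ), HasCompactSupport g → (0 : E3) ∉ tsupport g →
      ∫ x, w x • (𝓕⁻ g) x = 0) : ∃ c, ∀ x, w x = c := by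
  have hint : ∀ ψ : 𝓢(E3, ℂ), Integrable fun x => w x • ψ x := by
    intro ψ
    obtain ⟨C', _, h'⟩ := ψ.exists_le_weight
    exact integrable_smul_of_weight hw.aestronglyMeasurable hwi
      ψ.continuous.aestronglyMeasurable h'
  have scale : ∀ a ε (ha : 0 < a) (hε : 0 < ε) (x₀ : E3),
      ∫ x, w x • (𝓕⁻ (modulatedBumpS ha x₀)) x = ∫ x, w x • (𝓕⁻ (modulatedBumpS hε x₀)) x := by
    intro a ε ha hε x₀
    have h1 := h (modulatedBumpS ha x₀ - modulatedBumpS hε x₀)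
      ((hasCompactSupport_modulatedBump ha x₀).sub (hasCompactSupport_modulatedBump hε x₀)) ?_
    · have h2 : 𝓕⁻ (modulatedBumpS ha x₀ - modulatedBumpS hε x₀) =
        𝓕⁻ (modulatedBumpS ha x₀) - 𝓕⁻ (modulatedBumpS hε x₀) := by
        exact map_sub (FourierTransform.fourierCLE ℂ 𝓢(E3, ℂ)).symm _ _
      rw [h2] at h1
      simp only [sub_apply, smul_sub] at h1
      rw [integral_sub (hint _) (hint _), sub_eq_zero] at h1
      exact h1
    · rw [notMem_tsupport_iff_eventuallyEq]
      filter_upwards [Metric.ball_mem_nhds (0 : E3) (lt_min ha hε)] with ξ hξ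
      rw [mem_ball_zero_iff, lt_min_iff] at hξ
      change modulatedBump a x₀ ξ - modulatedBump ε x₀ ξ = 0
      rw [modulatedBump_of_norm_le ha x₀ hξ.1.le, modulatedBump_of_norm_le hε x₀ hξ.2.le, sub_self]
  have shift : ∀ x₀ : E3, ∀ a (ha : 0 < a), ∫ x, w x • (𝓕⁻ (modulatedBumpS ha x₀)) x =
      ∫ x, w x • (𝓕⁻ (modulatedBumpS ha 0)) x := by
    intro x₀ a ha
    obtain ⟨K, hK, hb⟩ := norm_fourierInv_modulatedBumpS_sub_le x₀
    have hpos : ∀ n : ℕ, (0 : ℝ) < 1 / ((n : ℝ) + 1) := fun n => Nat.one_div_pos_of_nat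
    have hle : ∀ n : ℕ, 1 / ((n : ℝ) + 1) ≤ 1 := fun n => by
      rw [div_le_one n.cast_add_one_pos]; linarith [n.cast_nonneg (α := ℝ)]
    have lim : Tendsto (fun n : ℕ => ∫ x, w x • ((𝓕⁻ (modulatedBumpS (hpos n) x₀)) x -
        (𝓕⁻ (modulatedBumpS (hpos n) 0)) x)) atTop (nhds (∫ _ : E3, (0 : ℂ))) := by
      refine tendsto_integral_of_dominated_convergence (fun x => K * (|w x| / (1 + ‖x‖ ^ 4)))
        (fun n => ?_) (hwi.const_mul K) (fun n => .of_forall fun x => ?_) (.of_forall fun x => ?_)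
      · exact (hw.smul ((SchwartzMap.continuous _).sub
          (SchwartzMap.continuous _))).aestronglyMeasurable
      · rw [norm_smul, Real.norm_eq_abs]
        calc _ ≤ |w x| * (K / (1 + ‖x‖ ^ 4)) := by
              gcongr
              exact (hb _ (hpos n) (hle n) x).1
          _ = _ := by ring
      · refine squeeze_zero_norm (a := fun n : ℕ => |w x| * (K * (1 / ((n : ℝ) + 1))))
          (fun n => ?_) ?_
        · rw [norm_smul, Real.norm_eq_abs]
          gcongr
          exact (hb _ (hpos n) (hle n) x).2
        · simpa using (tendsto_one_div_add_atTop_nhds_zero_nat.const_mul K).const_mul |w x|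
    have cst : ∀ n : ℕ, ∫ x, w x • ((𝓕⁻ (modulatedBumpS (hpos n) x₀)) x -
        (𝓕⁻ (modulatedBumpS (hpos n) 0)) x) = (∫ x, w x • (𝓕⁻ (modulatedBumpS ha x₀)) x) -
      ∫ x, w x • (𝓕⁻ (modulatedBumpS ha 0)) x := by
      intro n
      simp_rw [smul_sub]
      rw [integral_sub (hint _) (hint _), scale a _ ha (hpos n) x₀, scale a _ ha (hpos n) 0]
    simp_rw [cst] at lim
    have := tendsto_nhds_unique tendsto_const_nhds lim
    exact sub_eq_zero.mp (this.trans (integral_zero _ _))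
  refine ⟨w 0, fun x₀ => ?_⟩
  have t1 := tendsto_integral_fourierInv_modulatedBumpS hw hwi x₀
  have t2 := tendsto_integral_fourierInv_modulatedBumpS hw hwi 0
  exact_mod_cast tendsto_nhds_unique (t1.congr fun n => shift x₀ _ n.cast_add_one_pos) t2

/-- The kernel `‖z‖⁻¹` truncated to a ball. -/
noncomputable def nearKernel (ρ : ℝ) (z : E3) : ℝ := (Set.Iio ρ).indicator (fun r => r⁻¹) ‖z‖

theorem nearKernel_nonneg (ρ : ℝ) (z : E3) : 0 ≤ nearKernel ρ z := by
  unfold nearKernel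
  by_cases h : ‖z‖ ∈ Set.Iio ρ
  · rw [Set.indicator_of_mem h]
    positivity
  · rw [Set.indicator_of_notMem h]

theorem integrable_nearKernel (ρ : ℝ) : Integrable (nearKernel ρ) := by
  rw [show nearKernel ρ = fun z => (Set.Iio ρ).indicator (fun r => r⁻¹) ‖z‖ from rfl,
    integrable_fun_norm_addHaar]
  rw [finrank_euclideanSpace, Fintype.card_fin]
  have h : IntegrableOn (fun r : ℝ => (Set.Iio ρ).indicator (fun r => r) r) (Set.Ioi 0) := by
    refine (integrableOn_indicator_iff measurableSet_Iio).mpr ?_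
    exact (continuous_id.integrableOn_Icc (a := 0) (b := ρ)).mono_set
      fun r hr => ⟨hr.2.le, hr.1.le⟩
  refine h.congr_fun (fun r hr => ?_) measurableSet_Ioi
  have hr : r ≠ 0 := (Set.mem_Ioi.mp hr).ne'
  by_cases h : r ∈ Set.Iio ρ
  · simp only [Set.indicator_of_mem h, smul_eq_mul]
    field_simp
  · simp only [Set.indicator_of_notMem h, smul_zero]

/-- The integral of `‖z‖⁻¹` over the unit ball. -/
noncomputable def nearConst : ℝ := ∫ z, nearKernel 1 z

theorem nearConst_nonneg : 0 ≤ nearConst := integral_nonneg (nearKernel_nonneg 1)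

theorem integral_nearKernel {ρ : ℝ} (hρ : 0 < ρ) : ∫ z, nearKernel ρ z = nearConst * ρ ^ 2 := by
  have key := Measure.integral_comp_smul (volume : Measure E3) (nearKernel ρ) ρ
  rw [finrank_euclideanSpace, Fintype.card_fin, abs_of_pos (by positivity)] at key
  have : ∀ z, nearKernel ρ (ρ • z) = ρ⁻¹ * nearKernel 1 z := by
    intro z
    simp only [nearKernel, norm_smul, norm_of_nonneg hρ.le, Set.indicator, Set.mem_Iio,
      mul_lt_iff_lt_one_right hρ, mul_inv, mul_ite, mul_zero]
  simp_rw [this] at key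
  rw [integral_const_mul, smul_eq_mul] at key
  rw [nearConst]
  field_simp at key ⊢
  linarith

theorem norm_nearKernel_sub_smul_le {F : Type*} [NormedAddCommGroup F] {g : E3 → F} {x : E3}
    {ρ M : ℝ} (hρ : 0 < ρ) (hM : ∀ y, ‖x - y‖ < ρ → ‖g y‖ ≤ M) (y : E3) :
    ‖x - y‖⁻¹ * ‖g y‖ ≤ M * nearKernel ρ (x - y) + ρ⁻¹ * ‖g y‖ := by
  by_cases h : ‖x - y‖ < ρ
  · rw [nearKernel, Set.indicator_of_mem (Set.mem_Iio.mpr h), mul_comm M]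
    have := hM y h
    have h1 : 0 ≤ ‖x - y‖⁻¹ := by positivity
    have h2 : 0 ≤ ρ⁻¹ * ‖g y‖ := by positivity
    nlinarith
  · rw [nearKernel, Set.indicator_of_notMem (fun h' => h (Set.mem_Iio.mp h')), mul_zero, zero_add]
    have := inv_anti₀ hρ (not_lt.mp h)
    gcongr

theorem integrable_inv_norm_sub_mul {F : Type*} [NormedAddCommGroup F] {g : E3 → F}
    (hg : Integrable g) {x : E3} {ρ M : ℝ} (hρ : 0 < ρ) (hM : ∀ y, ‖x - y‖ < ρ → ‖g y‖ ≤ M) :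
    Integrable (fun y => ‖x - y‖⁻¹ * ‖g y‖) := by
  refine Integrable.mono' ((((integrable_nearKernel ρ).comp_sub_left x).const_mul M).add
    (hg.norm.const_mul ρ⁻¹)) ?_ (.of_forall fun y => ?_)
  · exact (Measurable.aestronglyMeasurable (by fun_prop)).mul hg.1.norm
  · rw [norm_of_nonneg (by positivity)]
    exact norm_nearKernel_sub_smul_le hρ hM y

theorem integral_inv_norm_sub_mul_le {F : Type*} [NormedAddCommGroup F] {g : E3 → F}
    (hg : Integrable g) {x : E3} {ρ M : ℝ} (hρ : 0 < ρ) (hM : ∀ y, ‖x - y‖ < ρ → ‖g y‖ ≤ M) :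
    ∫ y, ‖x - y‖⁻¹ * ‖g y‖ ≤ M * (nearConst * ρ ^ 2) + ρ⁻¹ * ∫ y, ‖g y‖ := by
  calc _ ≤ ∫ y, (M * nearKernel ρ (x - y) + ρ⁻¹ * ‖g y‖) :=
        integral_mono (integrable_inv_norm_sub_mul hg hρ hM)
          ((((integrable_nearKernel ρ).comp_sub_left x).const_mul M).add (hg.norm.const_mul ρ⁻¹))
          (norm_nearKernel_sub_smul_le hρ hM)
    _ = _ := by
      rw [integral_add (((integrable_nearKernel ρ).comp_sub_left x).const_mul M)
        (hg.norm.const_mul ρ⁻¹), integral_const_mul, integral_const_mul,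
        integral_sub_left_eq_self (nearKernel ρ), integral_nearKernel hρ]

/-- The kernel `z_i / ‖z‖²`, the gradient of `log ‖z‖`. -/
noncomputable def gradLog (i : Fin 3) (z : E3) : ℝ := z i / ‖z‖ ^ 2

theorem gradLog_neg (i : Fin 3) (z : E3) : gradLog i (-z) = -gradLog i z := by
  simp [gradLog, neg_div]

theorem abs_apply_le_norm (z : E3) (i : Fin 3) : |z i| ≤ ‖z‖ := by
  simpa using PiLp.norm_apply_le z i

theorem abs_gradLog_le (i : Fin 3) (z : E3) : |gradLog i z| ≤ ‖z‖⁻¹ := by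
  rcases eq_or_ne z 0 with rfl | hz
  · simp [gradLog]
  · have h := norm_pos_iff.mpr hz
    rw [gradLog, abs_div, abs_of_pos (by positivity : 0 < ‖z‖ ^ 2), div_le_iff₀ (by positivity)]
    calc |z i| ≤ ‖z‖ := abs_apply_le_norm z i
      _ = _ := by field_simp

@[fun_prop]
theorem measurable_gradLog (i : Fin 3) : Measurable (gradLog i) := by
  unfold gradLog
  fun_prop

/-- The potential `∫ (x - y)_i / ‖x - y‖² g(y) dy`. -/
noncomputable def potential {F : Type*} [NormedAddCommGroup F] [NormedSpace ℝ F]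
    (i : Fin 3) (g : E3 → F) (x : E3) : F :=
  ∫ y, gradLog i (x - y) • g y

section
variable {F : Type*} [NormedAddCommGroup F] [NormedSpace ℝ F]

theorem norm_gradLog_smul_le (i : Fin 3) (g : E3 → F) (x y : E3) :
    ‖gradLog i (x - y) • g y‖ ≤ ‖x - y‖⁻¹ * ‖g y‖ := by
  rw [norm_smul, Real.norm_eq_abs]
  gcongr
  exact abs_gradLog_le i _

theorem integrable_gradLog_smul (i : Fin 3) {g : E3 → F}
    (hg : Integrable g) {x : E3} {ρ M : ℝ} (hρ : 0 < ρ) (hM : ∀ y, ‖x - y‖ < ρ → ‖g y‖ ≤ M) :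
    Integrable (fun y => gradLog i (x - y) • g y) := by
  refine (integrable_inv_norm_sub_mul hg hρ hM).mono' ?_
    (.of_forall fun y => norm_gradLog_smul_le i g x y)
  exact AEStronglyMeasurable.fun_smul (Measurable.aestronglyMeasurable (by fun_prop)) hg.1

theorem integral_norm_gradLog_smul_le (i : Fin 3) {g : E3 → F}
    (hg : Integrable g) {x : E3} {ρ M : ℝ} (hρ : 0 < ρ) (hM : ∀ y, ‖x - y‖ < ρ → ‖g y‖ ≤ M) :
    ∫ y, ‖gradLog i (x - y) • g y‖ ≤ M * (nearConst * ρ ^ 2) + ρ⁻¹ * ∫ y, ‖g y‖ :=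
  (integral_mono (integrable_gradLog_smul i hg hρ hM).norm (integrable_inv_norm_sub_mul hg hρ hM)
    (norm_gradLog_smul_le i g x)).trans (integral_inv_norm_sub_mul_le hg hρ hM)

theorem norm_potential_le (i : Fin 3) {g : E3 → F}
    (hg : Integrable g) {x : E3} {ρ M : ℝ} (hρ : 0 < ρ) (hM : ∀ y, ‖x - y‖ < ρ → ‖g y‖ ≤ M) :
    ‖potential i g x‖ ≤ M * (nearConst * ρ ^ 2) + ρ⁻¹ * ∫ y, ‖g y‖ :=
  (norm_integral_le_integral_norm _).trans (integral_norm_gradLog_smul_le i hg hρ hM)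

theorem integrable_prod_gradLog_smul (i : Fin 3) {f : E3 → ℝ} (hf : Integrable f) {g : E3 → F}
    (hg : Integrable g) {M : ℝ} (hM : ∀ x, ‖g x‖ ≤ M) :
    Integrable (fun p : E3 × E3 => (gradLog i (p.1 - p.2) * f p.2) • g p.1)
      (volume.prod volume) := by
  have hmeas : AEStronglyMeasurable
      (fun p : E3 × E3 => (gradLog i (p.1 - p.2) * f p.2) • g p.1) (volume.prod volume) := by
    refine AEStronglyMeasurable.fun_smul (AEStronglyMeasurable.mul
      (Measurable.aestronglyMeasurable (by fun_prop)) hf.1.comp_snd) hg.1.comp_fst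
  have heq : ∀ x y, (gradLog i (x - y) * f y) • g x = -(f y • gradLog i (y - x) • g x) := by
    intro x y
    rw [← neg_sub y x, gradLog_neg, smul_smul, ← neg_smul]
    congr 1
    ring
  rw [integrable_prod_iff' hmeas]
  constructor
  · refine .of_forall fun y => ?_
    simp_rw [heq]
    exact ((integrable_gradLog_smul i hg one_pos fun x _ => hM x).smul (f y)).neg
  · simp_rw [heq, norm_neg, norm_smul _ (gradLog i _ • _), integral_const_mul]
    refine (hf.norm.mul_const (M * (nearConst * 1 ^ 2) + 1⁻¹ * ∫ y, ‖g y‖)).mono' ?_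
      (.of_forall fun y => ?_)
    · refine hf.1.norm.mul ?_
      exact AEStronglyMeasurable.integral_prod_right' (f := fun p : E3 × E3 =>
        ‖gradLog i (p.1 - p.2) • g p.2‖) (AEStronglyMeasurable.fun_smul
          (Measurable.aestronglyMeasurable (by fun_prop)) hg.1.comp_snd).norm
    · rw [norm_of_nonneg (mul_nonneg (norm_nonneg _) (integral_nonneg fun _ => norm_nonneg _))]
      gcongr
      exact integral_norm_gradLog_smul_le i hg one_pos fun x _ => hM x

theorem integrable_potential_smul [CompleteSpace F] (i : Fin 3) {f : E3 → ℝ} (hf : Integrable f) {g : E3 → F}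
    (hg : Integrable g) {M : ℝ} (hM : ∀ x, ‖g x‖ ≤ M) :
    Integrable (fun x => potential i f x • g x) := by
  refine (integrable_prod_gradLog_smul i hf hg hM).integral_prod_left.congr (.of_forall fun x => ?_)
  simp only [potential, smul_eq_mul]
  exact integral_smul_const _ _

theorem integral_potential_smul [CompleteSpace F] (i : Fin 3) {f : E3 → ℝ} (hf : Integrable f) {g : E3 → F}
    (hg : Integrable g) {M : ℝ} (hM : ∀ x, ‖g x‖ ≤ M) :
    ∫ x, potential i f x • g x = ∫ y, f y • -potential i g y := by
  have h := integral_integral_swap (f := fun x y => (gradLog i (x - y) * f y) • g x)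
    (integrable_prod_gradLog_smul i hf hg hM)
  calc _ = ∫ x, ∫ y, (gradLog i (x - y) * f y) • g x := by
        congr 1 with x
        simp only [potential, smul_eq_mul]
        exact (integral_smul_const _ _).symm
    _ = _ := h
    _ = _ := by
        congr 1 with y
        rw [potential, ← integral_neg, ← integral_smul]
        congr 1 with x
        rw [← neg_sub y x, gradLog_neg, mul_comm, mul_smul, neg_smul]

end

theorem continuous_potential (i : Fin 3) {f : E3 → ℝ} (hf : Integrable f) (hfc : Continuous f) :
    Continuous (potential i f) := by
  set far : E3 → ℝ := fun z => z i / max 1 (‖z‖ ^ 2) with hfar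
  have hfarc : Continuous far :=
    (by fun_prop : Continuous fun z : E3 => z i).div (by fun_prop)
      fun z => (lt_max_of_lt_left one_pos).ne'
  have hfarb : ∀ z, |far z| ≤ 1 := by
    intro z
    have h0 : 0 < max 1 (‖z‖ ^ 2) := lt_max_of_lt_left one_pos
    rw [hfar, abs_div, abs_of_pos h0, div_le_one h0]
    refine (abs_apply_le_norm z i).trans ?_
    rcases le_total ‖z‖ 1 with h | h
    · exact le_max_of_le_left h
    · exact le_max_of_le_right (by nlinarith)
  have hnear : ∀ z, |gradLog i z - far z| ≤ nearKernel 2 z := by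
    intro z
    by_cases h : ‖z‖ < 1
    · have h2 : ‖z‖ ^ 2 ≤ 1 := pow_le_one₀ (norm_nonneg _) h.le
      rw [nearKernel, Set.indicator_of_mem (Set.mem_Iio.mpr (h.trans one_lt_two))]
      refine le_trans ?_ (abs_gradLog_le i z)
      simp only [hfar, max_eq_left h2, gradLog, div_one]
      rcases eq_or_ne z 0 with rfl | hz
      · simp
      have hz := norm_pos_iff.mpr hz
      have : z i / ‖z‖ ^ 2 - z i = z i / ‖z‖ ^ 2 * (1 - ‖z‖ ^ 2) := by field_simp
      rw [this, abs_mul, abs_of_nonneg (sub_nonneg.mpr h2)]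
      refine mul_le_of_le_one_right (abs_nonneg _) ?_
      linarith [sq_nonneg ‖z‖]
    · have h2 : 1 ≤ ‖z‖ ^ 2 := one_le_pow₀ (not_lt.mp h)
      simp only [hfar, max_eq_right h2, gradLog, sub_self, abs_zero]
      exact nearKernel_nonneg 2 z
  have hnm : Measurable fun z => gradLog i z - far z := (measurable_gradLog i).sub hfarc.measurable
  have hsplit : potential i f = fun x =>
      (∫ z, (gradLog i z - far z) * f (x - z)) + ∫ y, far (x - y) * f y := by
    ext x
    obtain ⟨M, hM⟩ := (isCompact_closedBall x 1).exists_bound_of_continuousOn hfc.continuousOn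
    have h1 : Integrable fun y => far (x - y) * f y :=
      hf.bdd_mul (c := 1) (hfarc.comp (by fun_prop)).aestronglyMeasurable
        (.of_forall fun y => hfarb _)
    have h2 : Integrable fun y => gradLog i (x - y) * f y :=
      integrable_gradLog_smul (F := ℝ) (M := M) i hf one_pos fun y hy => hM y (by
        rw [mem_closedBall_iff_norm']; exact hy.le)
    have h3 : ∫ z, (gradLog i z - far z) * f (x - z) =
        ∫ y, (gradLog i (x - y) - far (x - y)) * f y := by
      rw [← integral_sub_left_eq_self (fun z => (gradLog i z - far z) * f (x - z)) volume x]
      simp only [sub_sub_cancel]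
    rw [h3]
    simp_rw [sub_mul]
    rw [integral_sub h2 h1, sub_add_cancel, potential]
    rfl
  rw [hsplit]
  refine Continuous.add ?_ ?_
  · refine continuous_iff_continuousAt.mpr fun x₀ => ?_
    obtain ⟨M, hM⟩ := (isCompact_closedBall x₀ 3).exists_bound_of_continuousOn hfc.continuousOn
    refine continuousAt_of_dominated (bound := fun z => nearKernel 2 z * M) (.of_forall fun x => ?_)
      ?_ ((integrable_nearKernel 2).mul_const M) (.of_forall fun z => ?_)
    · exact hnm.aestronglyMeasurable.mul (hfc.comp (by fun_prop)).aestronglyMeasurable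
    · filter_upwards [Metric.ball_mem_nhds x₀ one_pos] with x hx
      refine .of_forall fun z => ?_
      rw [norm_mul]
      by_cases hz : ‖z‖ < 2
      · refine mul_le_mul (hnear z) (hM _ ?_) (norm_nonneg _) (nearKernel_nonneg 2 z)
        rw [mem_ball_iff_norm] at hx
        rw [mem_closedBall_iff_norm, sub_right_comm]
        linarith [norm_sub_le (x - x₀) z]
      · have h0 := hnear z
        have h1 : nearKernel 2 z = 0 := by
          rw [nearKernel, Set.indicator_of_notMem (fun h' => hz (Set.mem_Iio.mp h'))]
        rw [h1] at h0 ⊢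
        rw [Real.norm_eq_abs, le_antisymm h0 (abs_nonneg _), zero_mul, zero_mul]
    · exact (continuous_const.mul (hfc.comp (by fun_prop))).continuousAt
  · refine continuous_of_dominated (bound := fun y => ‖f y‖) (fun x => ?_) (fun x => ?_) hf.norm ?_
    · exact ((hfarc.comp (by fun_prop)).mul hfc).aestronglyMeasurable
    · refine .of_forall fun y => ?_
      rw [norm_mul]
      exact mul_le_of_le_one_left (norm_nonneg _) (hfarb _)
    · exact .of_forall fun y => (hfarc.comp (by fun_prop)).mul continuous_const

theorem integrableOn_and_integral_exp_neg_div_div_sq {r : ℝ} (hr : 0 < r) :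
    IntegrableOn (fun s : ℝ => exp (-(r / s)) / s ^ 2) (Set.Ioi 0) ∧
      ∫ s in Set.Ioi (0 : ℝ), exp (-(r / s)) / s ^ 2 = 1 / r := by
  have hpt : ∀ s ∈ Set.Ioi (0 : ℝ), (|(-1 : ℝ)| * s ^ ((-1 : ℝ) - 1)) • exp (-(r * s ^ (-1 : ℝ))) =
      exp (-(r / s)) / s ^ 2 := by
    intro s hs
    have hs : 0 < s := hs
    rw [abs_neg, abs_one, one_mul, show (-1 : ℝ) - 1 = -(2 : ℕ) by norm_num, rpow_neg hs.le,
      rpow_natCast, rpow_neg_one, smul_eq_mul]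
    ring_nf
  constructor
  · refine IntegrableOn.congr_fun ?_ hpt measurableSet_Ioi
    refine (integrableOn_Ioi_comp_rpow_iff (fun t : ℝ => exp (-(r * t))) (by norm_num)).mpr ?_
    simpa using integrableOn_rpow_mul_exp_neg_mul_rpow (p := 1) (s := 0) (b := r) (by norm_num)
      one_pos hr
  · rw [← setIntegral_congr_fun measurableSet_Ioi hpt,
      integral_comp_rpow_Ioi (fun t : ℝ => exp (-(r * t))) (by norm_num)]
    simpa using integral_rpow_mul_exp_neg_mul_Ioi one_pos hr

theorem integrableOn_and_integral_exp_neg_div_div_cube {r : ℝ} (hr : 0 < r) :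
    IntegrableOn (fun s : ℝ => exp (-(r / s)) / s ^ 3) (Set.Ioi 0) ∧
      ∫ s in Set.Ioi (0 : ℝ), exp (-(r / s)) / s ^ 3 = 1 / r ^ 2 := by
  have hpt : ∀ s ∈ Set.Ioi (0 : ℝ), (|(-1 : ℝ)| * s ^ ((-1 : ℝ) - 1)) •
      (s ^ (-1 : ℝ) * exp (-(r * s ^ (-1 : ℝ)))) = exp (-(r / s)) / s ^ 3 := by
    intro s hs
    have hs : 0 < s := hs
    rw [abs_neg, abs_one, one_mul, show (-1 : ℝ) - 1 = -(2 : ℕ) by norm_num, rpow_neg hs.le,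
      rpow_natCast, rpow_neg_one, smul_eq_mul]
    field_simp
  constructor
  · refine IntegrableOn.congr_fun ?_ hpt measurableSet_Ioi
    refine (integrableOn_Ioi_comp_rpow_iff (fun t : ℝ => t * exp (-(r * t))) (by norm_num)).mpr ?_
    simpa using integrableOn_rpow_mul_exp_neg_mul_rpow (p := 1) (s := 1) (b := r) (by norm_num)
      one_pos hr
  · rw [← setIntegral_congr_fun measurableSet_Ioi hpt,
      integral_comp_rpow_Ioi (fun t : ℝ => t * exp (-(r * t))) (by norm_num)]
    have := integral_rpow_mul_exp_neg_mul_Ioi two_pos hr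
    norm_num [Real.Gamma_two] at this
    simpa using this

theorem integrableOn_and_integral_sqrt_mul_exp {A : ℝ} (hA : 0 < A) :
    IntegrableOn (fun s : ℝ => s ^ (1 / 2 : ℝ) * exp (-(A * s))) (Set.Ioi 0) ∧
      ∫ s in Set.Ioi (0 : ℝ), s ^ (1 / 2 : ℝ) * exp (-(A * s)) =
        (1 / A) ^ (3 / 2 : ℝ) * (√π / 2) := by
  constructor
  · simpa using integrableOn_rpow_mul_exp_neg_mul_rpow (p := 1) (s := 1 / 2) (b := A) (by norm_num)
      one_pos hA
  · have := integral_rpow_mul_exp_neg_mul_Ioi (a := 3 / 2) (by norm_num) hA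
    rw [show (3 / 2 : ℝ) - 1 = 1 / 2 by norm_num] at this
    rw [this, show (3 / 2 : ℝ) = 1 / 2 + 1 by norm_num, Real.Gamma_add_one (by norm_num),
      Real.Gamma_one_half_eq]
    ring

theorem integrableOn_and_integral_rpow_mul_one_sub_exp {A : ℝ} (hA : 0 < A) :
    IntegrableOn (fun s : ℝ => s ^ (-3 / 2 : ℝ) * (1 - exp (-(A * s)))) (Set.Ioi 0) ∧
      ∫ s in Set.Ioi (0 : ℝ), s ^ (-3 / 2 : ℝ) * (1 - exp (-(A * s))) = 2 * √(π * A) := by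
  have hle : ∀ s, 1 - exp (-(A * s)) ≤ A * s := fun s => by
    linarith [Real.add_one_le_exp (-(A * s))]
  have hnn : ∀ s : ℝ, 0 < s → 0 ≤ 1 - exp (-(A * s)) := fun s hs => by
    rw [sub_nonneg, exp_le_one_iff]
    have := mul_pos hA hs
    linarith
  have hint : IntegrableOn (fun s : ℝ => s ^ (-3 / 2 : ℝ) * (1 - exp (-(A * s)))) (Set.Ioi 0) := by
    rw [← Set.Ioc_union_Ioi_eq_Ioi zero_le_one]
    refine IntegrableOn.union ?_ ?_
    · have h : IntegrableOn (fun s : ℝ => s ^ (-1 / 2 : ℝ)) (Set.Ioc 0 1) := by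
        have := intervalIntegral.intervalIntegrable_rpow' (a := 0) (b := 1) (r := -1 / 2)
          (by norm_num)
        rwa [intervalIntegrable_iff_integrableOn_Ioc_of_le zero_le_one] at this
      refine (h.const_mul A).mono' (Measurable.aestronglyMeasurable (by fun_prop)) ?_
      refine (ae_restrict_mem measurableSet_Ioc).mono fun s hs => ?_
      rw [norm_of_nonneg (mul_nonneg (rpow_nonneg hs.1.le _) (hnn s hs.1))]
      calc _ ≤ s ^ (-3 / 2 : ℝ) * (A * s) := by
            gcongr
            · exact rpow_nonneg hs.1.le _
            · exact hle s
        _ = A * (s ^ (-3 / 2 : ℝ) * s ^ (1 : ℝ)) := by rw [rpow_one]; ring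
        _ = _ := by rw [← rpow_add hs.1]; norm_num
    · have h := integrableOn_Ioi_rpow_of_lt (a := -3 / 2) (by norm_num) one_pos
      refine h.mono' (Measurable.aestronglyMeasurable (by fun_prop)) ?_
      refine (ae_restrict_mem measurableSet_Ioi).mono fun s hs => ?_
      have hs : 0 < s := one_pos.trans hs
      rw [norm_of_nonneg (mul_nonneg (rpow_nonneg hs.le _) (hnn s hs))]
      refine mul_le_of_le_one_right (rpow_nonneg hs.le _) ?_
      linarith [exp_pos (-(A * s))]
  refine ⟨hint, ?_⟩
  have hu : ∀ x ∈ Set.Ioi (0 : ℝ), HasDerivAt (fun s => 1 - exp (-(A * s)))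
      (A * exp (-(A * x))) x := by
    intro x _
    have h1 : HasDerivAt (fun s => -(A * s)) (-A) x := by
      simpa using ((hasDerivAt_id x).const_mul A).fun_neg
    exact (h1.exp.const_sub 1).congr_deriv (by ring)
  have hv : ∀ x ∈ Set.Ioi (0 : ℝ), HasDerivAt (fun s : ℝ => -2 * s ^ (-1 / 2 : ℝ))
      (x ^ (-3 / 2 : ℝ)) x := by
    intro x hx
    have := (Real.hasDerivAt_rpow_const (x := x) (p := -1 / 2) (.inl hx.ne')).const_mul (-2)
    refine this.congr_deriv ?_
    rw [← mul_assoc]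
    norm_num
  have hint2 : IntegrableOn (fun s : ℝ => s ^ (-1 / 2 : ℝ) * exp (-(A * s))) (Set.Ioi 0) := by
    simpa using integrableOn_rpow_mul_exp_neg_mul_rpow (p := 1) (s := -1 / 2) (b := A)
      (by norm_num) one_pos hA
  have key := integral_Ioi_mul_deriv_eq_deriv_mul (a' := 0) (b' := 0) hu hv ?_ ?_ ?_ ?_
  · have e1 : ∫ s in Set.Ioi (0 : ℝ), s ^ (-3 / 2 : ℝ) * (1 - exp (-(A * s))) =
        ∫ s in Set.Ioi (0 : ℝ), (1 - exp (-(A * s))) * s ^ (-3 / 2 : ℝ) := by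
      simp_rw [mul_comm]
    have e2 : ∫ s in Set.Ioi (0 : ℝ), A * exp (-(A * s)) * (-2 * s ^ (-1 / 2 : ℝ)) =
        (-2 * A) * ∫ s in Set.Ioi (0 : ℝ), s ^ (-1 / 2 : ℝ) * exp (-(A * s)) := by
      rw [← integral_const_mul]
      congr 1 with s
      ring
    have e3 := integral_rpow_mul_exp_neg_mul_Ioi (a := 1 / 2) (by norm_num) hA
    rw [show (1 / 2 : ℝ) - 1 = -1 / 2 by norm_num, Real.Gamma_one_half_eq, ← sqrt_eq_rpow] at e3
    rw [e1, key, e2, e3, sqrt_mul pi_pos.le, sqrt_div zero_le_one, sqrt_one]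
    have : A = √A * √A := (mul_self_sqrt hA.le).symm
    have h0 : √A ≠ 0 := (sqrt_pos.mpr hA).ne'
    field_simp
    rw [sq_sqrt hA.le]
    ring
  · exact hint.congr_fun (fun s _ => mul_comm _ _) measurableSet_Ioi
  · refine IntegrableOn.congr_fun (hint2.const_mul (-2 * A)) (fun s _ => ?_) measurableSet_Ioi
    simp only [Pi.mul_apply]
    ring
  · have h0 : Tendsto (fun s : ℝ => 2 * A * s ^ (1 / 2 : ℝ)) (nhdsWithin 0 (Set.Ioi 0))
        (nhds 0) := by
      have : Continuous fun s : ℝ => 2 * A * s ^ (1 / 2 : ℝ) :=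
        continuous_const.mul (continuous_id.rpow_const fun _ => .inr (by norm_num))
      have := this.tendsto 0
      rw [zero_rpow (by norm_num), mul_zero] at this
      exact this.mono_left nhdsWithin_le_nhds
    refine squeeze_zero_norm' ?_ h0
    filter_upwards [self_mem_nhdsWithin] with s hs
    have hs : 0 < s := hs
    simp only [Pi.mul_apply]
    rw [norm_mul, norm_of_nonneg (hnn s hs), norm_mul, norm_of_nonneg (rpow_nonneg hs.le _)]
    calc _ ≤ A * s * (‖(-2 : ℝ)‖ * s ^ (-1 / 2 : ℝ)) := by
          gcongr
          exact hle s
      _ = 2 * A * (s ^ (1 : ℝ) * s ^ (-1 / 2 : ℝ)) := by rw [rpow_one]; norm_num; ring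
      _ = _ := by rw [← rpow_add hs]; norm_num
  · have h0 : Tendsto (fun s : ℝ => 2 * s ^ (-(1 / 2) : ℝ)) atTop (nhds 0) := by
      simpa using (tendsto_rpow_neg_atTop (y := 1 / 2) (by norm_num)).const_mul 2
    refine squeeze_zero_norm' ?_ h0
    filter_upwards [eventually_gt_atTop 0] with s hs
    simp only [Pi.mul_apply]
    rw [norm_mul, norm_of_nonneg (hnn s hs), norm_mul, norm_of_nonneg (rpow_nonneg hs.le _)]
    calc _ ≤ 1 * (‖(-2 : ℝ)‖ * s ^ (-1 / 2 : ℝ)) := by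
          gcongr
          linarith [exp_pos (-(A * s))]
      _ = _ := by norm_num

theorem integrable_gaussian_mul_cexp {s : ℝ} (hs : 0 < s) (ξ : E3) :
    Integrable fun z : E3 => (exp (-(‖z‖ ^ 2 / s)) : ℂ) *
      Complex.exp ((2 * π * inner ℝ z ξ : ℝ) * Complex.I) := by
  have := GaussianFourier.integrable_cexp_neg_mul_sq_norm_add (b := ((1 / s : ℝ) : ℂ))
    (by rw [Complex.ofReal_re]; positivity) (2 * π * Complex.I) ξ
  refine this.congr (.of_forall fun z => ?_)
  simp only
  rw [Complex.exp_add, Complex.ofReal_exp, real_inner_comm]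
  congr 2 <;> push_cast <;> ring

theorem integral_gaussian_mul_cexp {s : ℝ} (hs : 0 < s) (ξ : E3) :
    ∫ z : E3, (exp (-(‖z‖ ^ 2 / s)) : ℂ) *
      Complex.exp ((2 * π * inner ℝ z ξ : ℝ) * Complex.I) =
      (((π * s) ^ (3 / 2 : ℝ) * exp (-(π ^ 2 * ‖ξ‖ ^ 2 * s)) : ℝ) : ℂ) := by
  have := GaussianFourier.integral_cexp_neg_mul_sq_norm_add (b := ((1 / s : ℝ) : ℂ))
    (by rw [Complex.ofReal_re]; positivity) (2 * π * Complex.I) ξ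
  rw [finrank_euclideanSpace, Fintype.card_fin] at this
  calc _ = ∫ v : E3, Complex.exp (-((1 / s : ℝ) : ℂ) * ‖v‖ ^ 2 +
        2 * π * Complex.I * (inner ℝ ξ v : ℝ)) := by
        congr 1 with z
        rw [Complex.exp_add, Complex.ofReal_exp, real_inner_comm]
        congr 2 <;> push_cast <;> ring
    _ = _ := by
        rw [this, Complex.ofReal_mul, Complex.ofReal_exp, Complex.ofReal_cpow (by positivity)]
        congr 2
        · push_cast
          rw [div_div_eq_mul_div, div_one]
        · push_cast
          norm_num
        · push_cast
          have hs' : (s : ℂ) ≠ 0 := by exact_mod_cast hs.ne'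
          field_simp
          rw [Complex.I_sq]
          ring

theorem integrable_gaussian {s : ℝ} (hs : 0 < s) :
    Integrable fun z : E3 => exp (-(‖z‖ ^ 2 / s)) := by
  have := (integrable_gaussian_mul_cexp hs 0).norm
  simpa [Complex.norm_exp, ← Complex.ofReal_pow] using this

theorem integral_exp_neg_norm_sq_div {s : ℝ} (hs : 0 < s) :
    ∫ z : E3, exp (-(‖z‖ ^ 2 / s)) = (π * s) ^ (3 / 2 : ℝ) := by
  have := integral_gaussian_mul_cexp hs 0
  simp only [inner_zero_right, mul_zero, Complex.ofReal_zero, zero_mul, Complex.exp_zero, mul_one,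
    norm_zero, ne_eq, OfNat.ofNat_ne_zero, not_false_eq_true, zero_pow, neg_zero, exp_zero] at this
  rw [← Complex.ofReal_inj, ← this, ← integral_complex_ofReal]

theorem integrable_gaussian_mul_cos {s : ℝ} (hs : 0 < s) (ξ : E3) :
    Integrable fun z : E3 => exp (-(‖z‖ ^ 2 / s)) * cos (2 * π * inner ℝ z ξ) := by
  have := (integrable_gaussian_mul_cexp hs ξ).re
  refine this.congr (.of_forall fun z => ?_)
  simp only [RCLike.re_to_complex, Complex.re_ofReal_mul, Complex.exp_ofReal_mul_I_re]

theorem integral_gaussian_mul_cos {s : ℝ} (hs : 0 < s) (ξ : E3) :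
    ∫ z : E3, exp (-(‖z‖ ^ 2 / s)) * cos (2 * π * inner ℝ z ξ) =
      (π * s) ^ (3 / 2 : ℝ) * exp (-(π ^ 2 * ‖ξ‖ ^ 2 * s)) := by
  have h := congrArg Complex.re (integral_gaussian_mul_cexp hs ξ)
  rw [Complex.ofReal_re] at h
  rw [← h]
  have := integral_re (𝕜 := ℂ) (integrable_gaussian_mul_cexp hs ξ)
  rw [RCLike.re_to_complex] at this
  rw [← this]
  congr 1 with z
  simp only [RCLike.re_to_complex, Complex.re_ofReal_mul, Complex.exp_ofReal_mul_I_re]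

theorem integrable_and_integral_one_sub_cos (ξ : E3) :
    Integrable (fun z : E3 => (1 - cos (2 * π * inner ℝ z ξ)) / ‖z‖ ^ 4) ∧
      ∫ z : E3, (1 - cos (2 * π * inner ℝ z ξ)) / ‖z‖ ^ 4 = 2 * π ^ 3 * ‖ξ‖ := by
  rcases eq_or_ne ξ 0 with rfl | hξ
  · simp
  have hξ := norm_pos_iff.mpr hξ
  set A := π ^ 2 * ‖ξ‖ ^ 2 with hA
  have hA0 : 0 < A := by positivity
  set H : E3 → ℝ → ℝ := fun z s =>
    (1 - cos (2 * π * inner ℝ z ξ)) * (exp (-(‖z‖ ^ 2 / s)) / s ^ 3) with hH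
  have hcos : ∀ t : ℝ, 0 ≤ 1 - cos t := fun t => sub_nonneg.mpr (cos_le_one t)
  have hpos : ∀ z, ∀ s ∈ Set.Ioi (0 : ℝ), 0 ≤ H z s := fun z s hs => by
    have hs : 0 < s := hs
    exact mul_nonneg (hcos _) (by positivity)
  have hz : ∀ z : E3, ∫ s in Set.Ioi (0 : ℝ), H z s =
      (1 - cos (2 * π * inner ℝ z ξ)) / ‖z‖ ^ 4 := by
    intro z
    simp only [hH]
    rw [integral_const_mul]
    rcases eq_or_ne z 0 with rfl | hz
    · simp
    · have := norm_pos_iff.mpr hz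
      rw [(integrableOn_and_integral_exp_neg_div_div_cube (by positivity)).2]
      ring
  have hs1 : ∀ s ∈ Set.Ioi (0 : ℝ), Integrable fun z => H z s := by
    intro s hs
    refine (((integrable_gaussian hs).sub (integrable_gaussian_mul_cos hs ξ)).div_const
      (s ^ 3)).congr (.of_forall fun z => ?_)
    simp only [hH, Pi.sub_apply]
    ring
  have hs2 : ∀ s ∈ Set.Ioi (0 : ℝ), ∫ z, H z s =
      π ^ (3 / 2 : ℝ) * (s ^ (-3 / 2 : ℝ) * (1 - exp (-(A * s)))) := by
    intro s hs
    have hs : 0 < s := hs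
    calc _ = ∫ z : E3, (exp (-(‖z‖ ^ 2 / s)) -
          exp (-(‖z‖ ^ 2 / s)) * cos (2 * π * inner ℝ z ξ)) / s ^ 3 := by
          congr 1 with z
          simp only [hH]
          ring
      _ = ((π * s) ^ (3 / 2 : ℝ) - (π * s) ^ (3 / 2 : ℝ) * exp (-(A * s))) / s ^ 3 := by
          rw [integral_div, integral_sub (integrable_gaussian hs)
            (integrable_gaussian_mul_cos hs ξ), integral_exp_neg_norm_sq_div hs, integral_gaussian_mul_cos hs]
      _ = _ := by
          rw [show (-3 / 2 : ℝ) = 3 / 2 - (3 : ℕ) by norm_num, rpow_sub_natCast hs.ne',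
            mul_rpow pi_pos.le hs.le]
          ring
  have hint : Integrable (Function.uncurry H) (volume.prod (volume.restrict (Set.Ioi (0 : ℝ)))) := by
    have hm : AEStronglyMeasurable (Function.uncurry H)
        (volume.prod (volume.restrict (Set.Ioi (0 : ℝ)))) := by
      refine Measurable.aestronglyMeasurable ?_
      change Measurable fun p : E3 × ℝ =>
        (1 - cos (2 * π * inner ℝ p.1 ξ)) * (exp (-(‖p.1‖ ^ 2 / p.2)) / p.2 ^ 3)
      fun_prop
    rw [integrable_prod_iff' hm]
    refine ⟨(ae_restrict_mem measurableSet_Ioi).mono hs1, ?_⟩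
    refine IntegrableOn.congr_fun
      ((integrableOn_and_integral_rpow_mul_one_sub_exp hA0).1.const_mul (π ^ (3 / 2 : ℝ)))
      (fun s hs => ?_) measurableSet_Ioi
    rw [← hs2 s hs]
    congr 1 with z
    exact (norm_of_nonneg (hpos z s hs)).symm
  refine ⟨hint.integral_prod_left.congr (.of_forall hz), ?_⟩
  simp_rw [← hz]
  rw [integral_integral_swap hint, setIntegral_congr_fun measurableSet_Ioi hs2,
    integral_const_mul, (integrableOn_and_integral_rpow_mul_one_sub_exp hA0).2, hA]
  rw [show π * (π ^ 2 * ‖ξ‖ ^ 2) = π * (π * ‖ξ‖) ^ 2 by ring, sqrt_mul pi_pos.le,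
    sqrt_sq (by positivity), sqrt_eq_rpow]
  calc _ = 2 * (π ^ (3 / 2 : ℝ) * π ^ (1 / 2 : ℝ)) * π * ‖ξ‖ := by ring
    _ = _ := by
      rw [← rpow_add pi_pos, show (3 / 2 + 1 / 2 : ℝ) = (2 : ℕ) by norm_num, rpow_natCast]
      ring

theorem inner_single_one_right (z : E3) (i : Fin 3) :
    inner ℝ z (EuclideanSpace.single i (1 : ℝ)) = z i := by
  simp [EuclideanSpace.inner_single_right]

theorem fderiv_norm_sq_single (z : E3) (i : Fin 3) :
    fderiv ℝ (fun z : E3 => ‖z‖ ^ 2) z (EuclideanSpace.single i 1) = 2 * z i := by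
  rw [(hasStrictFDerivAt_norm_sq z).hasFDerivAt.fderiv]
  simp [inner_single_one_right]

theorem fderiv_gaussian_single (s : ℝ) (z : E3) (i : Fin 3) :
    fderiv ℝ (fun z : E3 => exp (-(‖z‖ ^ 2 / s))) z (EuclideanSpace.single i 1) =
      -(2 / s) * (z i * exp (-(‖z‖ ^ 2 / s))) := by
  have hd : DifferentiableAt ℝ (fun z : E3 => ‖z‖ ^ 2) z :=
    (hasStrictFDerivAt_norm_sq z).hasFDerivAt.differentiableAt
  have h := ((hd.hasFDerivAt.mul_const s⁻¹).neg).exp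
  have e : (fun z : E3 => exp (-(‖z‖ ^ 2 / s))) = fun z => exp ((-fun z : E3 => ‖z‖ ^ 2 * s⁻¹) z) := by
    ext z
    simp [div_eq_mul_inv]
  rw [e, h.fderiv]
  simp only [Pi.neg_apply, smul_apply,
    neg_apply, smul_eq_mul, fderiv_norm_sq_single]
  ring_nf

theorem contDiff_character (ξ : E3) : ContDiff ℝ (⊤ : ℕ∞)
    fun z : E3 => Complex.exp ((2 * π * inner ℝ z ξ : ℝ) * Complex.I) :=
  ContDiff.cexp ((Complex.ofRealCLM.contDiff.comp
    (contDiff_const.mul (contDiff_id.inner ℝ contDiff_const))).mul contDiff_const)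

theorem fderiv_character_single (ξ z : E3) (i : Fin 3) :
    fderiv ℝ (fun z : E3 => Complex.exp ((2 * π * inner ℝ z ξ : ℝ) * Complex.I)) z
      (EuclideanSpace.single i 1) =
      2 * π * Complex.I * ξ i * Complex.exp ((2 * π * inner ℝ z ξ : ℝ) * Complex.I) := by
  have h1 : HasFDerivAt (fun z : E3 => inner ℝ z ξ) (innerSL ℝ ξ) z := by
    refine (innerSL ℝ ξ).hasFDerivAt.congr_of_eventuallyEq (.of_forall fun w => ?_)
    simp [real_inner_comm]
  have h2 := ((Complex.ofRealCLM.hasFDerivAt.comp z (h1.const_mul (2 * π))).mul_const Complex.I).cexp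
  have e : (fun z : E3 => Complex.exp ((2 * π * inner ℝ z ξ : ℝ) * Complex.I)) = fun z =>
      Complex.exp ((⇑Complex.ofRealCLM ∘ fun y => 2 * π * inner ℝ y ξ) z * Complex.I) := rfl
  rw [e, h2.fderiv]
  simp [inner_single_one_right]
  ring

theorem integrable_apply_mul_gaussian {s : ℝ} (hs : 0 < s) (i : Fin 3) :
    Integrable fun z : E3 => z i * exp (-(‖z‖ ^ 2 / s)) := by
  refine ((integrable_gaussian (s := 2 * s) (by positivity)).const_mul (1 + 2 * s)).mono'
    (Measurable.aestronglyMeasurable (by fun_prop)) (.of_forall fun z => ?_)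
  rw [norm_mul, norm_of_nonneg (exp_pos _).le]
  set t := ‖z‖ ^ 2 / (2 * s) with ht
  have ht0 : 0 ≤ t := by positivity
  have e : -(‖z‖ ^ 2 / s) = -t + -t := by rw [ht]; field_simp; ring
  rw [e, exp_add, ← mul_assoc]
  refine mul_le_mul_of_nonneg_right ?_ (exp_pos _).le
  rw [exp_neg, ← div_eq_mul_inv, div_le_iff₀ (exp_pos _)]
  have h1 := add_one_le_exp t
  have h2 : ‖z‖ ^ 2 = 2 * s * t := by rw [ht]; field_simp
  calc ‖z i‖ ≤ ‖z‖ := abs_apply_le_norm z i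
    _ ≤ 1 + 2 * s * t := by rw [← h2]; nlinarith [sq_nonneg (‖z‖ - 1)]
    _ ≤ (1 + 2 * s) * (t + 1) := by nlinarith
    _ ≤ _ := by gcongr

theorem integral_apply_mul_gaussian_mul_cexp {s : ℝ} (hs : 0 < s) (ξ : E3) (i : Fin 3) :
    ∫ z : E3, (z i * exp (-(‖z‖ ^ 2 / s))) •
      Complex.exp ((2 * π * inner ℝ z ξ : ℝ) * Complex.I) =
      Complex.I * (π * s * ξ i * ((π * s) ^ (3 / 2 : ℝ) * exp (-(π ^ 2 * ‖ξ‖ ^ 2 * s))) : ℝ) := by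
  set χ : E3 → ℂ := fun z => Complex.exp ((2 * π * inner ℝ z ξ : ℝ) * Complex.I) with hχ
  have hχ1 : ∀ z, ‖χ z‖ ≤ 1 := fun z => by
    rw [hχ]
    exact (Complex.norm_exp_ofReal_mul_I _).le
  have hχc : Continuous χ := (contDiff_character ξ).continuous
  have hG : Integrable fun z : E3 => exp (-(‖z‖ ^ 2 / s)) • χ z := by
    simpa [hχ, Complex.real_smul] using integrable_gaussian_mul_cexp hs ξ
  have hM : Integrable fun z : E3 => (z i * exp (-(‖z‖ ^ 2 / s))) • χ z :=
    (integrable_apply_mul_gaussian hs i).norm.mono'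
      ((integrable_apply_mul_gaussian hs i).1.fun_smul hχc.aestronglyMeasurable)
      (.of_forall fun z => by
        rw [norm_smul]
        exact mul_le_of_le_one_right (norm_nonneg _) (hχ1 z))
  have key := integral_smul_fderiv_eq_neg_fderiv_smul_of_integrable (μ := volume) (𝕜 := ℝ)
    (f := fun z : E3 => exp (-(‖z‖ ^ 2 / s))) (g := χ) (v := EuclideanSpace.single i 1) ?_ ?_ hG
    ?_ ?_
  · simp_rw [fderiv_gaussian_single, hχ, fderiv_character_single] at key
    have e1 : ∫ z : E3, exp (-(‖z‖ ^ 2 / s)) • (2 * π * Complex.I * ξ i *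
        Complex.exp ((2 * π * inner ℝ z ξ : ℝ) * Complex.I)) = 2 * π * Complex.I * ξ i *
        (((π * s) ^ (3 / 2 : ℝ) * exp (-(π ^ 2 * ‖ξ‖ ^ 2 * s)) : ℝ) : ℂ) := by
      rw [← integral_gaussian_mul_cexp hs, ← integral_const_mul]
      congr 1 with z
      rw [Complex.real_smul]
      ring
    rw [e1] at key
    simp_rw [mul_smul (-(2 / s))] at key
    rw [integral_smul, neg_smul, neg_neg, Complex.real_smul] at key
    have hs' : (s : ℂ) ≠ 0 := by exact_mod_cast hs.ne'
    have e2 : ((2 / s : ℝ) : ℂ) ≠ 0 := by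
      push_cast
      exact div_ne_zero two_ne_zero hs'
    refine mul_left_cancel₀ e2 ?_
    rw [← key]
    push_cast
    field_simp
  · simp_rw [fderiv_gaussian_single, mul_smul (-(2 / s))]
    exact hM.smul (-(2 / s))
  · simp_rw [hχ, fderiv_character_single]
    refine ((integrable_gaussian_mul_cexp hs ξ).const_mul (2 * π * Complex.I * ξ i)).congr
      (.of_forall fun z => ?_)
    simp only [Complex.real_smul]
    ring
  · intro z _
    have hd : DifferentiableAt ℝ (fun z : E3 => ‖z‖ ^ 2) z :=
      (hasStrictFDerivAt_norm_sq z).hasFDerivAt.differentiableAt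
    simp_rw [div_eq_mul_inv]
    exact (hd.mul_const s⁻¹).fun_neg.exp
  · intro z _
    exact (contDiff_character ξ).differentiable (by simp) z

theorem fourierInv_apply_eq_integral (h : 𝓢(E3, ℂ)) (x : E3) :
    (𝓕⁻ h) x = ∫ ξ, Complex.exp ((2 * π * inner ℝ ξ x : ℝ) * Complex.I) • h ξ := by
  rw [SchwartzMap.fourierInv_coe, Real.fourierInv_eq']

theorem integrable_character_smul (h : 𝓢(E3, ℂ)) (x : E3) :
    Integrable fun ξ : E3 => Complex.exp ((2 * π * inner ℝ ξ x : ℝ) * Complex.I) • h ξ := by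
  refine h.integrable.bdd_mul (c := 1) (by fun_prop) (.of_forall fun ξ => ?_)
  rw [Complex.norm_exp_ofReal_mul_I]

theorem two_mul_fourierInv_sub_sub (h : 𝓢(E3, ℂ)) (x z : E3) :
    2 * (𝓕⁻ h) x - (𝓕⁻ h) (x - z) - (𝓕⁻ h) (x + z) =
      ∫ ξ, (2 * (1 - cos (2 * π * inner ℝ z ξ)) : ℝ) •
        (Complex.exp ((2 * π * inner ℝ ξ x : ℝ) * Complex.I) • h ξ) := by
  simp only [fourierInv_apply_eq_integral]
  rw [← integral_const_mul, ← integral_sub ((integrable_character_smul h x).const_mul 2)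
    (integrable_character_smul h _), ← integral_sub (by
      exact ((integrable_character_smul h x).const_mul 2).sub (integrable_character_smul h _))
    (integrable_character_smul h _)]
  congr 1 with ξ
  rw [inner_sub_right, inner_add_right, ← real_inner_comm z ξ]
  simp only [smul_eq_mul, Complex.real_smul]
  set a := inner ℝ ξ x
  set b := inner ℝ ξ z
  have e1 : ((2 * π * (a - b) : ℝ) : ℂ) * Complex.I =
    (2 * π * a : ℝ) * Complex.I + (-((2 * π * b : ℝ) : ℂ)) * Complex.I := by push_cast; ring
  have e2 : ((2 * π * (a + b) : ℝ) : ℂ) * Complex.I =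
    (2 * π * a : ℝ) * Complex.I + ((2 * π * b : ℝ) : ℂ) * Complex.I := by push_cast; ring
  have e3 : ((2 * (1 - cos (2 * π * b)) : ℝ) : ℂ) =
      2 - (Complex.exp (((2 * π * b : ℝ) : ℂ) * Complex.I) +
        Complex.exp ((-((2 * π * b : ℝ) : ℂ)) * Complex.I)) := by
    rw [← Complex.two_cos]
    push_cast
    ring
  rw [e1, e2, e3, Complex.exp_add, Complex.exp_add]
  ring

theorem integrable_and_integral_second_difference (h h₂ : 𝓢(E3, ℂ))
    (hh : ∀ ξ, h₂ ξ = (2 * π * ‖ξ‖ : ℝ) • h ξ) (x : E3) :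
    Integrable (fun z : E3 => (1 / ‖z‖ ^ 4 : ℝ) •
      (2 * (𝓕⁻ h) x - (𝓕⁻ h) (x - z) - (𝓕⁻ h) (x + z))) ∧
    ∫ z : E3, (1 / ‖z‖ ^ 4 : ℝ) • (2 * (𝓕⁻ h) x - (𝓕⁻ h) (x - z) - (𝓕⁻ h) (x + z)) =
      (2 * π ^ 2 : ℝ) • (𝓕⁻ h₂) x := by
  set H : E3 → E3 → ℂ := fun z ξ => (2 * ((1 - cos (2 * π * inner ℝ z ξ)) / ‖z‖ ^ 4) : ℝ) •
    (Complex.exp ((2 * π * inner ℝ ξ x : ℝ) * Complex.I) • h ξ) with hH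
  have hz : ∀ z, ∫ ξ, H z ξ = (1 / ‖z‖ ^ 4 : ℝ) •
      (2 * (𝓕⁻ h) x - (𝓕⁻ h) (x - z) - (𝓕⁻ h) (x + z)) := by
    intro z
    rw [two_mul_fourierInv_sub_sub, ← integral_smul]
    congr 1 with ξ
    simp only [hH, smul_smul]
    congr 1
    ring_nf
  have hξi : ∀ ξ, Integrable fun z => H z ξ := fun ξ =>
    ((integrable_and_integral_one_sub_cos ξ).1.const_mul 2).smul_const _
  have hξ : ∀ ξ, ∫ z, H z ξ = (2 * π ^ 2 : ℝ) •
      (Complex.exp ((2 * π * inner ℝ ξ x : ℝ) * Complex.I) • h₂ ξ) := by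
    intro ξ
    simp only [hH]
    rw [integral_smul_const, integral_const_mul, (integrable_and_integral_one_sub_cos ξ).2, hh]
    simp only [smul_eq_mul, Complex.real_smul]
    push_cast
    ring
  have hnorm : ∀ ξ, ∫ z, ‖H z ξ‖ = 2 * π ^ 2 * ‖h₂ ξ‖ := by
    intro ξ
    have : ∀ z, ‖H z ξ‖ = 2 * ((1 - cos (2 * π * inner ℝ z ξ)) / ‖z‖ ^ 4) * ‖h ξ‖ := by
      intro z
      have := sub_nonneg.mpr (cos_le_one (2 * π * inner ℝ z ξ))
      simp only [hH]
      rw [norm_smul, norm_smul, Complex.norm_exp_ofReal_mul_I, one_mul, Real.norm_of_nonneg]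
      positivity
    simp only [this]
    rw [integral_mul_const, integral_const_mul, (integrable_and_integral_one_sub_cos ξ).2, hh,
      norm_smul, Real.norm_of_nonneg (by positivity)]
    ring
  have hmeas : Measurable (Function.uncurry H) := by
    have := h.continuous.measurable
    simp only [hH, Function.uncurry_def]
    fun_prop
  have hint : Integrable (Function.uncurry H) (volume.prod volume) := by
    rw [integrable_prod_iff' hmeas.aestronglyMeasurable]
    refine ⟨.of_forall hξi, ?_⟩
    simp only [Function.uncurry_apply_pair, hnorm]
    exact h₂.integrable.norm.const_mul _
  refine ⟨hint.integral_prod_left.congr (.of_forall hz), ?_⟩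
  simp only [← hz]
  rw [integral_integral_swap hint]
  simp only [hξ]
  rw [integral_smul, fourierInv_apply_eq_integral]

theorem one_div_norm_pow_le {ε : ℝ} (hε : 0 < ε) {z : E3} (hz : ε < ‖z‖) :
    1 / ‖z‖ ^ 4 ≤ (1 / ε ^ 4 + 1) * (1 / (1 + ‖z‖ ^ 4)) := by
  have hz0 : 0 < ‖z‖ := hε.trans hz
  have : ε ^ 4 ≤ ‖z‖ ^ 4 := pow_le_pow_left₀ hε.le hz.le 4
  rw [← mul_one_div, mul_one_div, mul_one_div, div_le_div_iff₀ (by positivity) (by positivity), one_mul,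
    add_mul, one_mul, div_mul_eq_mul_div, one_mul]
  have : 1 ≤ ‖z‖ ^ 4 / ε ^ 4 := (one_le_div (by positivity)).mpr this
  linarith

theorem halfLap_eq_re_fourierInv (φ : 𝓢(E3, ℝ)) (h h₂ : 𝓢(E3, ℂ))
    (hh : ∀ ξ, h₂ ξ = (2 * π * ‖ξ‖ : ℝ) • h ξ) (hφ : ∀ x, φ x = ((𝓕⁻ h) x).re) (x : E3) :
    halfLap φ x = ((𝓕⁻ h₂) x).re := by
  obtain ⟨hi, hI⟩ := integrable_and_integral_second_difference h h₂ hh x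
  set S : E3 → ℝ := fun z => (2 * φ x - φ (x - z) - φ (x + z)) / ‖z‖ ^ 4 with hS
  have hSre : ∀ z, S z = RCLike.re ((1 / ‖z‖ ^ 4 : ℝ) •
      (2 * (𝓕⁻ h) x - (𝓕⁻ h) (x - z) - (𝓕⁻ h) (x + z))) := by
    intro z
    simp only [hS, hφ, RCLike.re_to_complex, Complex.smul_re, Complex.sub_re, Complex.mul_re]
    simp
    ring
  have hSi : Integrable S := hi.re.congr (.of_forall fun z => (hSre z).symm)
  have hSI : ∫ z, S z = 2 * π ^ 2 * ((𝓕⁻ h₂) x).re := by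
    simp only [hSre]
    rw [integral_re hi, hI, RCLike.re_to_complex, Complex.smul_re, smul_eq_mul]
  obtain ⟨C, hC0, hC⟩ := φ.exists_le_weight
  have hb : ∀ y, |φ y| ≤ C := fun y => (hC y).trans (div_le_self hC0 (by
    have := pow_nonneg (norm_nonneg y) 4; linarith))
  have hcont := φ.continuous
  have hset : ∀ ε : ℝ, 0 < ε → ∀ σ : ℝ,
      IntegrableOn (fun z : E3 => (φ x - φ (x - σ • z)) / ‖z‖ ^ 4) {z : E3 | ε < ‖z‖} := by
    intro ε hε σ
    have hms : MeasurableSet {z : E3 | ε < ‖z‖} := measurableSet_lt measurable_const measurable_norm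
    refine Integrable.mono' ((integrable_weight.const_mul ((2 * C) * (1 / ε ^ 4 + 1))).integrableOn)
      ?_ ?_
    · exact Measurable.aestronglyMeasurable (by have := hcont.measurable; fun_prop)
    · filter_upwards [ae_restrict_mem hms] with z hz
      have h1 := one_div_norm_pow_le hε hz
      have h2 : |φ x - φ (x - σ • z)| ≤ 2 * C :=
        (abs_sub _ _).trans (by linarith [hb x, hb (x - σ • z)])
      rw [norm_div, norm_pow, norm_norm, Real.norm_eq_abs, div_eq_mul_one_div, mul_assoc]
      exact mul_le_mul h2 h1 (by positivity) (by positivity)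
  have key : ∀ ε : ℝ, 0 < ε → (∫ y in {y : E3 | ε < ‖x - y‖}, (φ x - φ y) / ‖x - y‖ ^ 4) =
      (1 / 2) * ∫ z in {z : E3 | ε < ‖z‖}, S z := by
    intro ε hε
    have hms : MeasurableSet {z : E3 | ε < ‖z‖} := measurableSet_lt measurable_const measurable_norm
    have hms' : MeasurableSet {y : E3 | ε < ‖x - y‖} :=
      measurableSet_lt measurable_const (by fun_prop)
    have e1 : (∫ y in {y : E3 | ε < ‖x - y‖}, (φ x - φ y) / ‖x - y‖ ^ 4) =
        ∫ z in {z : E3 | ε < ‖z‖}, (φ x - φ (x - z)) / ‖z‖ ^ 4 := by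
      rw [← integral_indicator hms, ← integral_indicator hms', ← integral_sub_left_eq_self _ volume x]
      congr 1 with z
      simp [Set.indicator]
    have e2 : (∫ z in {z : E3 | ε < ‖z‖}, (φ x - φ (x - z)) / ‖z‖ ^ 4) =
        ∫ z in {z : E3 | ε < ‖z‖}, (φ x - φ (x + z)) / ‖z‖ ^ 4 := by
      rw [← integral_indicator hms, ← integral_indicator hms, ← integral_neg_eq_self]
      congr 1 with z
      simp [Set.indicator]
    have e3 : (∫ z in {z : E3 | ε < ‖z‖}, S z) =
        (∫ z in {z : E3 | ε < ‖z‖}, (φ x - φ (x - z)) / ‖z‖ ^ 4) +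
        ∫ z in {z : E3 | ε < ‖z‖}, (φ x - φ (x + z)) / ‖z‖ ^ 4 := by
      have i1 := hset ε hε 1
      have i2 := hset ε hε (-1)
      simp only [one_smul, neg_smul, sub_neg_eq_add] at i1 i2
      rw [← integral_add i1 i2]
      congr 1 with z
      simp only [hS]
      ring
    rw [e3, ← e2, ← e1]
    ring
  have hlim : Tendsto (fun ε : ℝ => ∫ z in {z : E3 | ε < ‖z‖}, S z) (nhdsWithin 0 (Set.Ioi 0))
      (nhds (∫ z, S z)) := by
    have hms : ∀ ε : ℝ, MeasurableSet {z : E3 | ε < ‖z‖} := fun ε =>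
      measurableSet_lt measurable_const measurable_norm
    simp_rw [← integral_indicator (hms _)]
    refine tendsto_integral_filter_of_dominated_convergence (fun z => ‖S z‖)
      (.of_forall fun ε => (hSi.1.indicator (hms ε))) (.of_forall fun ε => .of_forall fun z =>
        norm_indicator_le_norm_self _ _) hSi.norm (.of_forall fun z => ?_)
    rcases eq_or_ne z 0 with rfl | hz
    · have : S 0 = 0 := by simp [hS]
      refine tendsto_const_nhds.congr fun ε => ?_
      by_cases h : (0 : E3) ∈ {z : E3 | ε < ‖z‖} <;> simp [Set.indicator, this]
    · refine tendsto_const_nhds.congr' ?_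
      have : ∀ᶠ ε : ℝ in nhdsWithin 0 (Set.Ioi 0), ε < ‖z‖ :=
        nhdsWithin_le_nhds (Iio_mem_nhds (norm_pos_iff.mpr hz))
      filter_upwards [this] with ε hε
      rw [Set.indicator_of_mem]
      exact hε
  unfold halfLap
  refine Tendsto.limUnder_eq ?_
  have := (hlim.const_mul (1 / 2)).const_mul (1 / π ^ 2)
  rw [hSI] at this
  have e : 1 / π ^ 2 * (1 / 2 * (2 * π ^ 2 * ((𝓕⁻ h₂) x).re)) = ((𝓕⁻ h₂) x).re := by
    field_simp
  rw [e] at this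
  refine this.congr' ?_
  filter_upwards [self_mem_nhdsWithin] with ε hε
  rw [key ε hε]

theorem SchwartzMap.exists_norm_le {F : Type*} [NormedAddCommGroup F] [NormedSpace ℝ F]
    (φ : 𝓢(E3, F)) : ∃ C, ∀ x, ‖φ x‖ ≤ C := by
  obtain ⟨C, hC0, hC⟩ := φ.exists_le_weight
  exact ⟨C, fun y => (hC y).trans (div_le_self hC0 (by
    have := pow_nonneg (norm_nonneg y) 4; linarith))⟩

theorem integral_exp_mul_apply_div_sq (z : E3) (i : Fin 3) :
    IntegrableOn (fun s : ℝ => z i * exp (-(‖z‖ ^ 2 / s)) / s ^ 2) (Set.Ioi 0) ∧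
    ∫ s in Set.Ioi (0 : ℝ), z i * exp (-(‖z‖ ^ 2 / s)) / s ^ 2 = gradLog i z := by
  simp only [mul_div_assoc]
  rcases eq_or_ne z 0 with rfl | hz
  · simp [gradLog]
  · have := norm_pos_iff.mpr hz
    obtain ⟨h1, h2⟩ := integrableOn_and_integral_exp_neg_div_div_sq (r := ‖z‖ ^ 2) (by positivity)
    refine ⟨h1.const_mul _, ?_⟩
    rw [integral_const_mul, h2, gradLog, mul_one_div]

theorem integral_apply_mul_gaussian_mul_fourierInv (g : 𝓢(E3, ℂ)) {s : ℝ} (hs : 0 < s)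
    (y : E3) (i : Fin 3) :
    ∫ z : E3, (z i * exp (-(‖z‖ ^ 2 / s))) • (𝓕⁻ g) (y + z) =
      ∫ ξ : E3, (π * s * ξ i * ((π * s) ^ (3 / 2 : ℝ) * exp (-(π ^ 2 * ‖ξ‖ ^ 2 * s))) : ℝ) •
        (Complex.I * (Complex.exp ((2 * π * inner ℝ ξ y : ℝ) * Complex.I) • g ξ)) := by
  set H : E3 → E3 → ℂ := fun z ξ => ((z i * exp (-(‖z‖ ^ 2 / s))) •
    Complex.exp ((2 * π * inner ℝ z ξ : ℝ) * Complex.I)) *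
      (Complex.exp ((2 * π * inner ℝ ξ y : ℝ) * Complex.I) • g ξ) with hH
  have hint : Integrable (Function.uncurry H) (volume.prod volume) := by
    have hm := g.continuous.measurable
    refine ((integrable_apply_mul_gaussian hs i).mul_prod g.integrable.norm).mono
      (Measurable.aestronglyMeasurable (by simp only [hH, Function.uncurry_def]; fun_prop))
      (.of_forall fun p => ?_)
    simp only [hH, Function.uncurry_def]
    rw [norm_mul, norm_smul, norm_smul, Complex.norm_exp_ofReal_mul_I,
      Complex.norm_exp_ofReal_mul_I, norm_mul (_ * _), norm_norm, one_mul, mul_one]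
  have h1 : ∀ z : E3, (z i * exp (-(‖z‖ ^ 2 / s))) • (𝓕⁻ g) (y + z) = ∫ ξ, H z ξ := by
    intro z
    rw [fourierInv_apply_eq_integral, ← integral_smul]
    congr 1 with ξ
    simp only [hH, Complex.real_smul, smul_eq_mul]
    rw [inner_add_right, real_inner_comm ξ z, mul_add, Complex.ofReal_add, add_mul, Complex.exp_add]
    ring
  simp only [h1]
  rw [integral_integral_swap hint]
  congr 1 with ξ
  simp only [hH]
  rw [integral_mul_const, integral_apply_mul_gaussian_mul_cexp hs ξ i]
  simp only [Complex.real_smul]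
  ring

theorem integral_sqrt_moment {ξ : E3} (hξ : ξ ≠ 0) (i : Fin 3) :
    IntegrableOn (fun s : ℝ => (π * s * ξ i * ((π * s) ^ (3 / 2 : ℝ) *
      exp (-(π ^ 2 * ‖ξ‖ ^ 2 * s)))) / s ^ 2) (Set.Ioi 0) ∧
    ∫ s in Set.Ioi (0 : ℝ), (π * s * ξ i * ((π * s) ^ (3 / 2 : ℝ) *
      exp (-(π ^ 2 * ‖ξ‖ ^ 2 * s)))) / s ^ 2 = ξ i / (2 * ‖ξ‖ ^ 3) := by
  have hn := norm_pos_iff.mpr hξ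
  obtain ⟨h1, h2⟩ := integrableOn_and_integral_sqrt_mul_exp (A := π ^ 2 * ‖ξ‖ ^ 2) (by positivity)
  have e : ∀ s ∈ Set.Ioi (0 : ℝ), (π * ξ i * π ^ (3 / 2 : ℝ)) *
      (s ^ (1 / 2 : ℝ) * exp (-(π ^ 2 * ‖ξ‖ ^ 2 * s))) = (π * s * ξ i * ((π * s) ^ (3 / 2 : ℝ) *
      exp (-(π ^ 2 * ‖ξ‖ ^ 2 * s)))) / s ^ 2 := by
    intro s hs
    have hs : 0 < s := hs
    have : s ^ (3 / 2 : ℝ) = s * s ^ (1 / 2 : ℝ) := by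
      rw [show (3 / 2 : ℝ) = 1 + 1 / 2 by norm_num, rpow_add hs, rpow_one]
    rw [mul_rpow pi_nonneg hs.le, this]
    field_simp
  refine ⟨IntegrableOn.congr_fun (h1.const_mul _) e measurableSet_Ioi, ?_⟩
  rw [← setIntegral_congr_fun measurableSet_Ioi e, integral_const_mul, h2]
  have h3 : (1 / (π ^ 2 * ‖ξ‖ ^ 2)) ^ (3 / 2 : ℝ) = 1 / (π ^ 3 * ‖ξ‖ ^ 3) := by
    rw [show 1 / (π ^ 2 * ‖ξ‖ ^ 2) = (1 / (π * ‖ξ‖)) ^ (2 : ℝ) by rw [rpow_two]; ring,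
      ← rpow_mul (by positivity), show (2 * (3 / 2) : ℝ) = (3 : ℕ) by norm_num, rpow_natCast]
    ring
  have h4 : π ^ (3 / 2 : ℝ) = π * √π := by
    rw [show (3 / 2 : ℝ) = 1 + 1 / 2 by norm_num, rpow_add pi_pos, rpow_one, sqrt_eq_rpow]
  have h5 := mul_self_sqrt pi_nonneg
  rw [h3, h4]
  field_simp
  linear_combination ξ i * h5

theorem potential_fourierInv_eq (g G : 𝓢(E3, ℂ)) (i : Fin 3)
    (hG : ∀ ξ, G ξ = (ξ i / (2 * ‖ξ‖ ^ 3) : ℝ) • (Complex.I * g ξ)) (y : E3) :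
    potential i (⇑(𝓕⁻ g : 𝓢(E3, ℂ))) y = -(𝓕⁻ G) y := by
  set ψ := 𝓕⁻ g with hψ
  obtain ⟨M, hM⟩ := ψ.exists_norm_le
  have hψi : Integrable (fun z => gradLog i z • ψ (y + z)) := by
    have := (integrable_gradLog_smul i (ψ.integrable (μ := volume)) (x := y) one_pos
      (fun z _ => hM z)).comp_sub_left y
    refine this.comp_neg.neg.congr (.of_forall fun z => ?_)
    simp [gradLog_neg]
  have e1 : potential i ψ y = -∫ z, gradLog i z • ψ (y + z) := by
    rw [potential, ← integral_sub_left_eq_self _ volume y, ← integral_neg_eq_self, ← integral_neg]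
    simp [gradLog_neg]
  rw [e1, neg_inj]
  set H : E3 → ℝ → ℂ := fun z s => (z i * exp (-(‖z‖ ^ 2 / s)) / s ^ 2) • ψ (y + z) with hH
  have hHi : ∀ z, IntegrableOn (fun s => H z s) (Set.Ioi 0) := fun z =>
    Integrable.smul_const (𝕜 := ℝ) (integral_exp_mul_apply_div_sq z i).1 (ψ (y + z))
  have hHint : Integrable (Function.uncurry H) (volume.prod (volume.restrict (Set.Ioi 0))) := by
    have hm : Measurable (fun x => ψ x) := ψ.continuous.measurable
    rw [integrable_prod_iff (Measurable.aestronglyMeasurable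
      (by simp only [hH, Function.uncurry_def]; fun_prop))]
    refine ⟨.of_forall hHi, ?_⟩
    refine hψi.norm.congr (.of_forall fun z => ?_)
    simp only [hH, Function.uncurry_apply_pair, norm_smul]
    rw [integral_mul_const]
    congr 1
    have := (integral_exp_mul_apply_div_sq z i).2
    rcases le_total 0 (z i) with h | h
    · rw [← this, Real.norm_of_nonneg (integral_nonneg fun s => by positivity)]
      congr 1 with s
      rw [Real.norm_of_nonneg (by positivity)]
    · have h' : ∀ s, z i * exp (-(‖z‖ ^ 2 / s)) / s ^ 2 ≤ 0 := fun s =>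
        div_nonpos_of_nonpos_of_nonneg (mul_nonpos_of_nonpos_of_nonneg h (exp_pos _).le)
          (by positivity)
      rw [← this, Real.norm_of_nonpos (integral_nonpos h'), ← integral_neg]
      congr 1 with s
      rw [Real.norm_of_nonpos (h' s)]
  have e2 : ∀ z, gradLog i z • ψ (y + z) = ∫ s in Set.Ioi 0, H z s := by
    intro z
    simp only [hH]
    rw [integral_smul_const, (integral_exp_mul_apply_div_sq z i).2]
  simp only [e2]
  rw [integral_integral_swap hHint]
  set L : ℝ → E3 → ℂ := fun s ξ =>
    ((π * s * ξ i * ((π * s) ^ (3 / 2 : ℝ) * exp (-(π ^ 2 * ‖ξ‖ ^ 2 * s)))) / s ^ 2 : ℝ) •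
        (Complex.I * (Complex.exp ((2 * π * inner ℝ ξ y : ℝ) * Complex.I) • g ξ)) with hL
  have e3 : ∀ s ∈ Set.Ioi (0 : ℝ), ∫ z, H z s = ∫ ξ, L s ξ := by
    intro s hs
    have hs : 0 < s := hs
    have := congrArg (fun w : ℂ => (1 / s ^ 2 : ℝ) • w)
      (integral_apply_mul_gaussian_mul_fourierInv g hs y i)
    simp only [← integral_smul, smul_smul] at this
    simp only [hH, hL]
    convert this using 5 <;> ring
  rw [setIntegral_congr_fun measurableSet_Ioi e3]
  have hLi : ∀ ξ, IntegrableOn (fun s => L s ξ) (Set.Ioi 0) := by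
    intro ξ
    rcases eq_or_ne ξ 0 with rfl | hξ
    · simp [hL]
    · exact (integral_sqrt_moment hξ i).1.smul_const _
  have hLe : ∀ ξ, ∫ s in Set.Ioi 0, L s ξ =
      Complex.exp ((2 * π * inner ℝ ξ y : ℝ) * Complex.I) • G ξ := by
    intro ξ
    rcases eq_or_ne ξ 0 with rfl | hξ
    · simp [hL, hG]
    · simp only [hL]
      rw [integral_smul_const, (integral_sqrt_moment hξ i).2, hG]
      simp only [Complex.real_smul, smul_eq_mul]
      ring
  have hLint : Integrable (Function.uncurry L) ((volume.restrict (Set.Ioi 0)).prod volume) := by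
    have hm := g.continuous.measurable
    rw [integrable_prod_iff' (Measurable.aestronglyMeasurable
      (by simp only [hL, Function.uncurry_def]; fun_prop))]
    refine ⟨.of_forall hLi, ?_⟩
    refine G.integrable.norm.congr (.of_forall fun ξ => ?_)
    simp only [hL, Function.uncurry_apply_pair, norm_smul, norm_mul, Complex.norm_I, one_mul,
      Complex.norm_exp_ofReal_mul_I]
    rw [integral_mul_const, hG, norm_smul, norm_mul, Complex.norm_I, one_mul]
    congr 1
    rcases eq_or_ne ξ 0 with rfl | hξ
    · simp
    rw [← (integral_sqrt_moment hξ i).2]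
    rcases le_total 0 (ξ i) with h | h
    · have h' : ∀ s ∈ Set.Ioi (0 : ℝ), 0 ≤ (π * s * ξ i * ((π * s) ^ (3 / 2 : ℝ) *
          exp (-(π ^ 2 * ‖ξ‖ ^ 2 * s)))) / s ^ 2 := fun s hs => by
        have hs : 0 < s := hs
        positivity
      rw [Real.norm_of_nonneg (setIntegral_nonneg measurableSet_Ioi h')]
      exact setIntegral_congr_fun measurableSet_Ioi fun s hs => (Real.norm_of_nonneg (h' s hs)).symm
    · have h' : ∀ s ∈ Set.Ioi (0 : ℝ), (π * s * ξ i * ((π * s) ^ (3 / 2 : ℝ) *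
          exp (-(π ^ 2 * ‖ξ‖ ^ 2 * s)))) / s ^ 2 ≤ 0 := fun s hs => by
        have hs : 0 < s := hs
        refine div_nonpos_of_nonpos_of_nonneg (mul_nonpos_of_nonpos_of_nonneg
          (mul_nonpos_of_nonneg_of_nonpos ?_ h) ?_) ?_ <;> positivity
      rw [Real.norm_of_nonpos (setIntegral_nonpos measurableSet_Ioi h'), ← integral_neg]
      exact setIntegral_congr_fun measurableSet_Ioi fun s hs => (Real.norm_of_nonpos (h' s hs)).symm
  rw [integral_integral_swap hLint, fourierInv_apply_eq_integral]
  simp only [hLe]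

theorem exists_schwartzMap_eq_mul {g : 𝓢(E3, ℂ)} (hg : HasCompactSupport g)
    (h0 : (0 : E3) ∉ tsupport g) {m : E3 → ℂ} (hm : ∀ x ≠ 0, ContDiffAt ℝ (⊤ : ℕ∞) m x) :
    ∃ G : 𝓢(E3, ℂ), ∀ ξ, G ξ = m ξ * g ξ := by
  have hcd : ContDiff ℝ (⊤ : ℕ∞) fun ξ => m ξ * g ξ := by
    refine contDiff_iff_contDiffAt.mpr fun x => ?_
    by_cases hx : x ∈ tsupport g
    · exact (hm x fun h => h0 (h ▸ hx)).mul (g.smooth (⊤ : ℕ∞)).contDiffAt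
    · refine (contDiffAt_const (c := (0 : ℂ))).congr_of_eventuallyEq ?_
      filter_upwards [notMem_tsupport_iff_eventuallyEq.mp hx] with y hy
      simp [hy]
  have hcs : HasCompactSupport fun ξ => m ξ * g ξ := hg.mul_left
  exact ⟨hcs.toSchwartzMap hcd, fun ξ => rfl⟩

theorem contDiffAt_norm_ofReal {x : E3} (hx : x ≠ 0) :
    ContDiffAt ℝ (⊤ : ℕ∞) (fun ξ : E3 => ((‖ξ‖ : ℝ) : ℂ)) x :=
  Complex.ofRealCLM.contDiff.contDiffAt.comp x (contDiffAt_norm ℝ hx)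

theorem contDiff_apply_ofReal (i : Fin 3) :
    ContDiff ℝ (⊤ : ℕ∞) (fun ξ : E3 => ((ξ i : ℝ) : ℂ)) :=
  Complex.ofRealCLM.contDiff.comp (EuclideanSpace.proj (𝕜 := ℝ) i).contDiff

theorem pd_comm {u : E3 → ℝ} (hu : ContDiff ℝ 2 u) (i j : Fin 3) (x : E3) :
    pd i (pd j u) x = pd j (pd i u) x := by
  have hd : DifferentiableAt ℝ (fderiv ℝ u) x :=
    (hu.fderiv_right (m := 1) (by norm_num)).differentiable one_ne_zero x
  have h := (hu.contDiffAt (x := x)).isSymmSndFDerivAt (by simp)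
  have e : ∀ k l : Fin 3, pd k (pd l u) x =
      fderiv ℝ (fderiv ℝ u) x (EuclideanSpace.single k 1) (EuclideanSpace.single l 1) := by
    intro k l
    unfold pd
    rw [fderiv_clm_apply hd (differentiableAt_const _)]
    simp
  rw [e, e, h.eq]

/-- The partial derivative of a Schwartz function. -/
noncomputable def schwartzPd {F : Type*} [NormedAddCommGroup F] [NormedSpace ℝ F] (i : Fin 3)
    (θ : 𝓢(E3, F)) : 𝓢(E3, F) :=
  LineDeriv.lineDerivOp (EuclideanSpace.single i (1 : ℝ)) θ

theorem schwartzPd_apply {F : Type*} [NormedAddCommGroup F] [NormedSpace ℝ F] (i : Fin 3)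
    (θ : 𝓢(E3, F)) (x : E3) :
    schwartzPd i θ x = fderiv ℝ θ x (EuclideanSpace.single i 1) := rfl

theorem schwartzPd_comm {F : Type*} [NormedAddCommGroup F] [NormedSpace ℝ F] (i j : Fin 3)
    (θ : 𝓢(E3, F)) (x : E3) :
    schwartzPd i (schwartzPd j θ) x = schwartzPd j (schwartzPd i θ) x := by
  have hu := θ.smooth 2
  have hd : DifferentiableAt ℝ (fderiv ℝ θ) x :=
    (hu.fderiv_right (m := 1) (by norm_num)).differentiable one_ne_zero x
  have h := (hu.contDiffAt (x := x)).isSymmSndFDerivAt (by simp)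
  have e : ∀ k l : Fin 3, schwartzPd k (schwartzPd l θ) x =
      fderiv ℝ (fderiv ℝ θ) x (EuclideanSpace.single k 1) (EuclideanSpace.single l 1) := by
    intro k l
    have : ⇑(schwartzPd l θ) = fun y => fderiv ℝ θ y (EuclideanSpace.single l 1) := rfl
    rw [schwartzPd_apply, this, fderiv_clm_apply hd (differentiableAt_const _)]
    simp
  rw [e, e, h.eq]

theorem schwartzPd_fourierInv (i : Fin 3) (k k' : 𝓢(E3, ℂ))
    (hk : ∀ ξ, k' ξ = (2 * π * Complex.I * (ξ i : ℝ)) * k ξ) :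
    schwartzPd i (𝓕⁻ k) = 𝓕⁻ k' := by
  rw [schwartzPd, SchwartzMap.lineDerivOp_fourierInv_eq]
  congr 1
  ext ξ
  rw [smul_apply, SchwartzMap.smulLeftCLM_apply_apply (by fun_prop), hk, inner_single_one_right]
  simp only [smul_eq_mul, Complex.real_smul]
  ring

theorem integrable_smul_schwartz {F : Type*} [NormedAddCommGroup F] [NormedSpace ℝ F]
    {w : E3 → ℝ} (hw : Continuous w) (hwi : Integrable fun x => |w x| / (1 + ‖x‖ ^ 4))
    (θ : 𝓢(E3, F)) : Integrable fun x => w x • θ x := by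
  obtain ⟨C, -, hC⟩ := θ.exists_le_weight
  exact integrable_smul_of_weight hw.aestronglyMeasurable hwi θ.continuous.aestronglyMeasurable hC

theorem integral_div_smul_schwartz {F : Type*} [NormedAddCommGroup F] [NormedSpace ℝ F]
    (Y : Fin 3 → E3 → ℝ) (hY : ∀ k, ContDiff ℝ 1 (Y k))
    (hYi : ∀ k, Integrable fun x => |Y k x| / (1 + ‖x‖ ^ 4))
    (hD : Integrable fun x => |∑ k, pd k (Y k) x| / (1 + ‖x‖ ^ 4)) (θ : 𝓢(E3, F)) :
    ∫ x, (∑ k, pd k (Y k) x) • θ x = -∑ k, ∫ x, Y k x • schwartzPd k θ x := by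
  obtain ⟨C₀, -, h0⟩ := θ.exists_le_weight
  obtain ⟨C₁, -, h1⟩ := θ.exists_fderiv_le_weight
  have hle : ∀ {a b : ℝ} (x : E3), a ≤ b → a / (1 + ‖x‖ ^ 4) ≤ b / (1 + ‖x‖ ^ 4) :=
    fun x h => div_le_div_of_nonneg_right h (by positivity)
  rw [integral_div_smul_eq_neg Y hY hYi hD θ (θ.smooth 1) (max C₀ C₁)
    (fun x => (h0 x).trans (hle x (le_max_left _ _)))
    (fun x => (h1 x).trans (hle x (le_max_right _ _))), ← integral_finsetSum _ fun k _ =>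
      integrable_smul_schwartz (hY k).continuous (hYi k) (schwartzPd k θ)]
  rfl

theorem contDiff_pd {u : E3 → ℝ} {n m : ℕ∞} (hu : ContDiff ℝ n u) (i : Fin 3) (h : m + 1 ≤ n) :
    ContDiff ℝ m (pd i u) :=
  (hu.fderiv_right (m := m) (by exact_mod_cast h)).clm_apply contDiff_const

theorem integral_pd_smul_laplacian {F : Type*} [NormedAddCommGroup F] [NormedSpace ℝ F]
    {u : E3 → ℝ} (hu : ContDiff ℝ 2 u)
    (hgi : ∀ i, Integrable fun x => |pd i u x| / (1 + ‖x‖ ^ 4))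
    (hl : Integrable fun x => |lap u x| / (1 + ‖x‖ ^ 4)) (θ : 𝓢(E3, F)) (i : Fin 3) :
    ∫ x, pd i u x • ∑ j, schwartzPd j (schwartzPd j θ) x =
      -∫ x, lap u x • schwartzPd i θ x := by
  have hp : ∀ i, ContDiff ℝ 1 (pd i u) := fun i => contDiff_pd (n := 2) (m := 1) hu i (by norm_num)
  have hint : ∀ (k : Fin 3) (θ : 𝓢(E3, F)), Integrable fun x => pd k u x • θ x := fun k θ =>
    integrable_smul_schwartz (hp k).continuous (hgi k) θ
  have h1 : ∀ j, ∫ x, pd i u x • schwartzPd j (schwartzPd j θ) x =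
      ∫ x, pd j u x • schwartzPd i (schwartzPd j θ) x := by
    intro j
    set Y : Fin 3 → E3 → ℝ := fun k x =>
      (if k = i then (1 : ℝ) else 0) * pd j u x - (if k = j then (1 : ℝ) else 0) * pd i u x with hY
    have hYc : ∀ k, ContDiff ℝ 1 (Y k) := fun k =>
      (contDiff_const.mul (hp j)).sub (contDiff_const.mul (hp i))
    have hdiv : ∀ x, ∑ k, pd k (Y k) x = 0 := by
      intro x
      have e : ∀ k, pd k (Y k) x = (if k = i then (1 : ℝ) else 0) * pd k (pd j u) x -
          (if k = j then (1 : ℝ) else 0) * pd k (pd i u) x := by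
        intro k
        have d : ∀ l, DifferentiableAt ℝ (pd l u) x := fun l =>
          (hp l).differentiable one_ne_zero x
        simp only [hY]
        rw [pd, fderiv_fun_sub ((d j).const_mul _) ((d i).const_mul _), fderiv_const_mul (d j),
          fderiv_const_mul (d i)]
        rfl
      simp only [e, Finset.sum_sub_distrib, ite_mul, one_mul, zero_mul, Finset.sum_ite_eq',
        Finset.mem_univ, if_true]
      rw [pd_comm hu, sub_self]
    have hYi : ∀ k, Integrable fun x => |Y k x| / (1 + ‖x‖ ^ 4) := by
      intro k
      refine ((hgi j).add (hgi i)).mono' ((hYc k).continuous.abs.div continuous_weight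
        (fun x => (weight_pos x).ne')).aestronglyMeasurable (.of_forall fun x => ?_)
      have := weight_pos x
      simp only [Pi.add_apply]
      rw [← add_div, Real.norm_of_nonneg (by positivity)]
      refine div_le_div_of_nonneg_right ?_ this.le
      refine (abs_sub _ _).trans (add_le_add ?_ ?_) <;> rw [abs_mul] <;> split_ifs <;> simp
    have := integral_div_smul_schwartz Y hYc hYi (by simp [hdiv]) (schwartzPd j θ)
    simp only [hdiv, zero_smul, integral_zero] at this
    have e2 : ∑ k, ∫ x, Y k x • schwartzPd k (schwartzPd j θ) x =
        (∫ x, pd j u x • schwartzPd i (schwartzPd j θ) x) -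
        (∫ x, pd i u x • schwartzPd j (schwartzPd j θ) x) := by
      have : ∀ k, ∫ x, Y k x • schwartzPd k (schwartzPd j θ) x =
          (if k = i then (1 : ℝ) else 0) • (∫ x, pd j u x • schwartzPd k (schwartzPd j θ) x) -
          (if k = j then (1 : ℝ) else 0) • (∫ x, pd i u x • schwartzPd k (schwartzPd j θ) x) := by
        intro k
        rw [← integral_smul, ← integral_smul, ← integral_sub ((hint _ _).fun_smul _)
          ((hint _ _).fun_smul _)]
        simp only [hY, sub_smul, mul_smul]
      simp only [this, Finset.sum_sub_distrib, ite_smul, one_smul, zero_smul, Finset.sum_ite_eq',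
        Finset.mem_univ, if_true]
    rw [e2] at this
    exact (sub_eq_zero.mp (neg_eq_zero.mp this.symm)).symm
  have h2 := integral_div_smul_schwartz (fun k => pd k u) hp hgi hl (schwartzPd i θ)
  change ∫ x, lap u x • schwartzPd i θ x = _ at h2
  simp only [Finset.smul_sum]
  rw [integral_finsetSum _ fun k _ => hint _ _, h2, neg_neg]
  refine Finset.sum_congr rfl fun j _ => ?_
  rw [h1]
  simp only [schwartzPd_comm i j]

theorem integral_lap_smul_fourierInv {u : E3 → ℝ} (hu : IsSolution u) (h h₂ : 𝓢(E3, ℂ))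
    (hh : ∀ ξ, h₂ ξ = (2 * π * ‖ξ‖ : ℝ) • h ξ) :
    ∫ x, lap u x • (𝓕⁻ h₂) x = -(2 : ℝ) • ∫ x, exp (3 * u x) • (𝓕⁻ h) x := by
  obtain ⟨hsm, ⟨-, hl⟩, hf, hw⟩ := hu
  have hlc : Continuous (lap u) := by
    have : ∀ i, Continuous (pd i (pd i u)) := fun i =>
      (contDiff_pd (n := ⊤) (m := 0) (contDiff_pd (n := ⊤) (m := ⊤) hsm i le_top) i
        le_top).continuous
    exact continuous_finsetSum _ fun i _ => this i
  have hfi : ∀ θ : 𝓢(E3, ℂ), Integrable fun x => exp (3 * u x) • θ x := fun θ => by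
    obtain ⟨M, hM⟩ := θ.exists_norm_le
    exact hf.smul_bdd M θ.continuous.aestronglyMeasurable (.of_forall hM)
  have hre : ∀ h h₂ : 𝓢(E3, ℂ), (∀ ξ, h₂ ξ = (2 * π * ‖ξ‖ : ℝ) • h ξ) →
      (∫ x, lap u x • (𝓕⁻ h₂) x).re = -2 * (∫ x, exp (3 * u x) • (𝓕⁻ h) x).re := by
    intro h h₂ hh
    have h1 := hw ((𝓕⁻ h).postcompCLM Complex.reCLM)
    simp only [halfLap_eq_re_fourierInv ((𝓕⁻ h).postcompCLM Complex.reCLM) h h₂ hh fun x => by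
      rw [SchwartzMap.postcompCLM_apply, Complex.reCLM_apply], SchwartzMap.postcompCLM_apply,
      Complex.reCLM_apply] at h1
    have e1 := integral_re (𝕜 := ℂ) (integrable_smul_schwartz hlc hl (𝓕⁻ h₂))
    have e2 := integral_re (𝕜 := ℂ) (hfi (𝓕⁻ h))
    simp only [RCLike.re_to_complex, Complex.smul_re, smul_eq_mul] at e1 e2
    rw [← e1, ← e2, neg_mul, ← h1, ← integral_neg]
    simp
  apply Complex.ext
  · rw [hre h h₂ hh, Complex.smul_re, smul_eq_mul]
  · have h1 := hre (-Complex.I • h) (-Complex.I • h₂) fun ξ => by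
      rw [smul_apply, smul_apply, hh, smul_comm]
    have e : ∀ k : 𝓢(E3, ℂ), 𝓕⁻ (-Complex.I • k) = -Complex.I • 𝓕⁻ k := fun k =>
      map_smul (FourierTransform.fourierCLE ℂ 𝓢(E3, ℂ)).symm _ _
    have e' : ∀ (w : E3 → ℝ) (k : 𝓢(E3, ℂ)), ∫ x, w x • (-Complex.I • 𝓕⁻ k) x =
        -Complex.I • ∫ x, w x • (𝓕⁻ k) x := by
      intro w k
      rw [← integral_smul]
      congr 1 with x
      rw [smul_apply, smul_comm]
    rw [e, e, e', e'] at h1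
    simpa using h1

theorem integral_pd_smul_fourierInv {u : E3 → ℝ} (hu : IsSolution u)
    (hgi : ∀ i, Integrable fun x => |pd i u x| / (1 + ‖x‖ ^ 4)) (i : Fin 3) {g : 𝓢(E3, ℂ)}
    (hg : HasCompactSupport g) (h0 : (0 : E3) ∉ tsupport g) :
    ∫ x, pd i u x • (𝓕⁻ g) x =
      ∫ x, (-(1 / π ^ 2) * potential i (fun y => exp (3 * u y)) x) • (𝓕⁻ g) x := by
  have hpi : (π : ℂ) ≠ 0 := by exact_mod_cast pi_ne_zero
  have hn : ∀ x : E3, x ≠ 0 → ((‖x‖ : ℝ) : ℂ) ≠ 0 := fun x hx => by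
    exact_mod_cast (norm_pos_iff.mpr hx).ne'
  have hm : ∀ (n : ℕ) (x : E3), x ≠ 0 →
      ContDiffAt ℝ (⊤ : ℕ∞) (fun ξ : E3 => (4 * (π : ℂ) ^ 2 * (‖ξ‖ : ℝ) ^ n)⁻¹) x := fun n x hx =>
    (contDiffAt_const.mul ((contDiffAt_norm_ofReal hx).pow n)).inv
      (mul_ne_zero (by simp) (pow_ne_zero n (hn x hx)))
  have hsm2 : ContDiff ℝ 2 u := contDiff_infty.mp hu.1 2
  obtain ⟨k, hk⟩ := exists_schwartzMap_eq_mul hg h0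
    (m := fun ξ => (4 * (π : ℂ) ^ 2 * (‖ξ‖ : ℝ) ^ 2)⁻¹) (hm 2)
  have hk1 : ∀ j : Fin 3, ∃ G : 𝓢(E3, ℂ), ∀ ξ, G ξ = (2 * π * Complex.I * (ξ j : ℝ)) * k ξ := by
    intro j
    obtain ⟨G, hG⟩ := exists_schwartzMap_eq_mul hg h0
      (m := fun ξ => (2 * π * Complex.I * (ξ j : ℝ)) * (4 * (π : ℂ) ^ 2 * (‖ξ‖ : ℝ) ^ 2)⁻¹)
      fun x hx => (contDiffAt_const.mul (contDiff_apply_ofReal j).contDiffAt).mul (hm 2 x hx)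
    exact ⟨G, fun ξ => by rw [hG, hk, mul_assoc]⟩
  choose k₁ hk₁ using hk1
  have hk2 : ∀ j : Fin 3, ∃ G : 𝓢(E3, ℂ), ∀ ξ, G ξ = (2 * π * Complex.I * (ξ j : ℝ)) * k₁ j ξ := by
    intro j
    obtain ⟨G, hG⟩ := exists_schwartzMap_eq_mul hg h0
      (m := fun ξ => (2 * π * Complex.I * (ξ j : ℝ)) *
        ((2 * π * Complex.I * (ξ j : ℝ)) * (4 * (π : ℂ) ^ 2 * (‖ξ‖ : ℝ) ^ 2)⁻¹))
      fun x hx => (contDiffAt_const.mul (contDiff_apply_ofReal j).contDiffAt).mul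
        ((contDiffAt_const.mul (contDiff_apply_ofReal j).contDiffAt).mul (hm 2 x hx))
    exact ⟨G, fun ξ => by rw [hG, hk₁, hk]; ring⟩
  choose k₂ hk₂ using hk2
  obtain ⟨h, hh⟩ := exists_schwartzMap_eq_mul hg h0
    (m := fun ξ => Complex.I * (ξ i : ℝ) * (4 * (π : ℂ) ^ 2 * (‖ξ‖ : ℝ) ^ 3)⁻¹) fun x hx =>
      (contDiffAt_const.mul (contDiff_apply_ofReal i).contDiffAt).mul (hm 3 x hx)
  have hg0 : g 0 = 0 := image_eq_zero_of_notMem_tsupport h0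
  have hh2 : ∀ ξ, k₁ i ξ = (2 * π * ‖ξ‖ : ℝ) • h ξ := by
    intro ξ
    rw [hk₁, hk, hh, Complex.real_smul]
    rcases eq_or_ne ξ 0 with rfl | hξ
    · simp
    have := hn ξ hξ
    push_cast
    field_simp
  have hlapl : ∀ x, ∑ j, schwartzPd j (schwartzPd j (𝓕⁻ k)) x = -(𝓕⁻ g) x := by
    intro x
    have e : ∀ j, schwartzPd j (schwartzPd j (𝓕⁻ k)) x = (𝓕⁻ (k₂ j)) x := fun j => by
      rw [schwartzPd_fourierInv j k (k₁ j) (hk₁ j), schwartzPd_fourierInv j (k₁ j) (k₂ j) (hk₂ j)]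
    simp only [e, fourierInv_apply_eq_integral]
    rw [← integral_finsetSum _ fun j _ => integrable_character_smul _ _, ← integral_neg]
    congr 1 with ξ
    rw [← Finset.smul_sum, ← smul_neg]
    congr 1
    simp only [hk₂, hk₁, hk]
    rcases eq_or_ne ξ 0 with rfl | hξ
    · simp [hg0]
    have hξ' := hn ξ hξ
    have hs : ((‖ξ‖ : ℝ) : ℂ) ^ 2 = ((ξ 0 : ℝ) : ℂ) ^ 2 + ((ξ 1 : ℝ) : ℂ) ^ 2 + ((ξ 2 : ℝ) : ℂ) ^ 2 := by
      have := EuclideanSpace.real_norm_sq_eq ξ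
      rw [Fin.sum_univ_three] at this
      exact_mod_cast this
    rw [Fin.sum_univ_three]
    field_simp
    rw [Complex.I_sq, hs]
    ring
  have hpot : ∀ y, potential i (⇑(𝓕⁻ g : 𝓢(E3, ℂ))) y = -(2 * π ^ 2 : ℝ) • (𝓕⁻ h) y := by
    intro y
    rw [potential_fourierInv_eq g ((2 * π ^ 2 : ℝ) • h) i ?_ y]
    · have : 𝓕⁻ ((2 * π ^ 2 : ℝ) • h) = (2 * π ^ 2 : ℝ) • 𝓕⁻ h :=
        map_smul ((FourierTransform.fourierCLE ℂ 𝓢(E3, ℂ)).symm.restrictScalars ℝ) _ _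
      rw [this, smul_apply, neg_smul]
    · intro ξ
      rw [smul_apply, hh]
      simp only [Complex.real_smul]
      rcases eq_or_ne ξ 0 with rfl | hξ
      · simp
      have := hn ξ hξ
      push_cast
      field_simp
      ring
  have h1 := integral_pd_smul_laplacian hsm2 hgi hu.2.1.2 (𝓕⁻ k) i
  rw [schwartzPd_fourierInv i k (k₁ i) (hk₁ i), integral_lap_smul_fourierInv hu h (k₁ i) hh2] at h1
  simp only [hlapl, smul_neg] at h1
  rw [integral_neg, neg_inj] at h1
  obtain ⟨M, hM⟩ := (𝓕⁻ g).exists_norm_le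
  have h2 := integral_potential_smul i hu.2.2.1 ((𝓕⁻ g).integrable (μ := volume)) hM
  simp only [hpot] at h2
  simp only [mul_smul]
  rw [integral_smul, h2, h1, ← integral_smul, ← integral_smul]
  congr 1 with x
  simp only [Complex.real_smul]
  push_cast
  field_simp

theorem exists_pd_eq_potential_add {u : E3 → ℝ} (hu : IsSolution u)
    (hgi : ∀ i, Integrable fun x => |pd i u x| / (1 + ‖x‖ ^ 4)) (i : Fin 3) :
    ∃ a : ℝ, ∀ x, pd i u x = -(1 / π ^ 2) * potential i (fun y => exp (3 * u y)) x + a := by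
  have hf := hu.2.2.1
  have hfc : Continuous fun x => exp (3 * u x) := by
    have := hu.1.continuous
    fun_prop
  have hpc := continuous_potential i hf hfc
  have hpdc : Continuous (pd i u) :=
    (contDiff_pd (n := ⊤) (m := 0) hu.1 i le_top).continuous
  have hpi : Integrable fun x =>
      |-(1 / π ^ 2) * potential i (fun y => exp (3 * u y)) x| / (1 + ‖x‖ ^ 4) := by
    have := (integrable_potential_smul i hf integrable_weight (M := 1) fun x => by
      have := pow_nonneg (norm_nonneg x) 4
      rw [Real.norm_of_nonneg (by positivity), div_le_one (by linarith)]
      linarith).norm.const_mul (1 / π ^ 2)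
    refine this.congr (.of_forall fun x => ?_)
    simp only [smul_eq_mul, norm_mul, norm_div, Real.norm_eq_abs, abs_mul, abs_neg]
    rw [abs_of_pos (weight_pos x), abs_of_pos (show 0 < 1 / π ^ 2 by positivity)]
    simp
    ring
  obtain ⟨a, ha⟩ := exists_const_of_integral_fourierInv_eq_zero
    (fun x => pd i u x - -(1 / π ^ 2) * potential i (fun y => exp (3 * u y)) x)
    (hpdc.sub (continuous_const.mul hpc)) (by
      refine ((hgi i).add hpi).mono' ((hpdc.sub (continuous_const.mul hpc)).abs.div
        continuous_weight (fun x => (weight_pos x).ne')).aestronglyMeasurable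
        (.of_forall fun x => ?_)
      have := weight_pos x
      simp only [Pi.add_apply]
      rw [← add_div, Real.norm_of_nonneg (by positivity)]
      exact div_le_div_of_nonneg_right (abs_sub _ _) this.le) (fun g hg h0 => by
      simp only [sub_smul]
      rw [integral_sub (integrable_smul_schwartz hpdc (hgi i) _)
        (by exact integrable_smul_schwartz (continuous_const.mul hpc) hpi _),
        integral_pd_smul_fourierInv hu hgi i hg h0, sub_self])
  exact ⟨a, fun x => by linarith [ha x]⟩

theorem norm_gradient_sq (u : E3 → ℝ) (x : E3) : ‖gradient u x‖ ^ 2 = ∑ i, pd i u x ^ 2 := by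
  rw [EuclideanSpace.norm_sq_eq]
  refine Finset.sum_congr rfl fun i _ => ?_
  rw [Real.norm_eq_abs, sq_abs, ← inner_single_one_right]
  simp only [gradient, InnerProductSpace.toDual_symm_apply, pd]

theorem continuous_pd {u : E3 → ℝ} (hu : ContDiff ℝ (⊤ : ℕ∞) u) (i : Fin 3) :
    Continuous (pd i u) :=
  (contDiff_pd (n := ⊤) (m := 0) hu i le_top).continuous

theorem lap_eq_sum_pd (u : E3 → ℝ) : lap u = fun x => ∑ i, pd i (pd i u) x := rfl

theorem continuous_lap {u : E3 → ℝ} (hu : ContDiff ℝ (⊤ : ℕ∞) u) : Continuous (lap u) := by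
  rw [lap_eq_sum_pd]
  exact continuous_finsetSum _ fun i _ =>
    continuous_pd (contDiff_pd (n := ⊤) (m := ⊤) hu i le_top) i

theorem exists_le_of_bot_lt_liminf {u : E3 → ℝ} (hu : ContDiff ℝ (⊤ : ℕ∞) u)
    (h : (⊥ : EReal) < Filter.liminf
        (fun x : E3 =>
          ((-2 * Real.exp (-2 * u x) * (2 * lap u x + ‖gradient u x‖ ^ 2) : ℝ) : EReal))
        (Filter.comap (fun x : E3 => ‖x‖) Filter.atTop)) :
    ∃ C, 0 ≤ C ∧ ∀ x, 2 * lap u x + ∑ i, pd i u x ^ 2 ≤ C * exp (2 * u x) := by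
  obtain ⟨r, -, hr⟩ := EReal.lt_iff_exists_real_btwn.mp h
  have hev := eventually_lt_of_lt_liminf hr
  rw [eventually_comap] at hev
  obtain ⟨ρ, hρ⟩ := eventually_atTop.mp hev
  have huc := hu.continuous
  have hpc := continuous_pd hu
  have hlc := continuous_lap hu
  have hc : Continuous fun x => (2 * lap u x + ∑ i, pd i u x ^ 2) * exp (-(2 * u x)) := by
    fun_prop
  obtain ⟨B, hB⟩ := (isCompact_closedBall (0 : E3) ρ).bddAbove_image hc.continuousOn
  refine ⟨max 0 (max B (-r / 2)), le_max_left _ _, fun x => ?_⟩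
  have key : (2 * lap u x + ∑ i, pd i u x ^ 2) * exp (-(2 * u x)) ≤ max B (-r / 2) := by
    rcases le_total ρ ‖x‖ with hx | hx
    · have h1 := EReal.coe_lt_coe_iff.mp (hρ _ hx x rfl)
      rw [norm_gradient_sq, show -2 * u x = -(2 * u x) by ring] at h1
      exact le_max_of_le_right (by linarith)
    · exact le_max_of_le_left (hB ⟨x, by simpa using hx, rfl⟩)
  rw [exp_neg, ← div_eq_mul_inv, div_le_iff₀ (exp_pos _)] at key
  exact key.trans (mul_le_mul_of_nonneg_right (le_max_right _ _) (exp_pos _).le)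

theorem exp_two_mul_le (t : ℝ) {m : ℝ} (hm : 0 < m) :
    exp (2 * t) ≤ 2 / 3 * m * exp (3 * t) + 1 / 3 * (m ^ 2)⁻¹ := by
  have h2 : exp (2 * t) = exp t ^ 2 := by rw [← exp_nat_mul]; norm_num
  have h3 : exp (3 * t) = exp t ^ 3 := by rw [← exp_nat_mul]; norm_num
  rw [h2, h3]
  have hs := exp_pos t
  set s := exp t
  have : 0 ≤ (m * s - 1) ^ 2 * (2 * m * s + 1) := by positivity
  have e : 2 / 3 * m * s ^ 3 + 1 / 3 * (m ^ 2)⁻¹ - s ^ 2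
      = (m ^ 2)⁻¹ * ((m * s - 1) ^ 2 * (2 * m * s + 1)) / 3 := by
    field_simp
    ring
  have : 0 ≤ (m ^ 2)⁻¹ * ((m * s - 1) ^ 2 * (2 * m * s + 1)) / 3 := by positivity
  linarith

theorem integrable_exp_two_mul_weight {u : E3 → ℝ} (hu : Continuous u)
    (hi : Integrable fun x => exp (3 * u x)) :
    Integrable fun x => |exp (2 * u x)| / (1 + ‖x‖ ^ 4) := by
  refine (hi.add integrable_weight).mono' (Continuous.aestronglyMeasurable
    ((by fun_prop : Continuous fun x => |exp (2 * u x)|).div continuous_weight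
      fun x => (weight_pos x).ne')) (.of_forall fun x => ?_)
  have hw := weight_pos x
  have h1 : 1 ≤ 1 + ‖x‖ ^ 4 := by simp
  have h2 := exp_two_mul_le (u x) one_pos
  have h3 := exp_pos (3 * u x)
  rw [abs_of_pos (exp_pos _), Real.norm_of_nonneg (by positivity)]
  calc exp (2 * u x) / (1 + ‖x‖ ^ 4)
      ≤ (exp (3 * u x) + 1) / (1 + ‖x‖ ^ 4) := by
        gcongr
        norm_num at h2
        linarith
    _ = exp (3 * u x) / (1 + ‖x‖ ^ 4) + 1 / (1 + ‖x‖ ^ 4) := by ring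
    _ ≤ _ := by
        simp only [Pi.add_apply]
        gcongr
        exact div_le_self h3.le h1

theorem integrable_sq_pd_weight {u : E3 → ℝ} (hu : IsSolution u) {C : ℝ}
    (h : ∀ x, 2 * lap u x + ∑ i, pd i u x ^ 2 ≤ C * exp (2 * u x)) :
    Integrable fun x => |∑ i, pd i u x ^ 2| / (1 + ‖x‖ ^ 4) := by
  have hpc := continuous_pd hu.1
  refine (((integrable_exp_two_mul_weight hu.1.continuous hu.2.2.1).const_mul C).add
    (hu.2.1.2.const_mul 2)).mono' (Continuous.aestronglyMeasurable
    ((by fun_prop : Continuous fun x => |∑ i, pd i u x ^ 2|).div continuous_weight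
      fun x => (weight_pos x).ne')) (.of_forall fun x => ?_)
  have hw := weight_pos x
  have h0 : 0 ≤ ∑ i, pd i u x ^ 2 := Finset.sum_nonneg fun i _ => sq_nonneg _
  rw [abs_of_nonneg h0, Real.norm_of_nonneg (by positivity)]
  simp only [Pi.add_apply]
  rw [mul_div_assoc', mul_div_assoc', ← add_div, abs_of_pos (exp_pos _)]
  gcongr
  linarith [h x, neg_abs_le (lap u x)]

theorem integrable_pd_weight {u : E3 → ℝ} (hu : IsSolution u) {C : ℝ}
    (h : ∀ x, 2 * lap u x + ∑ i, pd i u x ^ 2 ≤ C * exp (2 * u x)) (i : Fin 3) :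
    Integrable fun x => |pd i u x| / (1 + ‖x‖ ^ 4) := by
  have hpc := continuous_pd hu.1
  refine (integrable_weight.add (integrable_sq_pd_weight hu h)).mono'
    (Continuous.aestronglyMeasurable
    ((by fun_prop : Continuous fun x => |pd i u x|).div continuous_weight
      fun x => (weight_pos x).ne')) (.of_forall fun x => ?_)
  have hw := weight_pos x
  have h0 : pd i u x ^ 2 ≤ ∑ i, pd i u x ^ 2 :=
    Finset.single_le_sum (f := fun i => pd i u x ^ 2) (fun i _ => sq_nonneg _) (Finset.mem_univ i)
  rw [Real.norm_of_nonneg (by positivity)]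
  simp only [Pi.add_apply]
  rw [← add_div]
  gcongr
  nlinarith [le_abs_self (∑ i, pd i u x ^ 2), sq_abs (pd i u x), sq_nonneg (|pd i u x| - 1)]

/-- The integral of the pointwise inequality `2 Δu + |∇u|² ≤ C e^{2u}` against `χ ≥ 0`, where
`|∇u|² χ` has been bounded from below by an affine function of `∇u`. -/
theorem testing_inequality {u : E3 → ℝ} (hu : IsSolution u) {C : ℝ}
    (h : ∀ x, 2 * lap u x + ∑ i, pd i u x ^ 2 ≤ C * exp (2 * u x))
    (χ ω : 𝓢(E3, ℝ)) (ψ : Fin 3 → 𝓢(E3, ℝ)) (hχ : ∀ x, 0 ≤ χ x)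
    (hψ : ∀ (x : E3) (p : Fin 3 → ℝ),
      2 * ∑ k, p k * ψ k x - ω x ≤ (∑ k, p k ^ 2) * χ x) :
    (-2 * ∑ k, ∫ x, pd k u x * schwartzPd k χ x) + (2 * ∑ k, ∫ x, pd k u x * ψ k x) - ∫ x, ω x
      ≤ C * ∫ x, exp (2 * u x) * χ x := by
  have huc := hu.1.continuous
  have hpi := integrable_pd_weight hu h
  have hpc := continuous_pd hu.1
  have hlap : ∫ x, lap u x * χ x = -∑ k, ∫ x, pd k u x * schwartzPd k χ x :=
    integral_div_smul_schwartz (fun k => pd k u)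
      (fun k => (contDiff_pd (n := ⊤) (m := 1) hu.1 k le_top)) hpi hu.2.1.2 χ
  have hli : Integrable fun x => lap u x * χ x :=
    integrable_smul_schwartz (continuous_lap hu.1) hu.2.1.2 χ
  have hei : Integrable fun x => exp (2 * u x) * χ x :=
    integrable_smul_schwartz (by fun_prop) (integrable_exp_two_mul_weight huc hu.2.2.1) χ
  have hψi : ∀ k, Integrable fun x => pd k u x * ψ k x := fun k =>
    integrable_smul_schwartz (hpc k) (hpi k) (ψ k)
  have hsum : ∑ k, ∫ x, pd k u x * ψ k x = ∫ x, ∑ k, pd k u x * ψ k x :=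
    (integral_finsetSum _ fun k _ => hψi k).symm
  have hsumi : Integrable fun x => ∑ k, pd k u x * ψ k x := integrable_finsetSum _ fun k _ => hψi k
  have hmono : ∫ x, (2 * (lap u x * χ x) + 2 * ∑ k, pd k u x * ψ k x - ω x)
      ≤ ∫ x, C * (exp (2 * u x) * χ x) := by
    refine integral_mono (((hli.const_mul 2).add (hsumi.const_mul 2)).sub ω.integrable)
      (hei.const_mul C) fun x => ?_
    have h1 := hψ x fun k => pd k u x
    have h2 := mul_le_mul_of_nonneg_right (h x) (hχ x)
    simp only
    linarith
  rw [integral_sub (by exact (hli.const_mul 2).add (hsumi.const_mul 2)) ω.integrable,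
    integral_add (hli.const_mul 2) (hsumi.const_mul 2), integral_const_mul, integral_const_mul,
    integral_const_mul, ← hsum, hlap] at hmono
  linarith

/-- The dilation `θ (x / (n + 1))` of a Schwartz function. -/
noncomputable def dilate (n : ℕ) (θ : 𝓢(E3, ℝ)) : 𝓢(E3, ℝ) :=
  SchwartzMap.compCLMOfContinuousLinearEquiv ℝ
    (ContinuousLinearEquiv.smulLeft (Units.mk0 ((n : ℝ) + 1)⁻¹ (by positivity))) θ

theorem dilate_apply (n : ℕ) (θ : 𝓢(E3, ℝ)) (x : E3) :
    dilate n θ x = θ (((n : ℝ) + 1)⁻¹ • x) := rfl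

theorem schwartzPd_dilate (n : ℕ) (θ : 𝓢(E3, ℝ)) (i : Fin 3) (x : E3) :
    schwartzPd i (dilate n θ) x = ((n : ℝ) + 1)⁻¹ * dilate n (schwartzPd i θ) x := by
  have h : HasFDerivAt (fun x : E3 => ((n : ℝ) + 1)⁻¹ • x)
      (((n : ℝ) + 1)⁻¹ • ContinuousLinearMap.id ℝ E3) x := (hasFDerivAt_id x).fun_const_smul _
  have h2 := (θ.differentiable (x := ((n : ℝ) + 1)⁻¹ • x)).hasFDerivAt.comp x h
  have : ⇑(dilate n θ) = θ ∘ fun x : E3 => ((n : ℝ) + 1)⁻¹ • x := rfl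
  rw [schwartzPd_apply, this, h2.fderiv, dilate_apply, schwartzPd_apply]
  simp

theorem integral_comp_dilation (n : ℕ) {F : Type*} [NormedAddCommGroup F] [NormedSpace ℝ F]
    (g : E3 → F) : ∫ x, g (((n : ℝ) + 1)⁻¹ • x) = ((n : ℝ) + 1) ^ 3 • ∫ x, g x := by
  rw [Measure.integral_comp_inv_smul_of_nonneg volume g (by positivity)]
  simp

theorem gradLog_smul (i : Fin 3) (c : ℝ) (z : E3) : gradLog i (c • z) = c⁻¹ * gradLog i z := by
  rcases eq_or_ne c 0 with rfl | hc
  · simp [gradLog]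
  · simp only [gradLog, norm_smul, PiLp.smul_apply, smul_eq_mul, mul_pow, Real.norm_eq_abs, sq_abs]
    rcases eq_or_ne z 0 with rfl | hz
    · simp
    · have := norm_ne_zero_iff.mpr hz
      field_simp

theorem potential_dilate (n : ℕ) (θ : 𝓢(E3, ℝ)) (i : Fin 3) (y : E3) :
    potential i (dilate n θ) y = ((n : ℝ) + 1) ^ 2 * potential i θ (((n : ℝ) + 1)⁻¹ • y) := by
  have hn : (n : ℝ) + 1 ≠ 0 := by positivity
  have h := integral_comp_dilation n fun x => gradLog i (((n : ℝ) + 1)⁻¹ • y - x) • θ x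
  simp only [← smul_sub, gradLog_smul, inv_inv, smul_eq_mul, mul_assoc] at h
  rw [integral_const_mul] at h
  simp only [potential, smul_eq_mul, dilate_apply]
  field_simp
  field_simp at h
  rw [h]

theorem tendsto_integral_mul_comp_dilation {f g : E3 → ℝ} (hf : Integrable f) (hg : Continuous g)
    {M : ℝ} (hM : ∀ x, ‖g x‖ ≤ M) :
    Tendsto (fun n : ℕ => ∫ x, f x * g (((n : ℝ) + 1)⁻¹ • x)) atTop
      (nhds ((∫ x, f x) * g 0)) := by
  rw [← integral_mul_const]
  refine tendsto_integral_of_dominated_convergence (fun x => ‖f x‖ * M) (fun n => ?_)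
    (hf.norm.mul_const M) (fun n => .of_forall fun x => ?_) (.of_forall fun x => ?_)
  · exact hf.1.mul (by fun_prop : Continuous fun x => g (((n : ℝ) + 1)⁻¹ • x)).aestronglyMeasurable
  · rw [norm_mul]
    gcongr
    exact hM _
  · refine tendsto_const_nhds.mul ((hg.tendsto 0).comp ?_)
    have h0 : Tendsto (fun n : ℕ => ((n : ℝ) + 1)⁻¹) atTop (nhds 0) := by
      simpa [one_div] using tendsto_one_div_add_atTop_nhds_zero_nat (𝕜 := ℝ)
    simpa using h0.smul_const x

theorem tendsto_integral_pd_mul_dilate {u : E3 → ℝ} (hu : IsSolution u) {i : Fin 3} {a : ℝ}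
    (ha : ∀ x, pd i u x =
      -(1 / π ^ 2) * potential i (fun y => exp (3 * u y)) x + a) (θ : 𝓢(E3, ℝ)) :
    Tendsto (fun n : ℕ => (((n : ℝ) + 1) ^ 2)⁻¹ *
        ((∫ x, pd i u x * dilate n θ x) - ((n : ℝ) + 1) ^ 3 * (a * ∫ x, θ x))) atTop
      (nhds (solAlpha u * potential i θ 0)) := by
  obtain ⟨M, hM⟩ := θ.exists_norm_le
  have hf := hu.2.2.1
  have hpb : ∀ x, ‖potential i θ x‖ ≤ M * (nearConst * 1 ^ 2) + 1⁻¹ * ∫ x, ‖θ x‖ := fun x =>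
    norm_potential_le i θ.integrable one_pos fun y _ => hM y
  have ht := (tendsto_integral_mul_comp_dilation hf
    (continuous_potential i θ.integrable θ.continuous) hpb).const_mul (1 / π ^ 2)
  rw [← mul_assoc] at ht
  refine ht.congr fun n => ?_
  have hn : (n : ℝ) + 1 ≠ 0 := by positivity
  obtain ⟨M', hM'⟩ := (dilate n θ).exists_norm_le
  have h1 := integral_potential_smul i hf (dilate n θ).integrable hM'
  have h1i : Integrable fun x => potential i (fun y => exp (3 * u y)) x * dilate n θ x :=
    integrable_potential_smul i hf (dilate n θ).integrable hM'
  have h2 : ∫ x, pd i u x * dilate n θ x = -(1 / π ^ 2) *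
      (∫ x, potential i (fun y => exp (3 * u y)) x * dilate n θ x) + a * ∫ x, dilate n θ x := by
    rw [← integral_const_mul, ← integral_const_mul, ← integral_add (h1i.const_mul _)
      ((dilate n θ).integrable.const_mul _)]
    congr 1 with x
    rw [ha]
    ring
  have h3 : ∫ x, dilate n θ x = ((n : ℝ) + 1) ^ 3 * ∫ x, θ x := integral_comp_dilation n θ
  simp only [smul_eq_mul, potential_dilate] at h1
  rw [h2, h3, h1]
  have h4 : ∫ y, exp (3 * u y) * -(((n : ℝ) + 1) ^ 2 * potential i θ (((n : ℝ) + 1)⁻¹ • y)) =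
      -(((n : ℝ) + 1) ^ 2) * ∫ y, exp (3 * u y) * potential i θ (((n : ℝ) + 1)⁻¹ • y) := by
    rw [← integral_const_mul]
    congr 1 with y
    ring
  rw [h4]
  field_simp
  ring

theorem tendsto_integral_exp_two_mul_dilate {u : E3 → ℝ} (hu : IsSolution u)
    (χ : 𝓢(E3, ℝ)) (hχ : ∀ x, 0 ≤ χ x) (h0 : χ 0 = 0) :
    Tendsto (fun n : ℕ => ((n : ℝ) + 1)⁻¹ * ∫ x, exp (2 * u x) * dilate n χ x) atTop (nhds 0) := by
  obtain ⟨K, hK⟩ := χ.exists_norm_le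
  have huc := hu.1.continuous
  have hf := hu.2.2.1
  have ht := tendsto_integral_mul_comp_dilation hf χ.continuous hK
  rw [h0, mul_zero] at ht
  have hb : ∀ (m : ℝ), 0 < m → ∀ n : ℕ, ((n : ℝ) + 1)⁻¹ * ∫ x, exp (2 * u x) * dilate n χ x ≤
      2 / 3 * m * (∫ x, exp (3 * u x) * χ (((n : ℝ) + 1)⁻¹ • x)) +
        1 / 3 * (m ^ 2)⁻¹ * ∫ x, χ x := by
    intro m hm n
    have hn : 0 < (n : ℝ) + 1 := by positivity
    obtain ⟨K', hK'⟩ := (dilate n χ).exists_norm_le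
    have h3 : ∫ x, dilate n χ x = ((n : ℝ) + 1) ^ 3 * ∫ x, χ x := integral_comp_dilation n χ
    have hi1 : Integrable fun x => exp (2 * u x) * dilate n χ x :=
      integrable_smul_schwartz (by fun_prop) (integrable_exp_two_mul_weight huc hf) _
    have hi2 : Integrable fun x => exp (3 * u x) * dilate n χ x :=
      hf.mul_bdd (c := K') (dilate n χ).continuous.aestronglyMeasurable (.of_forall hK')
    have : ∫ x, exp (2 * u x) * dilate n χ x ≤ ∫ x, (2 / 3 * (m * ((n : ℝ) + 1)) *
        (exp (3 * u x) * dilate n χ x) + 1 / 3 * ((m * ((n : ℝ) + 1)) ^ 2)⁻¹ * dilate n χ x) := by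
      refine integral_mono hi1 ((hi2.const_mul _).add ((dilate n χ).integrable.const_mul _))
        fun x => ?_
      have := mul_le_mul_of_nonneg_right (exp_two_mul_le (u x) (mul_pos hm hn))
        (hχ (((n : ℝ) + 1)⁻¹ • x))
      simp only [dilate_apply]
      linarith
    rw [integral_add (hi2.const_mul _) ((dilate n χ).integrable.const_mul _), integral_const_mul,
      integral_const_mul, h3] at this
    rw [inv_mul_le_iff₀ hn]
    refine this.trans (le_of_eq ?_)
    simp only [dilate_apply]
    field_simp
  have hnn : ∀ n : ℕ, 0 ≤ ((n : ℝ) + 1)⁻¹ * ∫ x, exp (2 * u x) * dilate n χ x := fun n =>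
    mul_nonneg (by positivity) (integral_nonneg fun x => mul_nonneg (exp_pos _).le (hχ _))
  have hI : 0 ≤ ∫ x, χ x := integral_nonneg hχ
  rw [Metric.tendsto_atTop]
  intro ε hε
  obtain ⟨m, hm, hmε⟩ : ∃ m : ℝ, 0 < m ∧ 1 / 3 * (m ^ 2)⁻¹ * ∫ x, χ x < ε / 2 := by
    have : Tendsto (fun m : ℝ => 1 / 3 * (m ^ 2)⁻¹ * ∫ x, χ x) atTop (nhds (1 / 3 * 0 * ∫ x, χ x)) :=
      ((tendsto_inv_atTop_zero.comp (tendsto_pow_atTop two_ne_zero)).const_mul _).mul_const _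
    rw [mul_zero, zero_mul] at this
    exact ((eventually_gt_atTop 0).and (this.eventually_lt_const (half_pos hε))).exists
  have ht2 := ht.const_mul (2 / 3 * m)
  rw [mul_zero] at ht2
  obtain ⟨N, hN⟩ := eventually_atTop.mp (ht2.eventually_lt_const (half_pos hε))
  refine ⟨N, fun n hn => ?_⟩
  rw [Real.dist_eq, sub_zero, abs_of_nonneg (hnn n)]
  linarith [hb m hm n, hN n hn]

/-- A smooth bump function around the origin. -/
noncomputable def unitBump : ContDiffBump (0 : E3) := ⟨1, 2, one_pos, one_lt_two⟩

/-- The Schwartz function `m · unitBump`. -/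
noncomputable def bumpMul (m : E3 → ℝ) (hm : ContDiff ℝ (⊤ : ℕ∞) m) : 𝓢(E3, ℝ) :=
  HasCompactSupport.toSchwartzMap (f := fun x => m x * unitBump x)
    (unitBump.hasCompactSupport.mul_left) (hm.mul unitBump.contDiff)

theorem schwartzPd_bumpMul (m : E3 → ℝ) (hm : ContDiff ℝ (⊤ : ℕ∞) m) (i : Fin 3) (x : E3) :
    schwartzPd i (bumpMul m hm) x = pd i m x * unitBump x + m x * pd i unitBump x := by
  have h : ⇑(bumpMul m hm) = fun x => m x * unitBump x := rfl
  rw [schwartzPd_apply, h, fderiv_fun_mul (hm.differentiable (by simp) x)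
    (unitBump.contDiff (n := 1)).contDiffAt.differentiableAt_one]
  simp [pd]
  ring

theorem integral_schwartzPd (θ : 𝓢(E3, ℝ)) (i : Fin 3) : ∫ x, schwartzPd i θ x = 0 := by
  have h := integral_mul_fderiv_eq_neg_fderiv_mul_of_integrable (μ := volume)
    (f := fun _ : E3 => (1 : ℝ)) (g := θ) (v := EuclideanSpace.single i 1)
    (by simp) (((schwartzPd i θ).integrable (μ := volume)).congr
      (.of_forall fun x => (one_mul (schwartzPd i θ x)).symm))
    (by simpa using θ.integrable (μ := volume)) (fun x _ => differentiableAt_const _)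
    (fun x _ => θ.differentiableAt)
  simp only [one_mul, fderiv_fun_const, Pi.zero_apply, zero_apply, zero_mul, integral_zero,
    neg_zero] at h
  exact h

/-- The bump function as a Schwartz function. -/
noncomputable def bumpOne : 𝓢(E3, ℝ) := bumpMul (fun _ => 1) contDiff_const

theorem contDiff_coord (i : Fin 3) : ContDiff ℝ (⊤ : ℕ∞) fun x : E3 => x i :=
  (EuclideanSpace.proj (𝕜 := ℝ) i).contDiff

/-- The Schwartz function `x_i · unitBump`. -/
noncomputable def bumpCoord (i : Fin 3) : 𝓢(E3, ℝ) :=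
  bumpMul (fun x => x i) (contDiff_coord i)

/-- The Schwartz function `‖x‖² · unitBump`. -/
noncomputable def bumpNormSq : 𝓢(E3, ℝ) := bumpMul (fun x => ‖x‖ ^ 2) (contDiff_norm_sq ℝ)

theorem bumpOne_apply (x : E3) : bumpOne x = unitBump x := one_mul _

theorem bumpCoord_apply (i : Fin 3) (x : E3) : bumpCoord i x = x i * unitBump x := rfl

theorem bumpNormSq_apply (x : E3) : bumpNormSq x = ‖x‖ ^ 2 * unitBump x := rfl

theorem integral_bumpOne_pos : 0 < ∫ x, bumpOne x := by
  simp only [bumpOne_apply]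
  exact unitBump.integral_pos

theorem integral_bumpNormSq_pos : 0 < ∫ x, bumpNormSq x := by
  have hnn : ∀ x, 0 ≤ bumpNormSq x := fun x => mul_nonneg (sq_nonneg _) unitBump.nonneg
  refine (bumpNormSq.continuous.integral_pos_of_hasCompactSupport_nonneg_nonzero
    (unitBump.hasCompactSupport.mul_left) (fun x => hnn x) (x := EuclideanSpace.single 0 1) ?_)
  rw [bumpNormSq_apply, norm_single_one, unitBump.one_of_mem_closedBall (by
    simp [unitBump])]
  norm_num

theorem norm_sq_eq_sum (x : E3) : ‖x‖ ^ 2 = ∑ i, x i ^ 2 := by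
  simp [EuclideanSpace.norm_sq_eq]

theorem pd_coord (i : Fin 3) (x : E3) : pd i (fun x : E3 => x i) x = 1 := by
  have : HasFDerivAt (fun x : E3 => x i) (EuclideanSpace.proj (𝕜 := ℝ) i : E3 →L[ℝ] ℝ) x :=
    (EuclideanSpace.proj (𝕜 := ℝ) i : E3 →L[ℝ] ℝ).hasFDerivAt
  rw [pd, this.fderiv]
  simp

theorem potential_schwartz_zero (i : Fin 3) (θ : 𝓢(E3, ℝ)) :
    potential i θ 0 = -∫ y, gradLog i y * θ y := by
  rw [potential, ← integral_neg]
  simp only [zero_sub, gradLog_neg, smul_eq_mul, neg_mul]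

theorem integrable_gradLog_mul_schwartz (i : Fin 3) (θ : 𝓢(E3, ℝ)) :
    Integrable fun y => gradLog i y * θ y := by
  obtain ⟨M, hM⟩ := θ.exists_norm_le
  have := (integrable_gradLog_smul i (θ.integrable (μ := volume)) (x := 0) one_pos
    fun y _ => hM y).neg
  refine this.congr (.of_forall fun y => ?_)
  simp [gradLog_neg]

theorem sum_potential_bumpCoord_zero :
    ∑ k, potential k (bumpCoord k) 0 = -∫ x, bumpOne x := by
  simp only [potential_schwartz_zero]
  rw [Finset.sum_neg_distrib, ← integral_finsetSum _ fun k _ => integrable_gradLog_mul_schwartz k _]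
  congr 1
  refine integral_congr_ae ?_
  filter_upwards [Measure.ae_ne volume (0 : E3)] with x hx
  have hx' : ‖x‖ ≠ 0 := norm_ne_zero_iff.mpr hx
  simp only [gradLog, bumpCoord_apply, bumpOne_apply]
  have : ∀ k, x k / ‖x‖ ^ 2 * (x k * unitBump x) = x k ^ 2 * (unitBump x / ‖x‖ ^ 2) := fun k => by ring
  simp only [this]
  rw [← Finset.sum_mul, ← norm_sq_eq_sum]
  field_simp

theorem sum_potential_schwartzPd_bumpNormSq_zero :
    ∑ k, potential k (schwartzPd k bumpNormSq) 0 = ∫ x, bumpOne x := by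
  simp only [potential_schwartz_zero]
  rw [Finset.sum_neg_distrib, ← integral_finsetSum _ fun k _ => integrable_gradLog_mul_schwartz k _]
  have h1 : ∫ x, ∑ k, gradLog k x * schwartzPd k bumpNormSq x =
      ∫ x, (∑ k, schwartzPd k (bumpCoord k) x - bumpOne x) := by
    refine integral_congr_ae ?_
    filter_upwards [Measure.ae_ne volume (0 : E3)] with x hx
    have hx' : ‖x‖ ≠ 0 := norm_ne_zero_iff.mpr hx
    have e : ∀ k, gradLog k x * schwartzPd k bumpNormSq x =
        x k ^ 2 * (2 * unitBump x / ‖x‖ ^ 2) + x k * pd k unitBump x := by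
      intro k
      rw [bumpNormSq, schwartzPd_bumpMul, pd, fderiv_norm_sq_single, gradLog]
      field_simp
    have e' : ∀ k, schwartzPd k (bumpCoord k) x = unitBump x + x k * pd k unitBump x := by
      intro k
      rw [bumpCoord, schwartzPd_bumpMul, pd_coord, one_mul]
    simp only [e, e', Finset.sum_add_distrib, bumpOne_apply]
    rw [← Finset.sum_mul, ← norm_sq_eq_sum]
    simp
    field_simp
    ring
  rw [h1, integral_sub (integrable_finsetSum _ fun k _ => (schwartzPd k _).integrable)
    bumpOne.integrable, integral_finsetSum _ fun k _ => (schwartzPd k _).integrable]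
  simp [integral_schwartzPd]

theorem tendsto_inv_natCast_add_one : Tendsto (fun n : ℕ => ((n : ℝ) + 1)⁻¹) atTop (nhds 0) := by
  simpa [one_div] using tendsto_one_div_add_atTop_nhds_zero_nat (𝕜 := ℝ)

theorem constants_eq_zero {u : E3 → ℝ} (hu : IsSolution u) {C : ℝ}
    (h : ∀ x, 2 * lap u x + ∑ i, pd i u x ^ 2 ≤ C * exp (2 * u x))
    {a : Fin 3 → ℝ} (ha : ∀ i x, pd i u x =
    -(1 / π ^ 2) * potential i (fun y => exp (3 * u y)) x + a i) : a = 0 := by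
  set I : Fin 3 → 𝓢(E3, ℝ) → ℕ → ℝ := fun k θ n => ∫ x, pd k u x * dilate n θ x with hI
  set J : Fin 3 → 𝓢(E3, ℝ) → ℕ → ℝ := fun k θ n => (((n : ℝ) + 1) ^ 2)⁻¹ *
        (I k θ n - ((n : ℝ) + 1) ^ 3 * (a k * ∫ x, θ x)) with hJ
  have hJt : ∀ k θ, Tendsto (J k θ) atTop (nhds (solAlpha u * potential k θ 0)) :=
    fun k θ => tendsto_integral_pd_mul_dilate hu (ha k) θ
  have hinv := tendsto_inv_natCast_add_one
  have hE := tendsto_integral_exp_two_mul_dilate hu bumpNormSq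
    (fun x => mul_nonneg (sq_nonneg _) unitBump.nonneg) (by simp [bumpNormSq_apply])
  set s := ∑ k, a k ^ 2 with hs
  have hineq : ∀ n : ℕ, -2 * ∑ k, (((n : ℝ) + 1)⁻¹ ^ 2 * J k (schwartzPd k bumpNormSq) n) +
      2 * ∑ k, a k * (((n : ℝ) + 1)⁻¹ * J k bumpNormSq n) + s * ∫ x, bumpNormSq x ≤
      C * (((n : ℝ) + 1)⁻¹ ^ 2 *
        (((n : ℝ) + 1)⁻¹ * ∫ x, exp (2 * u x) * dilate n bumpNormSq x)) := by
    intro n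
    have hn : 0 < (n : ℝ) + 1 := by positivity
    have ht := testing_inequality hu h (dilate n bumpNormSq) (s • dilate n bumpNormSq)
      (fun k => a k • dilate n bumpNormSq)
      (fun x => mul_nonneg (sq_nonneg _) unitBump.nonneg) (fun x p => by
        have h0 : 0 ≤ dilate n bumpNormSq x := mul_nonneg (sq_nonneg _) unitBump.nonneg
        have h1 : 0 ≤ ∑ k, (p k - a k) ^ 2 := Finset.sum_nonneg fun k _ => sq_nonneg _
        have h2 := mul_nonneg h1 h0
        simp only [smul_apply, smul_eq_mul, hs, Fin.sum_univ_three] at h2 ⊢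
        linarith)
    have e1 : ∀ k, ∫ x, pd k u x * schwartzPd k (dilate n bumpNormSq) x =
        ((n : ℝ) + 1)⁻¹ * I k (schwartzPd k bumpNormSq) n := fun k => by
      simp only [schwartzPd_dilate, hI]
      rw [← integral_const_mul]
      congr 1 with x
      ring
    have e2 : ∀ k, ∫ x, pd k u x * (a k • dilate n bumpNormSq) x = a k * I k bumpNormSq n :=
      fun k => by
        simp only [smul_apply, smul_eq_mul, hI]
        rw [← integral_const_mul]
        congr 1 with x
        ring
    have e3 : ∫ x, (s • dilate n bumpNormSq) x = s * (((n : ℝ) + 1) ^ 3 * ∫ x, bumpNormSq x) := by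
      simp only [smul_apply, smul_eq_mul]
      rw [integral_const_mul]
      congr 1
      exact integral_comp_dilation n bumpNormSq
    have e4 : ∀ k θ, I k θ n = ((n : ℝ) + 1) ^ 2 * J k θ n + ((n : ℝ) + 1) ^ 3 * (a k * ∫ x, θ x) := by
      intro k θ
      simp only [hJ]
      field_simp
      ring
    simp only [e1, e2, e3] at ht
    simp only [e4, integral_schwartzPd] at ht
    have hp : 0 < ((n : ℝ) + 1)⁻¹ ^ 3 := by positivity
    have ht' := mul_le_mul_of_nonneg_left ht hp.le
    refine le_of_eq_of_le ?_ (ht'.trans (le_of_eq (by ring)))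
    simp only [hs, Fin.sum_univ_three]
    field_simp
    ring
  have hL : Tendsto (fun n : ℕ => -2 * ∑ k, (((n : ℝ) + 1)⁻¹ ^ 2 * J k (schwartzPd k bumpNormSq) n) +
      2 * ∑ k, a k * (((n : ℝ) + 1)⁻¹ * J k bumpNormSq n) + s * ∫ x, bumpNormSq x) atTop
      (nhds (-2 * ∑ k, ((0 : ℝ) ^ 2 * (solAlpha u * potential k (schwartzPd k bumpNormSq) 0)) +
      2 * ∑ k, a k * (0 * (solAlpha u * potential k bumpNormSq 0)) + s * ∫ x, bumpNormSq x)) :=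
    ((tendsto_const_nhds.mul (tendsto_finsetSum _ fun k _ => (hinv.pow 2).mul (hJt k _))).add
      (tendsto_const_nhds.mul (tendsto_finsetSum _ fun k _ =>
        tendsto_const_nhds.mul (hinv.mul (hJt k _))))).add_const _
  have hR := ((hinv.pow 2).mul hE).const_mul C
  have hfin := le_of_tendsto_of_tendsto' hL hR hineq
  simp only [ne_eq, OfNat.ofNat_ne_zero, not_false_eq_true, zero_pow, zero_mul, mul_zero,
    Finset.sum_const_zero, add_zero, zero_add] at hfin
  have hs0 : s ≤ 0 := by
    by_contra hc
    push Not at hc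
    exact absurd hfin (not_le.mpr (mul_pos hc integral_bumpNormSq_pos))
  funext k
  have : a k ^ 2 ≤ s := Finset.single_le_sum (f := fun k => a k ^ 2) (fun i _ => sq_nonneg _)
    (Finset.mem_univ k)
  exact pow_eq_zero_iff two_ne_zero |>.mp (le_antisymm (this.trans hs0) (sq_nonneg _))

theorem solAlpha_le_two {u : E3 → ℝ} (hu : IsSolution u) {C : ℝ}
    (h : ∀ x, 2 * lap u x + ∑ i, pd i u x ^ 2 ≤ C * exp (2 * u x))
    (ha : ∀ i x, pd i u x =
    -(1 / π ^ 2) * potential i (fun y => exp (3 * u y)) x) : solAlpha u ≤ 2 := by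
  set I : Fin 3 → 𝓢(E3, ℝ) → ℕ → ℝ := fun k θ n => ∫ x, pd k u x * dilate n θ x with hI
  set J : Fin 3 → 𝓢(E3, ℝ) → ℕ → ℝ := fun k θ n => (((n : ℝ) + 1) ^ 2)⁻¹ * I k θ n with hJ
  have hJt : ∀ k θ, Tendsto (J k θ) atTop (nhds (solAlpha u * potential k θ 0)) := fun k θ => by
    have := tendsto_integral_pd_mul_dilate hu (i := k) (a := 0) (by simpa using ha k) θ
    simpa only [zero_mul, mul_zero, sub_zero] using this
  have hE := tendsto_integral_exp_two_mul_dilate hu bumpNormSq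
    (fun x => mul_nonneg (sq_nonneg _) unitBump.nonneg) (by simp [bumpNormSq_apply])
  set α := solAlpha u with hα
  have hineq : ∀ n : ℕ, -2 * ∑ k, J k (schwartzPd k bumpNormSq) n +
      -2 * α * ∑ k, J k (bumpCoord k) n - α ^ 2 * ∫ x, bumpOne x ≤
      C * (((n : ℝ) + 1)⁻¹ * ∫ x, exp (2 * u x) * dilate n bumpNormSq x) := by
    intro n
    have hn : 0 < (n : ℝ) + 1 := by positivity
    have ht := testing_inequality hu h (dilate n bumpNormSq)
      ((α ^ 2 * ((n : ℝ) + 1)⁻¹ ^ 2) • dilate n bumpOne)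
      (fun k => (-α * ((n : ℝ) + 1)⁻¹) • dilate n (bumpCoord k))
      (fun x => mul_nonneg (sq_nonneg _) unitBump.nonneg) (fun x p => by
        set m := ((n : ℝ) + 1)⁻¹ with hm
        have h0 : 0 ≤ unitBump (m • x) := unitBump.nonneg
        have hcs : (∑ k, p k * (m • x) k) ^ 2 ≤ (∑ k, p k ^ 2) * ∑ k, (m • x) k ^ 2 :=
          Finset.sum_mul_sq_le_sq_mul_sq _ _ _
        have h1 := mul_nonneg (add_nonneg (sub_nonneg.mpr hcs)
          (sq_nonneg (∑ k, p k * (m • x) k + α * m))) h0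
        simp only [smul_apply, smul_eq_mul, dilate_apply, bumpNormSq_apply, bumpCoord_apply,
          bumpOne_apply, ← hm]
        rw [norm_sq_eq_sum]
        simp only [Fin.sum_univ_three] at h1 ⊢
        linarith)
    have e1 : ∀ k, ∫ x, pd k u x * schwartzPd k (dilate n bumpNormSq) x =
        ((n : ℝ) + 1)⁻¹ * I k (schwartzPd k bumpNormSq) n := fun k => by
      simp only [schwartzPd_dilate, hI]
      rw [← integral_const_mul]
      congr 1 with x
      ring
    have e2 : ∀ k, ∫ x, pd k u x * ((-α * ((n : ℝ) + 1)⁻¹) • dilate n (bumpCoord k)) x =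
        -α * ((n : ℝ) + 1)⁻¹ * I k (bumpCoord k) n := fun k => by
      simp only [smul_apply, smul_eq_mul, hI]
      rw [← integral_const_mul]
      congr 1 with x
      ring
    have e3 : ∫ x, ((α ^ 2 * ((n : ℝ) + 1)⁻¹ ^ 2) • dilate n bumpOne) x =
        (α ^ 2 * ((n : ℝ) + 1)⁻¹ ^ 2) * (((n : ℝ) + 1) ^ 3 * ∫ x, bumpOne x) := by
      simp only [smul_apply, smul_eq_mul]
      rw [integral_const_mul]
      congr 1
      exact integral_comp_dilation n bumpOne
    have e4 : ∀ k θ, I k θ n = ((n : ℝ) + 1) ^ 2 * J k θ n := by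
      intro k θ
      simp only [hJ]
      field_simp
    simp only [e1, e2, e3] at ht
    simp only [e4] at ht
    have hp : 0 < ((n : ℝ) + 1)⁻¹ := by positivity
    have ht' := mul_le_mul_of_nonneg_left ht hp.le
    refine le_of_eq_of_le ?_ (ht'.trans (le_of_eq (by ring)))
    simp only [Fin.sum_univ_three]
    field_simp
    ring
  have hL : Tendsto (fun n : ℕ => -2 * ∑ k, J k (schwartzPd k bumpNormSq) n +
      -2 * α * ∑ k, J k (bumpCoord k) n - α ^ 2 * ∫ x, bumpOne x) atTop
      (nhds (-2 * ∑ k, α * potential k (schwartzPd k bumpNormSq) 0 +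
      -2 * α * ∑ k, α * potential k (bumpCoord k) 0 - α ^ 2 * ∫ x, bumpOne x)) :=
    ((tendsto_const_nhds.mul (tendsto_finsetSum _ fun k _ => hJt k _)).add
      (tendsto_const_nhds.mul (tendsto_finsetSum _ fun k _ => hJt k _))).sub_const _
  have hfin := le_of_tendsto_of_tendsto' hL (hE.const_mul C) hineq
  rw [← Finset.mul_sum, ← Finset.mul_sum, sum_potential_bumpCoord_zero,
    sum_potential_schwartzPd_bumpNormSq_zero, mul_zero] at hfin
  by_contra hc
  push Not at hc
  have := mul_pos (mul_pos (by linarith : 0 < α) (sub_pos.mpr hc)) integral_bumpOne_pos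
  linarith

theorem clm_apply_eq_sum (L : E3 →L[ℝ] ℝ) (d : E3) :
    L d = ∑ i, d i * L (EuclideanSpace.single i 1) := by
  conv_lhs => rw [← (EuclideanSpace.basisFun (Fin 3) ℝ).sum_repr d]
  simp

theorem volume_line_eq_zero (x d : E3) : volume {y : E3 | ∃ t : ℝ, x + t • d = y} = 0 := by
  have h0 : volume ((Submodule.span ℝ {d} : Submodule ℝ E3) : Set E3) = 0 := by
    refine Measure.addHaar_submodule _ _ fun h => ?_
    have h1 := finrank_span_le_card (R := ℝ) ({d} : Set E3)
    rw [h, finrank_top] at h1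
    simp at h1
  refine measure_mono_null ?_ ((measure_preimage_add_right volume (-x) _).trans h0)
  rintro y ⟨t, rfl⟩
  simp only [Set.mem_preimage, add_neg_cancel_comm, SetLike.mem_coe]
  exact Submodule.smul_mem _ _ (Submodule.mem_span_singleton_self d)

theorem continuousAt_gradLog (i : Fin 3) {z : E3} (hz : z ≠ 0) : ContinuousAt (gradLog i) z := by
  unfold gradLog
  exact ContinuousAt.div (by fun_prop) (by fun_prop) (pow_ne_zero 2 (norm_ne_zero_iff.mpr hz))

theorem hasDerivAt_log_norm_line {x d y : E3} {t : ℝ} (h : x + t • d ≠ y) :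
    HasDerivAt (fun s : ℝ => log ‖x + s • d - y‖) (∑ i, d i * gradLog i (x + t • d - y)) t := by
  have hz : x + t • d - y ≠ 0 := sub_ne_zero.mpr h
  have h1 : HasDerivAt (fun s : ℝ => x + s • d - y) d t := by
    simpa using (((hasDerivAt_id t).smul_const d).const_add x).sub_const y
  have h2 := (h1.norm_sq.log (pow_ne_zero 2 (norm_ne_zero_iff.mpr hz))).const_mul (1 / 2)
  have e : (fun s : ℝ => log ‖x + s • d - y‖) = fun s => 1 / 2 * log (‖x + s • d - y‖ ^ 2) := by
    funext s
    rw [log_pow]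
    push_cast
    ring
  rw [e]
  refine h2.congr_deriv ?_
  simp only [PiLp.inner_apply, gradLog, Fin.sum_univ_three]
  simp
  ring

theorem integrable_line_gradLog (i : Fin 3) {f : E3 → ℝ} (hf : Integrable f) (hfc : Continuous f)
    (x d : E3) : Integrable (fun p : ℝ × E3 => gradLog i (x + p.1 • d - p.2) * f p.2)
      ((volume.restrict (Set.Ioc (0 : ℝ) 1)).prod volume) := by
  obtain ⟨M, hM⟩ := (isCompact_closedBall x (‖d‖ + 1)).exists_bound_of_continuousOn hfc.continuousOn
  have hM' : ∀ t ∈ Set.Ioc (0 : ℝ) 1, ∀ y, ‖x + t • d - y‖ < 1 → ‖f y‖ ≤ M := by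
    intro t ht y hy
    refine hM y ?_
    rw [mem_closedBall_iff_norm]
    have e : y - x = t • d - (x + t • d - y) := by abel
    rw [e]
    refine (norm_sub_le _ _).trans ?_
    rw [norm_smul, Real.norm_of_nonneg ht.1.le]
    have := mul_le_of_le_one_left (norm_nonneg d) ht.2
    linarith
  have hms : AEStronglyMeasurable (fun p : ℝ × E3 => gradLog i (x + p.1 • d - p.2) * f p.2)
      ((volume.restrict (Set.Ioc (0 : ℝ) 1)).prod volume) := by
    have := hfc.measurable
    exact Measurable.aestronglyMeasurable (by fun_prop)
  rw [integrable_prod_iff hms]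
  constructor
  · filter_upwards [ae_restrict_mem measurableSet_Ioc] with t ht
    exact integrable_gradLog_smul i hf one_pos (hM' t ht)
  · refine Integrable.mono' (g := fun _ => M * (nearConst * 1 ^ 2) + 1⁻¹ * ∫ y, ‖f y‖)
      (integrable_const _) hms.norm.integral_prod_right' ?_
    filter_upwards [ae_restrict_mem measurableSet_Ioc] with t ht
    rw [Real.norm_of_nonneg (integral_nonneg fun y => norm_nonneg _)]
    exact integral_norm_gradLog_smul_le i hf one_pos (hM' t ht)

theorem log_kernel_line {f : E3 → ℝ} (hf : Integrable f) (hfc : Continuous f) (x d : E3) :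
    Integrable (fun y => (log ‖x + d - y‖ - log ‖x - y‖) * f y) ∧
    ∫ y, (log ‖x + d - y‖ - log ‖x - y‖) * f y =
      ∫ t in (0 : ℝ)..1, ∑ i, d i * potential i f (x + t • d) := by
  set μ := volume.restrict (Set.Ioc (0 : ℝ) 1) with hμ
  have hF : Integrable (fun p : ℝ × E3 => ∑ i, d i * (gradLog i (x + p.1 • d - p.2) * f p.2))
      (μ.prod volume) :=
    integrable_finsetSum _ fun i _ => (integrable_line_gradLog i hf hfc x d).const_mul _
  have hae : ∀ᵐ y : E3, ∫ t, ∑ i, d i * (gradLog i (x + t • d - y) * f y) ∂μ =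
      (log ‖x + d - y‖ - log ‖x - y‖) * f y := by
    filter_upwards [measure_eq_zero_iff_ae_notMem.mp (volume_line_eq_zero x d)] with y hy
    have hne : ∀ t : ℝ, x + t • d ≠ y := fun t ht => hy ⟨t, ht⟩
    have hftc := intervalIntegral.integral_eq_sub_of_hasDerivAt (a := 0) (b := 1)
      (fun t _ => hasDerivAt_log_norm_line (hne t)) (by
        refine ContinuousOn.intervalIntegrable fun t _ => ContinuousAt.continuousWithinAt ?_
        refine tendsto_finsetSum _ fun i _ => tendsto_const_nhds.mul ?_
        exact ContinuousAt.comp (g := gradLog i) (f := fun t : ℝ => x + t • d - y)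
          (continuousAt_gradLog i (sub_ne_zero.mpr (hne t))) (by fun_prop))
    simp only [one_smul, zero_smul, add_zero] at hftc
    rw [← hftc, intervalIntegral.integral_of_le zero_le_one, ← integral_mul_const]
    congr 1 with t
    rw [Finset.sum_mul]
    exact Finset.sum_congr rfl fun i _ => by ring
  refine ⟨hF.integral_prod_right.congr hae, ?_⟩
  rw [← integral_congr_ae hae, intervalIntegral.integral_of_le zero_le_one]
  rw [← integral_integral_swap (f := fun t y => ∑ i, d i * (gradLog i (x + t • d - y) * f y)) hF]
  refine integral_congr_ae ?_
  have hti : ∀ᵐ t ∂μ, ∀ i, Integrable fun y => gradLog i (x + t • d - y) * f y :=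
    ae_all_iff.mpr fun i => (integrable_line_gradLog i hf hfc x d).prod_right_ae
  filter_upwards [hti] with t ht
  rw [integral_finsetSum _ fun i _ => (ht i).const_mul _]
  simp only [integral_const_mul]
  rfl

/-- `u` is continuous with `e^{3u}` integrable of mass at most `2π²`, and `u` is, up to a constant,
the logarithmic potential of `e^{3u}`. -/
structure IsNormalSolution (u : E3 → ℝ) : Prop where
  continuous : Continuous u
  integrable_exp : Integrable fun x => exp (3 * u x)
  integrable_log : ∀ x x' : E3,
    Integrable fun y => (log ‖x' - y‖ - log ‖x - y‖) * exp (3 * u y)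
  sub_eq : ∀ x x' : E3,
    u x - u x' = 1 / π ^ 2 * ∫ y, (log ‖x' - y‖ - log ‖x - y‖) * exp (3 * u y)
  solAlpha_le : solAlpha u ≤ 2

theorem IsSolution.isNormalSolution {u : E3 → ℝ} (hu : IsSolution u) {C : ℝ}
    (h : ∀ x, 2 * lap u x + ∑ i, pd i u x ^ 2 ≤ C * exp (2 * u x)) : IsNormalSolution u := by
  choose a ha using exists_pd_eq_potential_add hu (integrable_pd_weight hu h)
  have ha0 := constants_eq_zero hu h ha
  have hp : ∀ i x, pd i u x = -(1 / π ^ 2) * potential i (fun y => exp (3 * u y)) x := by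
    intro i x
    rw [ha, ha0]
    simp
  have huc := hu.1.continuous
  have hlog := log_kernel_line hu.2.2.1 (by fun_prop : Continuous fun x => exp (3 * u x))
  refine ⟨huc, hu.2.2.1, fun x x' => by simpa using (hlog x (x' - x)).1, fun x x' => ?_,
    solAlpha_le_two hu h hp⟩
  have h1 := (hlog x (x' - x)).2
  rw [add_sub_cancel] at h1
  have hderiv : ∀ t : ℝ, HasDerivAt (fun t : ℝ => u (x + t • (x' - x)))
      (-(1 / π ^ 2) * ∑ i, (x' - x) i * potential i (fun y => exp (3 * u y)) (x + t • (x' - x))) t := by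
    intro t
    have h2 : HasDerivAt (fun t : ℝ => x + t • (x' - x)) (x' - x) t := by
      simpa using ((hasDerivAt_id t).smul_const (x' - x)).const_add x
    have h3 := ((hu.1.differentiable (by simp) (x + t • (x' - x))).hasFDerivAt).comp_hasDerivAt t h2
    refine h3.congr_deriv ?_
    rw [clm_apply_eq_sum, Finset.mul_sum]
    refine Finset.sum_congr rfl fun i _ => ?_
    have := hp i (x + t • (x' - x))
    rw [pd] at this
    rw [this]
    ring
  have hpc := fun i => continuous_potential i hu.2.2.1
    (by fun_prop : Continuous fun x => exp (3 * u x))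
  have hftc := intervalIntegral.integral_eq_sub_of_hasDerivAt (a := 0) (b := 1)
      (fun t _ => hderiv t) (Continuous.intervalIntegrable (by fun_prop) _ _)
  rw [intervalIntegral.integral_const_mul] at hftc
  simp only [one_smul, zero_smul, add_zero, add_sub_cancel] at hftc
  rw [h1]
  linarith

/-- Inversion in the sphere of radius `l` around the origin. -/
noncomputable def sphereInv (l : ℝ) (w : E3) : E3 := (l / ‖w‖) ^ 2 • w

/-- The Kelvin-type transform `u_l(w) = u(l² w / ‖w‖²) + 2 log (l / ‖w‖)`. -/
noncomputable def kelvin (u : E3 → ℝ) (l : ℝ) (w : E3) : ℝ :=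
  u (sphereInv l w) + 2 * log (l / ‖w‖)

/-- The open ball of radius `l` without its centre. -/
def puncturedBall (l : ℝ) : Set E3 := {w | 0 < ‖w‖ ∧ ‖w‖ < l}

/-- The logarithmic Green kernel `log (‖p‖ ‖p^l - w‖ / (l ‖p - w‖))` of the ball of radius `l`. -/
noncomputable def kelvinKernel (l : ℝ) (p w : E3) : ℝ :=
  log ‖sphereInv l p - w‖ - log ‖p - w‖ + log (‖p‖ / l)

theorem sphereInv_eq_inversion (l : ℝ) : sphereInv l = EuclideanGeometry.inversion 0 l := by
  funext w
  simp [sphereInv, EuclideanGeometry.inversion]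

theorem measurableSet_puncturedBall (l : ℝ) : MeasurableSet (puncturedBall l) :=
  (measurableSet_lt measurable_const measurable_norm).inter
    (measurableSet_lt measurable_norm measurable_const)

theorem ne_zero_of_mem_puncturedBall {l : ℝ} {w : E3} (hw : w ∈ puncturedBall l) : w ≠ 0 :=
  norm_pos_iff.mp hw.1

theorem pos_of_mem_puncturedBall {l : ℝ} {w : E3} (hw : w ∈ puncturedBall l) : 0 < l :=
  hw.1.trans hw.2

theorem norm_sphereInv (l : ℝ) (w : E3) : ‖sphereInv l w‖ = l ^ 2 / ‖w‖ := by
  simpa [sphereInv_eq_inversion] using EuclideanGeometry.dist_inversion_center (0 : E3) w l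

theorem sphereInv_sphereInv {l : ℝ} (hl : l ≠ 0) (w : E3) : sphereInv l (sphereInv l w) = w := by
  rw [sphereInv_eq_inversion]
  exact EuclideanGeometry.inversion_inversion _ hl _

theorem norm_sphereInv_sub_sphereInv (l : ℝ) {p w : E3} (hp : p ≠ 0) (hw : w ≠ 0) :
    ‖sphereInv l p - sphereInv l w‖ = l ^ 2 / (‖p‖ * ‖w‖) * ‖p - w‖ := by
  simpa [sphereInv_eq_inversion, dist_eq_norm] using
    EuclideanGeometry.dist_inversion_inversion hp hw l

theorem norm_sub_sphereInv {l : ℝ} (hl : l ≠ 0) {p w : E3} (hp : p ≠ 0) (hw : w ≠ 0) :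
    ‖p - sphereInv l w‖ = ‖sphereInv l p - w‖ * (‖p‖ / ‖w‖) := by
  have hp' : sphereInv l p ≠ 0 := by
    rw [← norm_ne_zero_iff, norm_sphereInv]
    have := norm_ne_zero_iff.mpr hp
    positivity
  have h := norm_sphereInv_sub_sphereInv l hp' hw
  rw [sphereInv_sphereInv hl, norm_sphereInv] at h
  rw [h]
  have := norm_ne_zero_iff.mpr hp
  have := norm_ne_zero_iff.mpr hw
  field_simp

theorem sphereInv_image_puncturedBall {l : ℝ} (hl : 0 < l) :
    sphereInv l '' puncturedBall l = {y | l < ‖y‖} := by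
  ext y
  constructor
  · rintro ⟨w, hw, rfl⟩
    rw [Set.mem_ofPred_eq, norm_sphereInv, lt_div_iff₀ hw.1]
    nlinarith [hw.2]
  · intro hy
    have hy : l < ‖y‖ := hy
    have hy0 := hl.trans hy
    refine ⟨sphereInv l y, ⟨?_, ?_⟩, sphereInv_sphereInv hl.ne' y⟩
    · rw [norm_sphereInv]
      positivity
    · rw [norm_sphereInv, div_lt_iff₀ hy0]
      nlinarith

theorem hasFDerivAt_sphereInv (l : ℝ) {w : E3} (hw : w ≠ 0) :
    ∃ L : E3 →L[ℝ] E3, HasFDerivAt (sphereInv l) L w ∧ |L.det| = (l / ‖w‖) ^ 6 := by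
  refine ⟨_, sphereInv_eq_inversion l ▸ EuclideanGeometry.hasFDerivAt_inversion hw, ?_⟩
  rw [ContinuousLinearMap.det, ContinuousLinearMap.toLinearMap_smul, LinearMap.det_smul]
  have h : LinearMap.det (((ℝ ∙ (w - 0))ᗮ.reflection : E3 →L[ℝ] E3) : E3 →ₗ[ℝ] E3) =
      (-1) ^ Module.finrank ℝ (ℝ ∙ (w - 0))ᗮᗮ := Submodule.det_reflection _
  rw [h, abs_mul, abs_pow (-1 : ℝ), abs_neg, abs_one, one_pow, mul_one,
    finrank_euclideanSpace_fin, dist_zero_right, ← pow_mul,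
    abs_of_nonneg ((even_two_mul 3).pow_nonneg _)]

theorem integral_norm_gt_eq {l : ℝ} (hl : 0 < l) (g : E3 → ℝ) :
    ∫ y in {y | l < ‖y‖}, g y = ∫ w in puncturedBall l, (l / ‖w‖) ^ 6 * g (sphereInv l w) := by
  have hL : ∀ w : E3, ∃ L : E3 →L[ℝ] E3, w ≠ 0 → HasFDerivAt (sphereInv l) L w ∧
      |L.det| = (l / ‖w‖) ^ 6 := fun w => by
    by_cases hw : w = 0
    · exact ⟨0, fun h => absurd hw h⟩
    · obtain ⟨L, hL⟩ := hasFDerivAt_sphereInv l hw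
      exact ⟨L, fun _ => hL⟩
  choose L hL using hL
  rw [← sphereInv_image_puncturedBall hl,
    integral_image_eq_integral_abs_det_fderiv_smul volume (measurableSet_puncturedBall l)
      (fun w hw => (hL w (ne_zero_of_mem_puncturedBall hw)).1.hasFDerivWithinAt)
      (fun a _ b _ hab => by
        rw [← sphereInv_sphereInv hl.ne' a, hab, sphereInv_sphereInv hl.ne'])]
  refine setIntegral_congr_fun (measurableSet_puncturedBall l) fun w hw => ?_
  simp only [(hL w (ne_zero_of_mem_puncturedBall hw)).2, smul_eq_mul]

theorem integrableOn_norm_gt_iff {l : ℝ} (hl : 0 < l) (g : E3 → ℝ) :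
    IntegrableOn g {y | l < ‖y‖} ↔
      IntegrableOn (fun w => (l / ‖w‖) ^ 6 * g (sphereInv l w)) (puncturedBall l) := by
  have hL : ∀ w : E3, ∃ L : E3 →L[ℝ] E3, w ≠ 0 → HasFDerivAt (sphereInv l) L w ∧
      |L.det| = (l / ‖w‖) ^ 6 := fun w => by
    by_cases hw : w = 0
    · exact ⟨0, fun h => absurd hw h⟩
    · obtain ⟨L, hL⟩ := hasFDerivAt_sphereInv l hw
      exact ⟨L, fun _ => hL⟩
  choose L hL using hL
  rw [← sphereInv_image_puncturedBall hl,
    integrableOn_image_iff_integrableOn_abs_det_fderiv_smul volume (measurableSet_puncturedBall l)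
      (fun w hw => (hL w (ne_zero_of_mem_puncturedBall hw)).1.hasFDerivWithinAt)
      (fun a _ b _ hab => by
        rw [← sphereInv_sphereInv hl.ne' a, hab, sphereInv_sphereInv hl.ne'])]
  refine integrableOn_congr_fun (fun w hw => ?_) (measurableSet_puncturedBall l)
  simp only [(hL w (ne_zero_of_mem_puncturedBall hw)).2, smul_eq_mul]

theorem integral_eq_puncturedBall_add {l : ℝ} (hl : 0 < l) {g : E3 → ℝ} (hg : Integrable g) :
    ∫ y, g y = ∫ w in puncturedBall l, (g w + (l / ‖w‖) ^ 6 * g (sphereInv l w)) := by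
  rw [integral_add hg.integrableOn ((integrableOn_norm_gt_iff hl g).mp hg.integrableOn),
    ← integral_norm_gt_eq hl]
  have hd : Disjoint (puncturedBall l) {y : E3 | l < ‖y‖} :=
    Set.disjoint_left.mpr fun w hw hw' => lt_asymm hw.2 hw'
  rw [← setIntegral_union hd (measurableSet_lt measurable_const measurable_norm) hg.integrableOn
    hg.integrableOn, ← setIntegral_univ]
  refine (setIntegral_congr_set ?_).symm
  rw [eventuallyEq_univ]
  have hs : volume (Metric.sphere (0 : E3) l) = 0 := Measure.addHaar_sphere _ _ _
  filter_upwards [Measure.ae_ne volume (0 : E3), measure_eq_zero_iff_ae_notMem.mp hs] with w h1 h2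
  rw [mem_sphere_zero_iff_norm] at h2
  rcases lt_or_gt_of_ne h2 with h | h
  · exact Or.inl ⟨norm_pos_iff.mpr h1, h⟩
  · exact Or.inr h

theorem exp_three_mul_kelvin (u : E3 → ℝ) {l : ℝ} (hl : 0 < l) {w : E3} (hw : w ≠ 0) :
    exp (3 * kelvin u l w) = (l / ‖w‖) ^ 6 * exp (3 * u (sphereInv l w)) := by
  have : 0 < l / ‖w‖ := div_pos hl (norm_pos_iff.mpr hw)
  rw [kelvin, show 3 * (u (sphereInv l w) + 2 * log (l / ‖w‖)) =
    ((6 : ℕ) : ℝ) * log (l / ‖w‖) + 3 * u (sphereInv l w) by push_cast; ring, exp_add, exp_nat_mul,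
    exp_log this]

theorem norm_mul_norm_sphereInv_sub_sq (l : ℝ) {p : E3} (hp : p ≠ 0) (w : E3) :
    (‖p‖ * ‖sphereInv l p - w‖) ^ 2 =
      (l * ‖p - w‖) ^ 2 + (l ^ 2 - ‖p‖ ^ 2) * (l ^ 2 - ‖w‖ ^ 2) := by
  have := norm_ne_zero_iff.mpr hp
  rw [mul_pow, mul_pow, norm_sub_sq_real, norm_sub_sq_real, norm_sphereInv, sphereInv,
    real_inner_smul_left]
  field_simp
  ring

theorem kelvinKernel_eq {l : ℝ} {p w : E3} (hp : p ∈ puncturedBall l) (hw : w ∈ puncturedBall l)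
    (h : w ≠ p) : kelvinKernel l p w = log (‖p‖ * ‖sphereInv l p - w‖ / (l * ‖p - w‖)) := by
  have hl := pos_of_mem_puncturedBall hp
  have h1 : 0 < ‖p - w‖ := norm_pos_iff.mpr (sub_ne_zero.mpr h.symm)
  have h2 : 0 < ‖sphereInv l p - w‖ := by
    refine norm_pos_iff.mpr (sub_ne_zero.mpr fun h => ?_)
    have h3 : sphereInv l p ∈ {y : E3 | l < ‖y‖} :=
      sphereInv_image_puncturedBall hl ▸ Set.mem_image_of_mem _ hp
    rw [h] at h3
    exact lt_asymm hw.2 h3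
  have h3 := hp.1
  rw [kelvinKernel, log_div h3.ne' hl.ne', log_div (mul_pos h3 h2).ne' (mul_pos hl h1).ne',
    log_mul h3.ne' h2.ne', log_mul hl.ne' h1.ne']
  ring

theorem kelvinKernel_pos {l : ℝ} {p w : E3} (hp : p ∈ puncturedBall l) (hw : w ∈ puncturedBall l)
    (h : w ≠ p) : 0 < kelvinKernel l p w := by
  have hl := pos_of_mem_puncturedBall hp
  have h1 : 0 < ‖p - w‖ := norm_pos_iff.mpr (sub_ne_zero.mpr h.symm)
  rw [kelvinKernel_eq hp hw h]
  refine log_pos ?_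
  rw [one_lt_div (by positivity)]
  refine lt_of_pow_lt_pow_left₀ 2 (by positivity) ?_
  rw [norm_mul_norm_sphereInv_sub_sq l (ne_zero_of_mem_puncturedBall hp)]
  have hp' : 0 < l ^ 2 - ‖p‖ ^ 2 := by nlinarith [hp.1, hp.2]
  have hw' : 0 < l ^ 2 - ‖w‖ ^ 2 := by nlinarith [hw.1, hw.2]
  have := mul_pos hp' hw'
  linarith

theorem kelvinKernel_le {l : ℝ} {p w : E3} (hp : p ∈ puncturedBall l) (hw : w ∈ puncturedBall l)
    (h : w ≠ p) : kelvinKernel l p w ≤ 2 * l * ‖p - w‖⁻¹ := by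
  have hl := pos_of_mem_puncturedBall hp
  have h1 : 0 < ‖p - w‖ := norm_pos_iff.mpr (sub_ne_zero.mpr h.symm)
  have h2 := hp.1
  rw [kelvinKernel_eq hp hw h]
  refine (log_le_self (by positivity)).trans ?_
  rw [← div_eq_mul_inv, div_le_div_iff₀ (by positivity) h1]
  have h3 : ‖p‖ * ‖sphereInv l p - w‖ ≤ 2 * l ^ 2 := by
    calc ‖p‖ * ‖sphereInv l p - w‖ ≤ ‖p‖ * (‖sphereInv l p‖ + ‖w‖) := by
          gcongr
          exact norm_sub_le _ _
      _ = l ^ 2 + ‖p‖ * ‖w‖ := by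
          rw [norm_sphereInv]
          field_simp
      _ ≤ l ^ 2 + l * l := by
          gcongr
          · exact hp.2.le
          · exact hw.2.le
      _ = _ := by ring
  nlinarith

/-- The difference of `u` and its Kelvin-type transform, as a potential over the ball. -/
theorem IsNormalSolution.kelvin_sub_eq {u : E3 → ℝ} (hu : IsNormalSolution u) {l : ℝ} {p : E3}
    (hp : p ∈ puncturedBall l) :
    IntegrableOn (fun w => kelvinKernel l p w * exp (3 * u w)) (puncturedBall l) ∧
    IntegrableOn (fun w => kelvinKernel l p w * exp (3 * kelvin u l w)) (puncturedBall l) ∧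
    kelvin u l p - u p = 1 / π ^ 2 * (∫ w in puncturedBall l,
      kelvinKernel l p w * (exp (3 * kelvin u l w) - exp (3 * u w))) +
      (2 - solAlpha u) * log (l / ‖p‖) := by
  have hl := pos_of_mem_puncturedBall hp
  have hp0 := ne_zero_of_mem_puncturedBall hp
  have hB := measurableSet_puncturedBall l
  have hfi := hu.integrable_exp
  have hli := hu.integrable_log (sphereInv l p) p
  have hc : log (l / ‖p‖) = -log (‖p‖ / l) := by rw [← log_inv, inv_div]
  have hK : ∀ w, (log ‖p - w‖ - log ‖sphereInv l p - w‖) * exp (3 * u w) =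
      -(kelvinKernel l p w * exp (3 * u w)) + log (‖p‖ / l) * exp (3 * u w) := fun w => by
    rw [kelvinKernel]
    ring
  have hK' : ∀ w ∈ puncturedBall l, w ≠ p → (l / ‖w‖) ^ 6 * ((log ‖p - sphereInv l w‖ -
      log ‖sphereInv l p - sphereInv l w‖) * exp (3 * u (sphereInv l w))) =
      kelvinKernel l p w * exp (3 * kelvin u l w) + log (‖p‖ / l) * exp (3 * kelvin u l w) := by
    intro w hw hwp
    have hw0 := ne_zero_of_mem_puncturedBall hw
    have h1 : 0 < ‖p - w‖ := norm_pos_iff.mpr (sub_ne_zero.mpr hwp.symm)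
    have h2 : 0 < ‖sphereInv l p - w‖ := by
      refine norm_pos_iff.mpr (sub_ne_zero.mpr fun h => ?_)
      have h3 : sphereInv l p ∈ {y : E3 | l < ‖y‖} :=
        sphereInv_image_puncturedBall hl ▸ Set.mem_image_of_mem _ hp
      rw [h] at h3
      exact lt_asymm hw.2 h3
    have h3 := hp.1
    have h4 := hw.1
    rw [exp_three_mul_kelvin u hl hw0, norm_sub_sphereInv hl.ne' hp0 hw0,
      norm_sphereInv_sub_sphereInv l hp0 hw0, kelvinKernel]
    rw [log_mul (by positivity) (by positivity), log_mul (by positivity) (by positivity),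
      log_div (by positivity) (by positivity), log_div (by positivity) (by positivity),
      log_div (by positivity) (by positivity), log_pow, log_mul (by positivity) (by positivity)]
    push_cast
    ring
  have hae : ∀ᵐ w ∂volume.restrict (puncturedBall l), (l / ‖w‖) ^ 6 * ((log ‖p - sphereInv l w‖ -
      log ‖sphereInv l p - sphereInv l w‖) * exp (3 * u (sphereInv l w))) =
      kelvinKernel l p w * exp (3 * kelvin u l w) + log (‖p‖ / l) * exp (3 * kelvin u l w) := by
    filter_upwards [ae_restrict_mem hB, ae_restrict_of_ae (Measure.ae_ne volume p)] with w hw hwp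
    exact hK' w hw hwp
  have hfl : IntegrableOn (fun w => exp (3 * kelvin u l w)) (puncturedBall l) :=
    ((integrableOn_norm_gt_iff hl _).mp hfi.integrableOn).congr_fun (fun w hw =>
      (exp_three_mul_kelvin u hl (ne_zero_of_mem_puncturedBall hw)).symm) hB
  have hI1 : IntegrableOn (fun w => kelvinKernel l p w * exp (3 * u w)) (puncturedBall l) := by
    refine ((hfi.const_mul (log (‖p‖ / l))).sub hli).integrableOn.congr_fun (fun w _ => ?_) hB
    simp only [Pi.sub_apply, hK]
    ring
  have hI2 : IntegrableOn (fun w => kelvinKernel l p w * exp (3 * kelvin u l w))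
      (puncturedBall l) := by
    have h1 : IntegrableOn _ (puncturedBall l) :=
      (((integrableOn_norm_gt_iff hl _).mp hli.integrableOn).congr hae).sub
      (hfl.const_mul (log (‖p‖ / l)))
    refine h1.congr_fun (fun w _ => ?_) hB
    simp only [Pi.sub_apply]
    ring
  refine ⟨hI1, hI2, ?_⟩
  have hmass : ∫ y, exp (3 * u y) =
      (∫ w in puncturedBall l, exp (3 * u w)) + ∫ w in puncturedBall l, exp (3 * kelvin u l w) := by
    rw [integral_eq_puncturedBall_add hl hfi, ← integral_add hfi.integrableOn hfl]
    refine setIntegral_congr_fun hB fun w hw => ?_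
    simp only [exp_three_mul_kelvin u hl (ne_zero_of_mem_puncturedBall hw)]
  have hmain : ∫ y, (log ‖p - y‖ - log ‖sphereInv l p - y‖) * exp (3 * u y) =
      (∫ w in puncturedBall l, kelvinKernel l p w * (exp (3 * kelvin u l w) - exp (3 * u w))) +
        log (‖p‖ / l) * ∫ y, exp (3 * u y) := by
    rw [hmass, mul_add, ← integral_const_mul, ← integral_const_mul,
      ← integral_add (hfi.integrableOn.const_mul _) (hfl.const_mul _)]
    simp only [mul_sub]
    rw [integral_eq_puncturedBall_add hl hli, ← integral_add (by exact hI2.sub hI1)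
      (by exact (hfi.integrableOn.const_mul _).add (hfl.const_mul _))]
    refine integral_congr_ae ?_
    filter_upwards [hae] with w hw
    rw [hw, hK]
    ring
  have h0 := hu.sub_eq (sphereInv l p) p
  rw [hmain] at h0
  rw [hc, kelvin, hc, solAlpha]
  linear_combination h0

/-- The function `u` lies below its Kelvin-type transform in the ball of radius `l`. -/
def KelvinLE (u : E3 → ℝ) (l : ℝ) : Prop := ∀ p ∈ puncturedBall l, u p ≤ kelvin u l p

/-- The set where `u` exceeds its Kelvin-type transform in the ball of radius `l`. -/
def kelvinBad (u : E3 → ℝ) (l : ℝ) : Set E3 := {w | w ∈ puncturedBall l ∧ kelvin u l w < u w}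

theorem kelvinBad_subset (u : E3 → ℝ) (l : ℝ) : kelvinBad u l ⊆ puncturedBall l := fun _ h => h.1

theorem continuousAt_kelvin {u : E3 → ℝ} (hu : Continuous u) {l : ℝ} (hl : 0 < l) {w : E3}
    (hw : w ≠ 0) : ContinuousAt (fun q : ℝ × E3 => kelvin u q.1 q.2) (l, w) := by
  have hw' : ‖w‖ ≠ 0 := norm_ne_zero_iff.mpr hw
  have h1 : ContinuousAt (fun q : ℝ × E3 => q.1 / ‖q.2‖) (l, w) :=
    continuousAt_fst.div continuousAt_snd.norm hw'
  have h2 : ContinuousAt (fun q : ℝ × E3 => sphereInv q.1 q.2) (l, w) := by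
    unfold sphereInv
    exact (h1.pow 2).smul continuousAt_snd
  unfold kelvin
  exact (hu.continuousAt.comp h2).add
    (continuousAt_const.mul (h1.log (div_pos hl (norm_pos_iff.mpr hw)).ne'))

theorem measurable_kelvin {u : E3 → ℝ} (hu : Continuous u) (l : ℝ) : Measurable (kelvin u l) := by
  have h : Measurable (sphereInv l) := by
    unfold sphereInv
    fun_prop
  unfold kelvin
  exact (hu.measurable.comp h).add (by fun_prop)

theorem measurableSet_kelvinBad {u : E3 → ℝ} (hu : Continuous u) (l : ℝ) :
    MeasurableSet (kelvinBad u l) :=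
  (measurableSet_puncturedBall l).inter (measurableSet_lt (measurable_kelvin hu l) hu.measurable)

theorem isOpen_puncturedBall (l : ℝ) : IsOpen (puncturedBall l) :=
  (isOpen_lt continuous_const continuous_norm).inter (isOpen_lt continuous_norm continuous_const)

theorem log_div_norm_pos {l : ℝ} {p : E3} (hp : p ∈ puncturedBall l) : 0 < log (l / ‖p‖) :=
  log_pos ((one_lt_div hp.1).mpr hp.2)

theorem ae_puncturedBall_ne (l : ℝ) (p : E3) :
    ∀ᵐ w ∂volume.restrict (puncturedBall l), w ∈ puncturedBall l ∧ w ≠ p := by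
  filter_upwards [ae_restrict_mem (measurableSet_puncturedBall l),
    ae_restrict_of_ae (Measure.ae_ne volume p)] with w hw hwp using ⟨hw, hwp⟩

/-- The excess of `u` over its Kelvin-type transform is controlled by the bad set. -/
theorem IsNormalSolution.sub_kelvin_le {u : E3 → ℝ} (hu : IsNormalSolution u) {l c : ℝ} {p : E3}
    (hp : p ∈ puncturedBall l)
    (hc : ∀ w ∈ kelvinBad u l, exp (3 * u w) - exp (3 * kelvin u l w) ≤ c * exp (3 * u w)) :
    u p - kelvin u l p ≤
      c * (1 / π ^ 2 * ∫ w in kelvinBad u l, kelvinKernel l p w * exp (3 * u w)) := by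
  obtain ⟨h1, h2, h3⟩ := hu.kelvin_sub_eq hp
  have hA := measurableSet_kelvinBad hu.continuous l
  have hmono : ∫ w in puncturedBall l,
      kelvinKernel l p w * (exp (3 * u w) - exp (3 * kelvin u l w)) ≤
      ∫ w in puncturedBall l, (kelvinBad u l).indicator
        (fun w => c * (kelvinKernel l p w * exp (3 * u w))) w := by
    refine integral_mono_ae ?_ ((h1.const_mul c).indicator hA) ?_
    · simp only [mul_sub]
      exact h1.sub h2
    · filter_upwards [ae_puncturedBall_ne l p] with w hw
      have hK := kelvinKernel_pos hp hw.1 hw.2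
      by_cases hwA : w ∈ kelvinBad u l
      · rw [Set.indicator_of_mem hwA]
        have := mul_le_mul_of_nonneg_left (hc w hwA) hK.le
        linarith
      · rw [Set.indicator_of_notMem hwA]
        have : u w ≤ kelvin u l w := not_lt.mp fun h => hwA ⟨hw.1, h⟩
        refine mul_nonpos_of_nonneg_of_nonpos hK.le (sub_nonpos.mpr ?_)
        gcongr
  rw [setIntegral_indicator hA, Set.inter_eq_right.mpr (kelvinBad_subset u l),
    integral_const_mul] at hmono
  have hneg : ∫ w in puncturedBall l,
      kelvinKernel l p w * (exp (3 * kelvin u l w) - exp (3 * u w)) =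
      -∫ w in puncturedBall l,
        kelvinKernel l p w * (exp (3 * u w) - exp (3 * kelvin u l w)) := by
    rw [← integral_neg]
    congr with w
    ring
  rw [hneg] at h3
  have h4 := mul_nonneg (sub_nonneg.mpr hu.solAlpha_le) (log_div_norm_pos hp).le
  have h5 := mul_le_mul_of_nonneg_left hmono (show 0 ≤ 1 / π ^ 2 by positivity)
  linarith

theorem IsNormalSolution.kelvinLE_of_integral_le {u : E3 → ℝ} (hu : IsNormalSolution u) {l : ℝ}
    (h : ∀ p ∈ puncturedBall l,
      1 / π ^ 2 * ∫ w in kelvinBad u l, kelvinKernel l p w * exp (3 * u w) ≤ 1 / 6) :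
    KelvinLE u l := by
  have key : ∀ n : ℕ, ∀ p ∈ puncturedBall l, u p - kelvin u l p ≤ (1 / 2 : ℝ) ^ n := by
    intro n
    induction n with
    | zero =>
      intro p hp
      have := hu.sub_kelvin_le hp (c := 1) fun w _ => by linarith [exp_pos (3 * kelvin u l w)]
      linarith [h p hp]
    | succ n ih =>
      intro p hp
      have hd : 0 ≤ (1 / 2 : ℝ) ^ n := by positivity
      have := hu.sub_kelvin_le hp (c := 3 * (1 / 2 : ℝ) ^ n) fun w hw => by
        have h1 := ih w hw.1
        have h2 := add_one_le_exp (3 * kelvin u l w - 3 * u w)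
        rw [exp_sub, le_div_iff₀ (exp_pos _)] at h2
        nlinarith [exp_pos (3 * u w)]
      rw [pow_succ]
      nlinarith [h p hp]
  intro p hp
  exact sub_nonpos.mp (ge_of_tendsto' (tendsto_pow_atTop_nhds_zero_of_lt_one (by norm_num)
    (by norm_num)) fun n => key n p hp)

theorem IsNormalSolution.integral_kelvinBad_le {u : E3 → ℝ} (hu : IsNormalSolution u)
    {l L M ρ : ℝ} (hlL : l ≤ L) (hM : ∀ w, ‖w‖ ≤ L → exp (3 * u w) ≤ M) (hρ : 0 < ρ) {p : E3}
    (hp : p ∈ puncturedBall l) :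
    ∫ w in kelvinBad u l, kelvinKernel l p w * exp (3 * u w) ≤
      2 * L * (M * (nearConst * ρ ^ 2) + ρ⁻¹ * (M * volume.real (kelvinBad u l))) := by
  have hl := pos_of_mem_puncturedBall hp
  have hA := measurableSet_kelvinBad hu.continuous l
  have hAL : ∀ w ∈ kelvinBad u l, ‖w‖ ≤ L := fun w hw => hw.1.2.le.trans hlL
  have hM0 : 0 ≤ M := (exp_pos _).le.trans (hM p (hp.2.le.trans hlL))
  have hfin : volume (kelvinBad u l) ≠ ⊤ := by
    refine ((measure_mono fun w hw => ?_).trans_lt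
      (measure_ball_lt_top (x := (0 : E3)) (r := l))).ne
    exact mem_ball_zero_iff.mpr hw.1.2
  set g := (kelvinBad u l).indicator fun w => exp (3 * u w) with hg
  have hgi : Integrable g := hu.integrable_exp.indicator hA
  have hgM : ∀ w, ‖g w‖ ≤ M := fun w => by
    by_cases hw : w ∈ kelvinBad u l
    · rw [hg, Set.indicator_of_mem hw, norm_of_nonneg (exp_pos _).le]
      exact hM w (hAL w hw)
    · rw [hg, Set.indicator_of_notMem hw, norm_zero]
      exact hM0
  have hint := integrable_inv_norm_sub_mul hgi (x := p) hρ fun y _ => hgM y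
  have hle := integral_inv_norm_sub_mul_le hgi (x := p) hρ fun y _ => hgM y
  have hgn : ∫ y, ‖g y‖ ≤ M * volume.real (kelvinBad u l) := by
    rw [hg]
    simp only [norm_indicator_eq_indicator_norm]
    rw [integral_indicator hA]
    refine (setIntegral_mono_on hu.integrable_exp.norm.integrableOn
      (integrableOn_const (C := M) hfin) hA fun w hw => ?_).trans_eq ?_
    · rw [norm_of_nonneg (exp_pos _).le]
      exact hM w (hAL w hw)
    · rw [setIntegral_const, smul_eq_mul, mul_comm]
  calc ∫ w in kelvinBad u l, kelvinKernel l p w * exp (3 * u w)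
      ≤ ∫ w in kelvinBad u l, 2 * l * (‖p - w‖⁻¹ * ‖g w‖) := by
        refine integral_mono_ae ((hu.kelvin_sub_eq hp).1.mono_set (kelvinBad_subset u l))
          (hint.const_mul _).integrableOn ?_
        filter_upwards [ae_restrict_mem hA, ae_restrict_of_ae (Measure.ae_ne volume p)]
          with w hw hwp
        rw [hg, Set.indicator_of_mem hw, norm_of_nonneg (exp_pos _).le, ← mul_assoc]
        exact mul_le_mul_of_nonneg_right (kelvinKernel_le hp hw.1 hwp) (exp_pos _).le
    _ ≤ ∫ w, 2 * l * (‖p - w‖⁻¹ * ‖g w‖) :=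
        setIntegral_le_integral (hint.const_mul _) (.of_forall fun w => by positivity)
    _ = 2 * l * ∫ w, ‖p - w‖⁻¹ * ‖g w‖ := integral_const_mul _ _
    _ ≤ 2 * L * (M * (nearConst * ρ ^ 2) + ρ⁻¹ * ∫ y, ‖g y‖) := by
        have : 0 ≤ ∫ w, ‖p - w‖⁻¹ * ‖g w‖ := integral_nonneg fun w => by positivity
        exact mul_le_mul (by linarith) hle this (by linarith)
    _ ≤ _ := by
        have hL : 0 ≤ 2 * L := by linarith
        gcongr

/-- The narrow region principle: a bad set of small volume is empty. -/
theorem IsNormalSolution.exists_kelvinLE_of_volume_le {u : E3 → ℝ} (hu : IsNormalSolution u)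
    {L : ℝ} (hL : 0 ≤ L) :
    ∃ ε > 0, ∀ l ≤ L, volume.real (kelvinBad u l) ≤ ε → KelvinLE u l := by
  obtain ⟨M, hM⟩ : ∃ M, ∀ w ∈ Metric.closedBall (0 : E3) L, exp (3 * u w) ≤ M := by
    have hc : Continuous fun w => exp (3 * u w) := by
      have := hu.continuous
      fun_prop
    obtain ⟨M, hM⟩ := (isCompact_closedBall (0 : E3) L).bddAbove_image hc.continuousOn
    exact ⟨M, fun w hw => hM (Set.mem_image_of_mem _ hw)⟩
  replace hM : ∀ w, ‖w‖ ≤ L → exp (3 * u w) ≤ M := fun w hw =>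
    hM w (mem_closedBall_zero_iff.mpr hw)
  have hM0 : 0 ≤ M := (exp_pos _).le.trans (hM 0 (by simpa using hL))
  have hn := nearConst_nonneg
  set C := 2 * L * M * nearConst with hC
  have hC0 : 0 ≤ C := by positivity
  set ρ := 1 / (2 * (C + 1)) with hρ
  have hρ0 : 0 < ρ := by positivity
  have hρ1 : ρ ≤ 1 := by
    rw [hρ, div_le_one (by positivity)]
    linarith
  have hCρ : C * ρ ≤ 1 / 2 := by
    rw [hρ, mul_one_div, div_le_iff₀ (by positivity)]
    linarith
  refine ⟨ρ / (2 * (2 * L * M + 1)), by positivity, fun l hl hv => ?_⟩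
  refine hu.kelvinLE_of_integral_le fun p hp => ?_
  have h1 := hu.integral_kelvinBad_le hl hM hρ0 hp
  have h2 : 2 * L * M * (ρ⁻¹ * volume.real (kelvinBad u l)) ≤ 1 / 2 := by
    calc 2 * L * M * (ρ⁻¹ * volume.real (kelvinBad u l))
        ≤ 2 * L * M * (ρ⁻¹ * (ρ / (2 * (2 * L * M + 1)))) := by gcongr
      _ = 2 * L * M / (2 * (2 * L * M + 1)) := by field_simp
      _ ≤ 1 / 2 := by
        rw [div_le_div_iff₀ (by positivity) two_pos]
        linarith
  have h3 : C * ρ ^ 2 ≤ 1 / 2 := by nlinarith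
  have h4 : ∫ w in kelvinBad u l, kelvinKernel l p w * exp (3 * u w) ≤ 1 := by
    refine h1.trans ?_
    have : 2 * L * (M * (nearConst * ρ ^ 2) + ρ⁻¹ * (M * volume.real (kelvinBad u l))) =
      C * ρ ^ 2 + 2 * L * M * (ρ⁻¹ * volume.real (kelvinBad u l)) := by
      rw [hC]
      ring
    linarith
  have hpi : (6 : ℝ) ≤ π ^ 2 := by nlinarith [pi_gt_three]
  rw [one_div_mul_eq_div, div_le_div_iff₀ (by positivity) (by norm_num)]
  linarith

theorem IsNormalSolution.eventually_kelvinLE {u : E3 → ℝ} (hu : IsNormalSolution u) {a : ℝ}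
    (ha : 0 ≤ a) (h : ∀ᵐ w : E3, ∀ᶠ l in nhdsWithin a (Set.Ioi a), w ∉ kelvinBad u l) :
    ∀ᶠ l in nhdsWithin a (Set.Ioi a), KelvinLE u l := by
  obtain ⟨ε, hε, H⟩ := hu.exists_kelvinLE_of_volume_le (L := a + 1) (by linarith)
  have hle : ∀ᶠ l in nhdsWithin a (Set.Ioi a), l < a + 1 :=
    nhdsWithin_le_nhds (eventually_lt_nhds (by linarith))
  have hsub : ∀ᶠ l in nhdsWithin a (Set.Ioi a), kelvinBad u l ⊆ Metric.ball (0 : E3) (a + 1) := by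
    filter_upwards [hle] with l hl w hw
    exact mem_ball_zero_iff.mpr (hw.1.2.trans hl)
  have ht := tendsto_measure_of_ae_tendsto_indicator _ (μ := volume) (A := (∅ : Set E3))
    MeasurableSet.empty (measurableSet_kelvinBad hu.continuous) Metric.isOpen_ball.measurableSet
    measure_ball_lt_top.ne hsub (by
      filter_upwards [h] with w hw
      filter_upwards [hw] with l hl
      simp [hl])
  have ht' := (ENNReal.tendsto_toReal (by simp)).comp ht
  rw [measure_empty, ENNReal.toReal_zero] at ht'
  filter_upwards [ht'.eventually (eventually_lt_nhds hε), hle] with l h1 h2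
  exact H l h2.le h1.le

/-- The strong maximum principle for the difference of `u` and its Kelvin-type transform. -/
theorem IsNormalSolution.lt_kelvin_or_eq {u : E3 → ℝ} (hu : IsNormalSolution u) {l : ℝ}
    (h : KelvinLE u l) :
    (∀ p ∈ puncturedBall l, u p < kelvin u l p) ∨ ∀ p ∈ puncturedBall l, u p = kelvin u l p := by
  refine or_iff_not_imp_left.mpr fun hne => ?_
  push Not at hne
  obtain ⟨p, hp, hp'⟩ := hne
  obtain ⟨h1, h2, h3⟩ := hu.kelvin_sub_eq hp
  have hl := pos_of_mem_puncturedBall hp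
  have hnn : 0 ≤ᵐ[volume.restrict (puncturedBall l)] fun w =>
      kelvinKernel l p w * (exp (3 * kelvin u l w) - exp (3 * u w)) := by
    filter_upwards [ae_puncturedBall_ne l p] with w hw
    refine mul_nonneg (kelvinKernel_pos hp hw.1 hw.2).le (sub_nonneg.mpr ?_)
    have := h w hw.1
    gcongr
  have h4 := mul_nonneg (sub_nonneg.mpr hu.solAlpha_le) (log_div_norm_pos hp).le
  have h5 : ∫ w in puncturedBall l,
      kelvinKernel l p w * (exp (3 * kelvin u l w) - exp (3 * u w)) = 0 := by
    refine le_antisymm ?_ (integral_nonneg_of_ae hnn)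
    by_contra! hlt
    have := mul_pos (show 0 < 1 / π ^ 2 by positivity) hlt
    linarith
  rw [integral_eq_zero_iff_of_nonneg_ae hnn (by simp only [mul_sub]; exact h2.sub h1)] at h5
  refine Measure.eqOn_open_of_ae_eq (μ := volume) ?_ (isOpen_puncturedBall l)
    hu.continuous.continuousOn fun w hw => ?_
  · filter_upwards [h5, ae_puncturedBall_ne l p] with w hw hwB
    have := (mul_eq_zero.mp hw).resolve_left (kelvinKernel_pos hp hwB.1 hwB.2).ne'
    have := exp_injective (sub_eq_zero.mp this)
    linarith
  · exact ((continuousAt_kelvin hu.continuous hl (ne_zero_of_mem_puncturedBall hw)).comp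
      (f := fun w => (l, w)) (by fun_prop)).continuousWithinAt

theorem eq_kelvin_of_ne_zero {u : E3 → ℝ} {l : ℝ} (hl : 0 < l)
    (h : ∀ p ∈ puncturedBall l, u p = kelvin u l p) {p : E3} (hp : p ≠ 0) :
    u p = kelvin u l p := by
  have hp' := norm_pos_iff.mpr hp
  rcases lt_trichotomy ‖p‖ l with h1 | h1 | h1
  · exact h p ⟨hp', h1⟩
  · rw [kelvin, sphereInv, h1, div_self hl.ne']
    simp
  · have hq : sphereInv l p ∈ puncturedBall l := by
      rw [← sphereInv_sphereInv hl.ne' p]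
      have hm : p ∈ {y : E3 | l < ‖y‖} := h1
      rw [← sphereInv_image_puncturedBall hl] at hm
      obtain ⟨q, hq, rfl⟩ := hm
      rwa [sphereInv_sphereInv hl.ne', sphereInv_sphereInv hl.ne']
    have h2 := h _ hq
    rw [kelvin, sphereInv_sphereInv hl.ne', norm_sphereInv] at h2
    rw [kelvin, h2, log_div hl.ne' (by positivity), log_div hl.ne' (by positivity),
      log_div (by positivity) (by positivity), log_pow]
    push_cast
    ring

/-- The method of moving spheres: either `u` lies below all its Kelvin-type transforms, or it
is invariant under one of them. -/
theorem IsNormalSolution.kelvinLE_or_eq {u : E3 → ℝ} (hu : IsNormalSolution u) :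
    (∀ l, KelvinLE u l) ∨ ∃ l > 0, ∀ p ≠ 0, u p = kelvin u l p := by
  refine or_iff_not_imp_right.mpr fun hne => ?_
  have hne' : ∀ l > 0, ¬∀ p ∈ puncturedBall l, u p = kelvin u l p := fun l hl h =>
    hne ⟨l, hl, fun p hp => eq_kelvin_of_ne_zero hl h hp⟩
  have hsmall : ∀ w : E3, ∀ a : ℝ, a < ‖w‖ →
      ∀ᶠ l in nhdsWithin a (Set.Ioi a), w ∉ kelvinBad u l := fun w a ha => by
    filter_upwards [nhdsWithin_le_nhds (eventually_lt_nhds ha)] with l hl hw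
    exact lt_asymm hl hw.1.2
  have hstart : ∀ᶠ l in nhdsWithin 0 (Set.Ioi 0), KelvinLE u l := by
    refine hu.eventually_kelvinLE le_rfl ?_
    filter_upwards [Measure.ae_ne volume (0 : E3)] with w hw
    exact hsmall w 0 (norm_pos_iff.mpr hw)
  have hext : ∀ a > 0, KelvinLE u a → ∀ᶠ l in nhdsWithin a (Set.Ioi a), KelvinLE u l := by
    intro a ha hKa
    refine hu.eventually_kelvinLE ha.le ?_
    have hs : volume (Metric.sphere (0 : E3) a) = 0 := Measure.addHaar_sphere _ _ _
    filter_upwards [Measure.ae_ne volume (0 : E3), measure_eq_zero_iff_ae_notMem.mp hs] with w h1 h2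
    rw [mem_sphere_zero_iff_norm] at h2
    rcases lt_or_gt_of_ne h2 with h | h
    · have hlt := ((hu.lt_kelvin_or_eq hKa).resolve_right (hne' a ha)) w ⟨norm_pos_iff.mpr h1, h⟩
      have hc : ContinuousAt (fun l => kelvin u l w) a :=
        (continuousAt_kelvin hu.continuous ha h1).comp (f := fun l => (l, w)) (by fun_prop)
      filter_upwards [nhdsWithin_le_nhds (hc.eventually (eventually_gt_nhds hlt))] with l hl hw
      exact lt_asymm hl hw.2
    · exact hsmall w a h
  by_contra hall
  push Not at hall
  obtain ⟨l₁, hl₁⟩ := hall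
  set S := {a : ℝ | 0 < a ∧ ∀ l ≤ a, KelvinLE u l} with hS
  have hneg : ∀ l ≤ 0, KelvinLE u l := fun l hl p hp =>
    absurd (pos_of_mem_puncturedBall hp) (not_lt.mpr hl)
  have hSne : S.Nonempty := by
    obtain ⟨b, hb, hb'⟩ := (mem_nhdsGT_iff_exists_Ioc_subset).mp hstart
    refine ⟨b, hb, fun l hl => ?_⟩
    rcases le_or_gt l 0 with h | h
    · exact hneg l h
    · exact hb' ⟨h, hl⟩
  have hSbdd : BddAbove S := ⟨l₁, fun a ha => by
    by_contra! h
    exact hl₁ (ha.2 l₁ h.le)⟩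
  set a := sSup S with ha
  have ha0 : 0 < a := by
    obtain ⟨b, hb⟩ := hSne
    exact hb.1.trans_le (le_csSup hSbdd hb)
  have hlt : ∀ l < a, KelvinLE u l := fun l hl => by
    obtain ⟨b, hb, hlb⟩ := exists_lt_of_lt_csSup hSne hl
    exact hb.2 l hlb.le
  have hKa : KelvinLE u a := fun p hp => by
    have hc : ContinuousAt (fun l => kelvin u l p) a :=
      (continuousAt_kelvin hu.continuous ha0 (ne_zero_of_mem_puncturedBall hp)).comp
        (f := fun l => (l, p)) (by fun_prop)
    refine ge_of_tendsto (hc.tendsto.mono_left (nhdsWithin_le_nhds (s := Set.Iio a))) ?_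
    filter_upwards [nhdsWithin_le_nhds (eventually_gt_nhds hp.2), self_mem_nhdsWithin] with l h1 h2
    exact hlt l h2 p ⟨hp.1, h1⟩
  obtain ⟨b, hb, hb'⟩ := (mem_nhdsGT_iff_exists_Ioc_subset).mp (hext a ha0 hKa)
  have hbS : b ∈ S := by
    refine ⟨ha0.trans hb, fun l hl => ?_⟩
    rcases lt_trichotomy l a with h | h | h
    · exact hlt l h
    · exact h ▸ hKa
    · exact hb' ⟨h, hl⟩
  exact absurd (le_csSup hSbdd hbS) (not_le.mpr hb)

theorem IsNormalSolution.comp_const_add {u : E3 → ℝ} (hu : IsNormalSolution u) (c : E3) :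
    IsNormalSolution fun x => u (c + x) := by
  have hs : ∀ x y : E3, x - y = (c + x) - (c + y) := fun x y => by abel
  refine ⟨hu.continuous.comp (by fun_prop), hu.integrable_exp.comp_add_left c, fun x x' => ?_,
    fun x x' => ?_, ?_⟩
  · simp only [hs x', hs x]
    exact (hu.integrable_log (c + x) (c + x')).comp_add_left c
  · simp only [hs x', hs x]
    rw [hu.sub_eq (c + x) (c + x'), ← integral_add_left_eq_self _ c]
  · have := hu.solAlpha_le
    rwa [solAlpha, ← integral_add_left_eq_self _ c] at this

theorem IsNormalSolution.not_forall_kelvinLE {u : E3 → ℝ} (hu : IsNormalSolution u) :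
    ¬∀ c l, KelvinLE (fun x => u (c + x)) l := by
  intro H
  have hle : ∀ x x' : E3, u x ≤ u x' := by
    intro x x'
    rcases eq_or_ne x' x with rfl | hne
    · rfl
    have hk : ∀ k : ℝ, 1 < k → u x ≤ u x' + 2 * log k := by
      intro k hk
      have hk1 : 0 < k ^ 2 - 1 := by nlinarith
      set p : E3 := (1 / (k ^ 2 - 1)) • (x' - x) with hp
      have hp0 : 0 < ‖p‖ := norm_pos_iff.mpr
        (smul_ne_zero (one_div_pos.mpr hk1).ne' (sub_ne_zero.mpr hne))
      have h := H (x - p) (k * ‖p‖) p ⟨hp0, by nlinarith⟩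
      rw [kelvin, sphereInv, mul_div_cancel_right₀ _ hp0.ne'] at h
      beta_reduce at h
      rw [sub_add_cancel] at h
      have hx' : x - p + k ^ 2 • p = x' := by
        have : (k ^ 2 - 1) • p = x' - x := by
          rw [hp, smul_smul, mul_one_div_cancel hk1.ne', one_smul]
        rw [sub_smul, one_smul] at this
        rw [← sub_eq_zero, ← sub_eq_zero.mpr this]
        abel
      rwa [hx'] at h
    have hc : ContinuousAt (fun k => u x' + 2 * log k) 1 := by fun_prop (disch := norm_num)
    have ht := hc.tendsto.mono_left (nhdsWithin_le_nhds (s := Set.Ioi 1))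
    simp only [log_one, mul_zero, add_zero] at ht
    exact ge_of_tendsto ht (eventually_nhdsWithin_of_forall hk)
  have hconst : (fun x => exp (3 * u x)) = fun _ => exp (3 * u 0) := by
    funext x
    rw [le_antisymm (hle x 0) (hle 0 x)]
  have hi := hu.integrable_exp
  rw [hconst, integrable_const_iff] at hi
  have := hi.resolve_left (exp_pos _).ne'
  exact (measure_lt_top (volume : Measure E3) Set.univ).ne (measure_univ_of_isAddLeftInvariant _)

theorem not_forall_kelvinLE_of_eq_kelvin {u : E3 → ℝ} (hu : Continuous u) {c₀ : E3} {l₀ : ℝ}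
    (hl₀ : 0 < l₀) (h₀ : ∀ p ≠ 0, u (c₀ + p) = kelvin (fun x => u (c₀ + x)) l₀ p) (c : E3) :
    ¬∀ l, KelvinLE (fun x => u (c + x)) l := by
  intro H
  obtain ⟨M, hM⟩ : ∃ M, ∀ w ∈ Metric.closedBall (0 : E3) 1, u (c₀ + w) ≤ M := by
    have hc : Continuous fun w => u (c₀ + w) := by fun_prop
    obtain ⟨M, hM⟩ := (isCompact_closedBall (0 : E3) 1).bddAbove_image hc.continuousOn
    exact ⟨M, fun w hw => hM (Set.mem_image_of_mem _ hw)⟩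
  set e : E3 := EuclideanSpace.single 0 1 with he
  have he1 : ‖e‖ = 1 := norm_single_one 0
  set δ := exp ((u (c + e) - M) / 2) with hδ
  have hδ0 : 0 < δ := exp_pos _
  obtain ⟨s, hs1, hs2, hs3, hs4⟩ : ∃ s : ℝ, 1 < s ∧ 2 * ‖c - c₀‖ < s ∧ 2 * l₀ ^ 2 < s ∧
      2 * l₀ / δ < s :=
    ((eventually_gt_atTop _).and ((eventually_gt_atTop _).and
      ((eventually_gt_atTop _).and (eventually_gt_atTop _)))).exists
  have h1 := H s e ⟨by rw [he1]; exact one_pos, by rwa [he1]⟩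
  rw [kelvin, sphereInv, he1, div_one] at h1
  set q : E3 := c - c₀ + s ^ 2 • e with hq
  have hss : s < s ^ 2 := by nlinarith
  have hqn : s ^ 2 / 2 ≤ ‖q‖ := by
    have h2 : ‖s ^ 2 • e‖ = s ^ 2 := by
      rw [norm_smul, he1, mul_one, norm_of_nonneg (by positivity)]
    have h3 := norm_sub_le q (c - c₀)
    rw [show q - (c - c₀) = s ^ 2 • e by rw [hq]; abel, h2] at h3
    linarith
  have hq0 : 0 < ‖q‖ := lt_of_lt_of_le (by positivity) hqn
  have h2 := h₀ q (norm_pos_iff.mp hq0)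
  rw [show c₀ + q = c + s ^ 2 • e by rw [hq]; abel, kelvin] at h2
  have h3 := hM (sphereInv l₀ q) (by
    rw [mem_closedBall_zero_iff, norm_sphereInv, div_le_one hq0]
    linarith)
  have h4 : (u (c + e) - M) / 2 ≤ log (l₀ * s / ‖q‖) := by
    rw [mul_comm l₀, mul_div_assoc, log_mul (by positivity) (by positivity)]
    linarith
  rw [le_log_iff_exp_le (by positivity), ← hδ] at h4
  rw [div_lt_iff₀ hδ0] at hs4
  rw [le_div_iff₀ hq0] at h4
  nlinarith [mul_le_mul_of_nonneg_left hqn hδ0.le]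

theorem IsNormalSolution.exists_eq_kelvin {u : E3 → ℝ} (hu : IsNormalSolution u) (c : E3) :
    ∃ l > 0, ∀ p ≠ 0, u (c + p) = kelvin (fun x => u (c + x)) l p := by
  by_cases h : ∀ c l, KelvinLE (fun x => u (c + x)) l
  · exact absurd h hu.not_forall_kelvinLE
  rw [not_forall] at h
  obtain ⟨c₀, hc₀⟩ := h
  obtain ⟨l₀, hl₀, h₀⟩ := (hu.comp_const_add c₀).kelvinLE_or_eq.resolve_left hc₀
  exact (hu.comp_const_add c).kelvinLE_or_eq.resolve_left
    (not_forall_kelvinLE_of_eq_kelvin hu.continuous hl₀ h₀ c)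

theorem kelvin_inv_smul (u : E3 → ℝ) {l t : ℝ} (hl : l ≠ 0) (ht : t ≠ 0) {z : E3} (hz : z ≠ 0) :
    kelvin u l (t⁻¹ • z) =
      u ((l ^ 2 * t / ‖z‖ ^ 2) • z) + 2 * log l + 2 * log t - log (‖z‖ ^ 2) := by
  have hz' : ‖z‖ ≠ 0 := norm_ne_zero_iff.mpr hz
  have ht' : |t| ≠ 0 := abs_ne_zero.mpr ht
  have hn : ‖t⁻¹ • z‖ = |t|⁻¹ * ‖z‖ := by rw [norm_smul, norm_inv, norm_eq_abs]
  have h1 : (l / (|t|⁻¹ * ‖z‖)) ^ 2 * t⁻¹ = l ^ 2 * t / ‖z‖ ^ 2 := by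
    rw [div_pow, mul_pow, inv_pow, sq_abs]
    field_simp
  rw [kelvin, sphereInv, hn, smul_smul, h1, log_div hl (by positivity),
    log_mul (by positivity) hz', log_inv, log_abs, log_pow]
  push_cast
  ring

/-- Invariance under two inversions relates the values and the derivatives at the centres. -/
theorem eq_and_fderiv_eq_of_eq_kelvin {u : E3 → ℝ} (hu : Differentiable ℝ u) {c : E3} {l l₀ : ℝ}
    (hl : 0 < l) (hl₀ : 0 < l₀) (h : ∀ p ≠ 0, u (c + p) = kelvin (fun x => u (c + x)) l p)
    (h₀ : ∀ p ≠ 0, u p = kelvin u l₀ p) {v : E3} (hv : v ≠ 0) :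
    u c + 2 * log l = u 0 + 2 * log l₀ ∧
      l ^ 2 * fderiv ℝ u c v = l₀ ^ 2 * fderiv ℝ u 0 v - 2 * inner ℝ v c := by
  have hv' : ‖v‖ ≠ 0 := norm_ne_zero_iff.mpr hv
  set G : ℝ → ℝ := fun t => (u (c + (l ^ 2 * t / ‖v‖ ^ 2) • v) + 2 * log l - log (‖v‖ ^ 2)) -
    (u ((l₀ ^ 2 * t / ‖v + t • c‖ ^ 2) • (v + t • c)) + 2 * log l₀ - log (‖v + t • c‖ ^ 2)) with hG
  have hz : HasDerivAt (fun t : ℝ => v + t • c) c 0 := by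
    simpa using ((hasDerivAt_id (0 : ℝ)).smul_const c).const_add v
  have hz0 : v + (0 : ℝ) • c = v := by simp
  have hn : HasDerivAt (fun t : ℝ => ‖v + t • c‖ ^ 2) (2 * inner ℝ v c) 0 := by
    simpa only [hz0] using hz.norm_sq
  have hnv : ‖v + (0 : ℝ) • c‖ ^ 2 ≠ 0 := by
    rw [hz0]
    positivity
  have hd1 : HasDerivAt (fun t : ℝ => c + (l ^ 2 * t / ‖v‖ ^ 2) • v)
      ((l ^ 2 / ‖v‖ ^ 2) • v) 0 := by
    refine (((((hasDerivAt_id (0 : ℝ)).const_mul (l ^ 2)).div_const (‖v‖ ^ 2)).smul_const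
      v).const_add c).congr_deriv ?_
    simp
  have hd2 : HasDerivAt (fun t : ℝ => (l₀ ^ 2 * t / ‖v + t • c‖ ^ 2) • (v + t • c))
      ((l₀ ^ 2 / ‖v‖ ^ 2) • v) 0 := by
    refine ((((hasDerivAt_id (0 : ℝ)).const_mul (l₀ ^ 2)).fun_div hn hnv).fun_smul hz).congr_deriv ?_
    simp only [id_eq, mul_zero, zero_div, zero_smul, zero_add, mul_one, zero_mul, sub_zero,
      add_zero]
    congr 1
    field_simp
  have hG' : HasDerivAt G (fderiv ℝ u c ((l ^ 2 / ‖v‖ ^ 2) • v) -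
      (fderiv ℝ u 0 ((l₀ ^ 2 / ‖v‖ ^ 2) • v) - 2 * inner ℝ v c / ‖v‖ ^ 2)) 0 := by
    have e1 : c + (l ^ 2 * (0 : ℝ) / ‖v‖ ^ 2) • v = c := by simp
    have e2 : (l₀ ^ 2 * (0 : ℝ) / ‖v + (0 : ℝ) • c‖ ^ 2) • (v + (0 : ℝ) • c) = 0 := by simp
    have a1 : HasDerivAt (fun t : ℝ => u (c + (l ^ 2 * t / ‖v‖ ^ 2) • v))
        (fderiv ℝ u c ((l ^ 2 / ‖v‖ ^ 2) • v)) 0 := by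
      refine HasFDerivAt.comp_hasDerivAt (l := u) (0 : ℝ) ?_ hd1
      rw [e1]
      exact (hu c).hasFDerivAt
    have a2 : HasDerivAt (fun t : ℝ => u ((l₀ ^ 2 * t / ‖v + t • c‖ ^ 2) • (v + t • c)))
        (fderiv ℝ u 0 ((l₀ ^ 2 / ‖v‖ ^ 2) • v)) 0 := by
      refine HasFDerivAt.comp_hasDerivAt (l := u) (0 : ℝ) ?_ hd2
      rw [e2]
      exact (hu 0).hasFDerivAt
    have a3 := hn.log hnv
    rw [hz0] at a3
    exact ((a1.add_const _).sub_const _).fun_sub ((a2.add_const _).fun_sub a3)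
  have hGz : ∀ᶠ t in nhdsWithin 0 {0}ᶜ, G t = 0 := by
    have hne : ∀ᶠ t in nhds (0 : ℝ), v + t • c ≠ 0 :=
      hz.continuousAt.eventually_ne (by rwa [hz0])
    filter_upwards [nhdsWithin_le_nhds hne, self_mem_nhdsWithin] with t ht ht0
    have ht0 : t ≠ 0 := ht0
    have b1 := h (t⁻¹ • v) (smul_ne_zero (inv_ne_zero ht0) hv)
    have b2 := h₀ (t⁻¹ • (v + t • c)) (smul_ne_zero (inv_ne_zero ht0) ht)
    rw [kelvin_inv_smul _ hl.ne' ht0 hv] at b1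
    rw [kelvin_inv_smul _ hl₀.ne' ht0 ht, smul_add, smul_smul, inv_mul_cancel₀ ht0, one_smul,
      add_comm, b1] at b2
    simp only [hG]
    linarith
  have hG0 : G 0 = 0 := by
    have h1 := hG'.continuousAt.tendsto.mono_left (nhdsWithin_le_nhds (s := {0}ᶜ))
    exact tendsto_nhds_unique_of_eventuallyEq h1 tendsto_const_nhds hGz
  constructor
  · simp only [hG, mul_zero, zero_div, zero_smul, add_zero] at hG0
    linarith
  · have hev : G =ᶠ[nhds 0] fun _ => 0 := by
      rw [← nhdsNE_sup_pure]
      exact eventually_sup.mpr ⟨hGz, hG0⟩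
    have h1 := (hG'.congr_of_eventuallyEq hev.symm).unique (hasDerivAt_const (0 : ℝ) (0 : ℝ))
    rw [map_smul, map_smul, smul_eq_mul, smul_eq_mul] at h1
    field_simp at h1
    linarith

/-- A function invariant under an inversion around every centre is, up to normalization,
the logarithm of a standard bubble. -/
theorem exists_eq_sub_log_of_eq_kelvin {u : E3 → ℝ} (hu : Differentiable ℝ u)
    (h : ∀ c, ∃ l > 0, ∀ p ≠ 0, u (c + p) = kelvin (fun x => u (c + x)) l p) :
    ∃ K b : ℝ, 0 < b ∧ ∃ x₀, ∀ x, u x = K - log (‖x - x₀‖ ^ 2 + b ^ 2) := by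
  choose l hl h using h
  have h₀ : ∀ p ≠ 0, u p = kelvin u (l 0) p := fun p hp => by simpa using h 0 p hp
  have hrel := fun c (v : E3) (hv : v ≠ 0) =>
    eq_and_fderiv_eq_of_eq_kelvin hu (hl c) (hl 0) (h c) h₀ hv
  set K := u 0 + 2 * log (l 0) with hK
  have hlc : ∀ c, exp (K - u c) = l c ^ 2 := fun c => by
    have := (hrel c (EuclideanSpace.single 0 1) (by simp)).1
    rw [← this, add_sub_cancel_left, show 2 * log (l c) = ((2 : ℕ) : ℝ) * log (l c) by simp,
      exp_nat_mul, exp_log (hl c)]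
  set D : E3 →L[ℝ] ℝ := (l 0 ^ 2) • fderiv ℝ u 0 with hD
  set N : E3 → ℝ := fun c => exp (K - u c) - ‖c‖ ^ 2 + D c with hN
  have hNd : ∀ c, HasFDerivAt N (exp (K - u c) • (-fderiv ℝ u c) - 2 • innerSL ℝ c + D) c :=
    fun c => (((((hu c).hasFDerivAt.const_sub K).exp)).sub
      (hasStrictFDerivAt_norm_sq c).hasFDerivAt).add D.hasFDerivAt
  have hN0 : ∀ c, N c = N 0 := fun c => by
    refine is_const_of_fderiv_eq_zero (fun x => (hNd x).differentiableAt) (fun x => ?_) c 0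
    rw [(hNd x).fderiv]
    ext v
    rcases eq_or_ne v 0 with rfl | hv
    · simp
    · have := (hrel x v hv).2
      simp only [hlc, hD, add_apply, sub_apply, neg_apply, smul_apply,
        innerSL_apply_apply, smul_eq_mul, nsmul_eq_mul, zero_apply]
      rw [real_inner_comm] at this
      push_cast
      linarith
  set x₀ : E3 := (1 / 2 : ℝ) • (InnerProductSpace.toDual ℝ E3).symm D with hx₀
  have hDx : ∀ x, D x = 2 * inner ℝ x x₀ := fun x => by
    rw [hx₀, real_inner_smul_right, real_inner_comm, InnerProductSpace.toDual_symm_apply]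
    ring
  have hexp : ∀ x, exp (K - u x) = ‖x - x₀‖ ^ 2 + (N 0 - ‖x₀‖ ^ 2) := fun x => by
    rw [← hN0 x, hN, norm_sub_sq_real]
    simp only [hDx]
    ring
  have hpos : 0 < N 0 - ‖x₀‖ ^ 2 := by
    have := hexp x₀
    rw [sub_self, norm_zero] at this
    have h2 := exp_pos (K - u x₀)
    linarith
  refine ⟨K, √(N 0 - ‖x₀‖ ^ 2), sqrt_pos.mpr hpos, x₀, fun x => ?_⟩
  rw [sq_sqrt hpos.le, ← hexp x, log_exp]
  ring

theorem IsNormalSolution.solAlpha_eq {u : E3 → ℝ} (hu : IsNormalSolution u) : solAlpha u = 2 := by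
  obtain ⟨l, hl, h⟩ := hu.exists_eq_kelvin 0
  simp only [zero_add] at h
  set p : E3 := (l / 2) • EuclideanSpace.single 0 1 with hp
  have hpn : ‖p‖ = l / 2 := by
    rw [hp, norm_smul, norm_single_one, mul_one, norm_of_nonneg (by positivity)]
  have hpB : p ∈ puncturedBall l := ⟨by rw [hpn]; positivity, by rw [hpn]; linarith⟩
  have h1 := (hu.kelvin_sub_eq hpB).2.2
  have h2 : ∫ w in puncturedBall l, kelvinKernel l p w * (exp (3 * kelvin u l w) - exp (3 * u w)) =
      0 := by
    refine (setIntegral_congr_fun (measurableSet_puncturedBall l) fun w hw => ?_).trans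
      (integral_zero _ _)
    have hw := (h w (ne_zero_of_mem_puncturedBall hw)).symm
    simp only [hw, sub_self, mul_zero]
  rw [h2, mul_zero, zero_add, ← h p (ne_zero_of_mem_puncturedBall hpB), sub_self, eq_comm,
    mul_eq_zero] at h1
  linarith [h1.resolve_right (log_div_norm_pos hpB).ne']

theorem integral_Ioi_sq_mul_inv_one_add_sq_cube :
    ∫ r in Set.Ioi (0 : ℝ), r ^ 2 * ((1 + r ^ 2) ^ 3)⁻¹ = π / 16 := by
  have hd : ∀ r ∈ Set.Ici (0 : ℝ), HasDerivAt
      (fun r => (arctan r + r * (r ^ 2 - 1) / (1 + r ^ 2) ^ 2) / 8)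
      (r ^ 2 * ((1 + r ^ 2) ^ 3)⁻¹) r := fun r _ => by
    have h0 : 1 + r ^ 2 ≠ 0 := by positivity
    have h1 : HasDerivAt (fun r : ℝ => r ^ 2) (2 * r) r := by simpa using hasDerivAt_pow 2 r
    refine (((hasDerivAt_arctan r).fun_add (((hasDerivAt_id r).fun_mul (h1.sub_const 1)).fun_div
      ((h1.const_add 1).fun_pow 2) (pow_ne_zero 2 h0))).div_const 8).congr_deriv ?_
    simp only [id_eq]
    field_simp
    ring
  have h1 : Tendsto (fun r : ℝ => r * (r ^ 2 - 1) / (1 + r ^ 2) ^ 2) atTop (nhds 0) := by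
    refine squeeze_zero_norm' ?_ tendsto_inv_atTop_zero
    filter_upwards [eventually_gt_atTop 0] with r hr
    rw [norm_eq_abs, abs_div, abs_mul, abs_of_pos hr, abs_of_pos (by positivity : 0 < (1 + r ^ 2) ^ 2),
      div_le_iff₀ (by positivity), inv_mul_eq_div, le_div_iff₀ hr]
    have : |r ^ 2 - 1| ≤ 1 + r ^ 2 := abs_le.mpr ⟨by nlinarith, by linarith⟩
    nlinarith
  have h2 := ((tendsto_arctan_atTop.mono_right nhdsWithin_le_nhds).add h1).div_const 8
  rw [integral_Ioi_of_hasDerivAt_of_nonneg' hd (fun r _ => by positivity) h2]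
  simp
  ring

theorem integral_inv_one_add_norm_sq_cube :
    ∫ x : E3, ((1 + ‖x‖ ^ 2) ^ 3)⁻¹ = π ^ 2 / 4 := by
  rw [integral_fun_norm_addHaar volume fun r => ((1 + r ^ 2) ^ 3)⁻¹, finrank_euclideanSpace_fin,
    measureReal_def, EuclideanSpace.volume_ball_fin_three, ENNReal.ofReal_one, one_pow, one_mul,
    ENNReal.toReal_ofReal (by positivity)]
  simp only [smul_eq_mul, nsmul_eq_mul, Nat.add_one_sub_one,
    integral_Ioi_sq_mul_inv_one_add_sq_cube]
  push_cast
  ring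

theorem integral_inv_norm_sub_sq_add_sq_cube (x₀ : E3) {b : ℝ} (hb : 0 < b) :
    ∫ x : E3, ((‖x - x₀‖ ^ 2 + b ^ 2) ^ 3)⁻¹ = (b ^ 3)⁻¹ * (π ^ 2 / 4) := by
  rw [integral_sub_right_eq_self (fun x : E3 => ((‖x‖ ^ 2 + b ^ 2) ^ 3)⁻¹) x₀,
    ← integral_inv_one_add_norm_sq_cube]
  have h1 := Measure.integral_comp_smul volume (fun x : E3 => ((‖x‖ ^ 2 + b ^ 2) ^ 3)⁻¹) b
  have h2 : ∀ x : E3, ((‖b • x‖ ^ 2 + b ^ 2) ^ 3)⁻¹ = (b ^ 6)⁻¹ * ((1 + ‖x‖ ^ 2) ^ 3)⁻¹ :=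
    fun x => by
      rw [norm_smul, norm_of_nonneg hb.le]
      field_simp
      ring
  simp only [h2] at h1
  rw [integral_const_mul, finrank_euclideanSpace_fin, abs_of_pos (by positivity), smul_eq_mul] at h1
  field_simp at h1 ⊢
  linarith

theorem IsNormalSolution.isSpherical {u : E3 → ℝ} (hu : IsNormalSolution u)
    (hd : Differentiable ℝ u) : IsSpherical u := by
  obtain ⟨K, b, hb, x₀, h⟩ := exists_eq_sub_log_of_eq_kelvin hd hu.exists_eq_kelvin
  have hα := hu.solAlpha_eq
  have hexp : ∀ x, exp (3 * u x) = exp K ^ 3 * ((‖x - x₀‖ ^ 2 + b ^ 2) ^ 3)⁻¹ := fun x => by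
    have : 0 < ‖x - x₀‖ ^ 2 + b ^ 2 := by positivity
    rw [h, show (3 : ℝ) = (3 : ℕ) by norm_num, exp_nat_mul, exp_sub, exp_log this]
    field_simp
  simp only [solAlpha, hexp] at hα
  rw [integral_const_mul, integral_inv_norm_sub_sq_add_sq_cube x₀ hb] at hα
  have h3 : exp K ^ 3 = (2 * b) ^ 3 := by
    field_simp at hα
    nlinarith
  have hK : exp K = 2 * b :=
    (pow_left_inj₀ (exp_pos K).le (by positivity) (by norm_num)).mp h3
  refine ⟨1 / b, by positivity, x₀, fun x => ?_⟩
  have hq : 0 < ‖x - x₀‖ ^ 2 + b ^ 2 := by positivity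
  rw [h, ← log_exp K, hK, ← log_div (by positivity) hq.ne']
  congr 1
  field_simp
  ring

theorem hasFDerivAt_one_add_mul_norm_sub_sq (k : ℝ) (x₀ x : E3) :
    HasFDerivAt (fun x => 1 + k * ‖x - x₀‖ ^ 2) ((2 * k) • innerSL ℝ (x - x₀)) x := by
  refine ((((hasStrictFDerivAt_norm_sq (x - x₀)).hasFDerivAt.comp x
    ((hasFDerivAt_id x).sub_const x₀)).const_mul k).const_add 1).congr_fderiv ?_
  ext v
  simp
  ring

theorem IsSpherical.scalar_curvature_eq {u : E3 → ℝ} (h : IsSpherical u) (x : E3) :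
    -2 * exp (-2 * u x) * (2 * lap u x + ‖gradient u x‖ ^ 2) = 6 := by
  obtain ⟨l, hl, x₀, h⟩ := h
  set q : E3 → ℝ := fun x => 1 + l ^ 2 * ‖x - x₀‖ ^ 2 with hq
  have hq0 : ∀ x, 0 < q x := fun x => by positivity
  have hqd : ∀ x, HasFDerivAt q ((2 * l ^ 2) • innerSL ℝ (x - x₀)) x :=
    hasFDerivAt_one_add_mul_norm_sub_sq (l ^ 2) x₀
  have hu : u = fun x => log (2 * l) - log (q x) := by
    funext x
    rw [h, ← log_div (by positivity) (hq0 x).ne']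
  have hpd : ∀ i, pd i u = fun x => -(2 * l ^ 2) * ((x - x₀) i * (q x)⁻¹) := fun i => by
    funext x
    rw [pd, hu, (((hqd x).log (hq0 x).ne').const_sub _).fderiv]
    simp only [neg_apply, smul_apply, innerSL_apply_apply, inner_single_one_right, smul_eq_mul]
    ring
  have hpd2 : ∀ i, pd i (pd i u) x =
      -(2 * l ^ 2) * ((q x)⁻¹ - 2 * l ^ 2 * (x - x₀) i ^ 2 * (q x ^ 2)⁻¹) := fun i => by
    have h1 : HasFDerivAt (fun x : E3 => (x - x₀) i) (EuclideanSpace.proj (𝕜 := ℝ) i : E3 →L[ℝ] ℝ)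
        x :=
      ((EuclideanSpace.proj (𝕜 := ℝ) i : E3 →L[ℝ] ℝ).hasFDerivAt).comp x
        ((hasFDerivAt_id x).sub_const x₀)
    have h2 : HasFDerivAt (fun x => (q x)⁻¹) _ x :=
      (hasDerivAt_inv (hq0 x).ne').comp_hasFDerivAt x (hqd x)
    have h3 : (EuclideanSpace.proj (𝕜 := ℝ) i : E3 →L[ℝ] ℝ) (EuclideanSpace.single i 1) = 1 := by
      simp
    rw [pd, hpd, ((h1.fun_mul h2).const_mul _).fderiv]
    simp only [add_apply, smul_apply, innerSL_apply_apply, inner_single_one_right, smul_eq_mul,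
      h3]
    ring
  have hr : l ^ 2 * ∑ i, (x - x₀) i ^ 2 = q x - 1 := by
    rw [← norm_sq_eq_sum, hq]
    ring
  have hexp : exp (-2 * u x) = q x ^ 2 / (2 * l) ^ 2 := by
    rw [hu, show -2 * (log (2 * l) - log (q x)) =
      ((2 : ℕ) : ℝ) * (log (q x) - log (2 * l)) by push_cast; ring, exp_nat_mul, exp_sub,
      exp_log (hq0 x), exp_log (by positivity), div_pow]
  have hqx := (hq0 x).ne'
  rw [norm_gradient_sq, lap_eq_sum_pd, hexp]
  simp only [hpd2]
  simp only [hpd, Fin.sum_univ_three] at hr ⊢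
  field_simp
  linear_combination (-6) * hr

/-- Theorem 4: a smooth finite-volume solution `u` of `(−Δ)^{3/2}u = 2e^{3u}` is spherical
if and only if the scalar curvature `R_{g_u} = −2e^{−2u}(2Δu + |∇u|²)` of `g_u = e^{2u}|dx|²`
satisfies `liminf_{|x|→∞} R_{g_u}(x) > −∞`. -/
theorem spherical_iff_liminf_scalar_curvature (u : E3 → ℝ) (hu : IsSolution u) :
    IsSpherical u ↔
      (⊥ : EReal) < Filter.liminf
        (fun x : E3 =>
          ((-2 * Real.exp (-2 * u x) * (2 * lap u x + ‖gradient u x‖ ^ 2) : ℝ) : EReal))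
        (Filter.comap (fun x : E3 => ‖x‖) Filter.atTop) := by
  refine ⟨fun h => ?_, fun h => ?_⟩
  · simp only [h.scalar_curvature_eq]
    have : (Filter.comap (fun x : E3 => ‖x‖) Filter.atTop).NeBot := by
      rw [comap_norm_atTop]
      infer_instance
    rw [liminf_const]
    exact EReal.bot_lt_coe 6
  · obtain ⟨C, -, hC⟩ := exists_le_of_bot_lt_liminf hu.1 h
    exact (hu.isNormalSolution hC).isSpherical (hu.1.differentiable (by simp))
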